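/- For every even integer k ≥ 14 and every index t ≥ 1, the dimensions of the spaces of Conway invariant weak and holomorphic Jacobi forms of weight k and index t satisfy dim J^{w,Co₀}_{k,Λ,t} − dim J^{Co₀}_{k,Λ,t} = δ_t, where δ_t = Σ_{v ∈ (S_t/Co₀)/tΛ} ⌈(v,v)/(2t)⌉. -/

import Mathlib

open Complex Matrix UpperHalfPlane
open scoped Manifold MatrixGroups Real Topology BigOperators

noncomputable section

/-- Vectors of the rank-24 lattice (coordinates w.r.t. a fixed basis). -/
abbrev LV := Fin 24 → ℤ

/-- Complexified vectors. -/
abbrev CV := Fin 24 → ℂ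

/-- The bilinear form attached to a Gram matrix `B`. -/
def pairZ (B : Matrix (Fin 24) (Fin 24) ℤ) (v u : LV) : ℤ := v ⬝ᵥ B.mulVec u

/-- The complex bilinear extension of the form. -/
def pairC (B : Matrix (Fin 24) (Fin 24) ℤ) (z w : CV) : ℂ :=
  z ⬝ᵥ ((B.map (Int.cast : ℤ → ℂ)).mulVec w)

/-- Inclusion of lattice vectors into complexified vectors. -/
def liftC (v : LV) : CV := fun i => (v i : ℂ)

/-- `B` is a Gram matrix of the Leech lattice: even, unimodular, positive definite of
rank 24, with no vectors of norm 2 (no roots). -/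
def IsLeech (B : Matrix (Fin 24) (Fin 24) ℤ) : Prop :=
  B.IsSymm ∧ B.det = 1 ∧ (∀ v : LV, v ≠ 0 → 0 < pairZ B v v) ∧
    (∀ v : LV, Even (pairZ B v v)) ∧ (∀ v : LV, pairZ B v v ≠ 2)

/-- The automorphism group `Co₀ = Aut(Λ)` of the lattice, as a set of integral matrices. -/
def ConwayGroup (B : Matrix (Fin 24) (Fin 24) ℤ) : Set (Matrix (Fin 24) (Fin 24) ℤ) :=
  {σ | IsUnit σ.det ∧ σᵀ * B * σ = B}

/-- Action of an integral matrix on complexified vectors. -/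
def actC (σ : Matrix (Fin 24) (Fin 24) ℤ) (z : CV) : CV :=
  (σ.map (Int.cast : ℤ → ℂ)).mulVec z

/-- `e(x) = exp(2πix)`. -/
def eC (x : ℂ) : ℂ := Complex.exp (2 * (Real.pi : ℂ) * Complex.I * x)

/-- The Fourier term `qⁿ ζ^ℓ`. -/
def fterm (B : Matrix (Fin 24) (Fin 24) ℤ) (n : ℕ) (ℓ : LV) (τ : UpperHalfPlane) (z : CV) : ℂ :=
  eC ((n : ℂ) * (τ : ℂ)) * eC (pairC B (liftC ℓ) z)

/-- Lower-left entry of `A ∈ SL(2,ℤ)`, as a complex number. -/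
def slc (A : SL(2, ℤ)) : ℂ := ((A : Matrix (Fin 2) (Fin 2) ℤ) 1 0 : ℤ)

/-- Lower-right entry of `A ∈ SL(2,ℤ)`, as a complex number. -/
def sld (A : SL(2, ℤ)) : ℂ := ((A : Matrix (Fin 2) (Fin 2) ℤ) 1 1 : ℤ)

/-- The automorphy factor `cτ + d`. -/
def jfactor (A : SL(2, ℤ)) (τ : UpperHalfPlane) : ℂ := slc A * (τ : ℂ) + sld A

/-- `φ : ℍ × (Λ⊗ℂ) → ℂ` is a Conway invariant weak Jacobi form of weight `k` and index `t`
with Fourier coefficients `f`. -/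
structure IsJacobiFormWith (B : Matrix (Fin 24) (Fin 24) ℤ) (k : ℤ) (t : ℕ)
    (φ : UpperHalfPlane → CV → ℂ) (f : ℕ → LV → ℂ) : Prop where
  holo_tau : ∀ z : CV, MDifferentiable 𝓘(ℂ) 𝓘(ℂ) fun τ : UpperHalfPlane => φ τ z
  holo_z : ∀ τ : UpperHalfPlane, Differentiable ℂ (φ τ)
  conway_invar : ∀ σ ∈ ConwayGroup B, ∀ (τ : UpperHalfPlane) (z : CV), φ τ (actC σ z) = φ τ z
  quasi_periodic : ∀ (x y : LV) (τ : UpperHalfPlane) (z : CV),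
    φ τ (z + (τ : ℂ) • liftC x + liftC y) =
      Complex.exp (-(t : ℂ) * (Real.pi : ℂ) * Complex.I * (pairZ B x x : ℂ) * (τ : ℂ)
        - 2 * (t : ℂ) * (Real.pi : ℂ) * Complex.I * pairC B (liftC x) z) * φ τ z
  modular : ∀ (A : SL(2, ℤ)) (τ : UpperHalfPlane) (z : CV),
    φ (A • τ) ((jfactor A τ)⁻¹ • z) =
      (jfactor A τ) ^ k *
        Complex.exp ((t : ℂ) * (Real.pi : ℂ) * Complex.I * slc A * pairC B z z / jfactor A τ) *
        φ τ z
  expansion : ∀ (τ : UpperHalfPlane) (z : CV),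
    HasSum (fun p : ℕ × LV => f p.1 p.2 * fterm B p.1 p.2 τ z) (φ τ z)

/-- Conway invariant weak Jacobi forms. -/
def IsWeakJacobiForm (B : Matrix (Fin 24) (Fin 24) ℤ) (k : ℤ) (t : ℕ)
    (φ : UpperHalfPlane → CV → ℂ) : Prop :=
  ∃ f, IsJacobiFormWith B k t φ f

/-- Conway invariant holomorphic Jacobi forms. -/
def IsHolJacobiForm (B : Matrix (Fin 24) (Fin 24) ℤ) (k : ℤ) (t : ℕ)
    (φ : UpperHalfPlane → CV → ℂ) : Prop :=
  ∃ f, IsJacobiFormWith B k t φ f ∧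
    ∀ (n : ℕ) (ℓ : LV), 2 * (n : ℤ) * t - pairZ B ℓ ℓ < 0 → f n ℓ = 0

/-- Modular forms of weight `k` on `SL₂(ℤ)`; the ring of all of them is `ℂ[E₄,E₆]`. -/
abbrev MForm (k : ℤ) := ModularForm (CongruenceSubgroup.Gamma 1) k

/-- The family `φ i` (of weights `w i`) freely generates the module of all forms satisfying
`P` over the ring `M_*(SL₂(ℤ)) = ℂ[E₄,E₆]` of modular forms on `SL₂(ℤ)`. -/
def FreelyGenerates (P : ℤ → (UpperHalfPlane → CV → ℂ) → Prop) {n : ℕ}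
    (w : Fin n → ℤ) (φ : Fin n → UpperHalfPlane → CV → ℂ) : Prop :=
  (∀ i, P (w i) (φ i)) ∧
  ∀ (k : ℤ) (ψ : UpperHalfPlane → CV → ℂ), P k ψ →
    ∃! g : (i : Fin n) → MForm (k - w i),
      ∀ (τ : UpperHalfPlane) (z : CV), ψ τ z = ∑ i, (g i) τ * φ i τ z

/-- The point `(aτ+b)/d` of the upper half-plane (for `a, d > 0`). -/
def heckePt (a d b : ℕ) (τ : UpperHalfPlane) : UpperHalfPlane :=
  if h : 0 < ((((a : ℂ) * (τ : ℂ) + (b : ℂ)) / (d : ℂ)).im) then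
    ⟨((a : ℂ) * (τ : ℂ) + (b : ℂ)) / (d : ℂ), h⟩ else τ

/-- The Hecke operator `T₋(m)` on Jacobi forms of weight `k`. -/
def heckeOp (k : ℤ) (m : ℕ) (φ : UpperHalfPlane → CV → ℂ) : UpperHalfPlane → CV → ℂ :=
  fun τ z => (m : ℂ)⁻¹ * ∑ d ∈ m.divisors, ∑ b ∈ Finset.range d,
    ((m / d : ℕ) : ℂ) ^ k * φ (heckePt (m / d) d b τ) (((m / d : ℕ) : ℂ) • z)

/-- The Jacobi theta function `Θ_Λ = A₁` of the lattice. -/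
def thetaLeech (B : Matrix (Fin 24) (Fin 24) ℤ) : UpperHalfPlane → CV → ℂ := fun τ z =>
  ∑' ℓ : LV, Complex.exp ((Real.pi : ℂ) * Complex.I * (pairZ B ℓ ℓ : ℂ) * (τ : ℂ)
    + 2 * (Real.pi : ℂ) * Complex.I * pairC B (liftC ℓ) z)

/-- `σ_k(n) = Σ_{d ∣ n} d^k`. -/
def sigmaNat (k n : ℕ) : ℕ := ∑ d ∈ n.divisors, d ^ k

/-- `A_t = σ₁₁(t)⁻¹ (A₁ | T₋(t))`, a holomorphic Jacobi form of weight 12 and index `t`. -/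
def Aform (B : Matrix (Fin 24) (Fin 24) ℤ) (t : ℕ) : UpperHalfPlane → CV → ℂ := fun τ z =>
  ((sigmaNat 11 t : ℂ))⁻¹ * heckeOp 12 t (thetaLeech B) τ z

/-- The quasimodular Eisenstein series `E₂`. -/
def E2 : UpperHalfPlane → ℂ := fun τ =>
  1 - 24 * ∑' n : ℕ, (sigmaNat 1 (n + 1) : ℂ) * eC (((n : ℂ) + 1) * (τ : ℂ))

/-- The discriminant cusp form `Δ(τ) = q ∏ (1-qⁿ)^24`. -/
def DeltaForm : UpperHalfPlane → ℂ := fun τ =>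
  eC (τ : ℂ) * ∏' n : ℕ, (1 - eC (((n : ℂ) + 1) * (τ : ℂ))) ^ 24

/-- `aτ`. -/
def scaleH (a : ℕ) (τ : UpperHalfPlane) : UpperHalfPlane := heckePt a 1 0 τ

/-- `(τ+j)/t`. -/
def sliceH (t j : ℕ) (τ : UpperHalfPlane) : UpperHalfPlane := heckePt 1 t j τ

/-- `f₂(τ) = (tE₂(tτ) - E₂(τ))/(t-1)`, a modular form of weight 2 on `Γ₀(t)`. -/
def f2w (t : ℕ) (τ : UpperHalfPlane) : ℂ := ((t : ℂ) * E2 (scaleH t τ) - E2 τ) / ((t : ℂ) - 1)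

/-- `B_t`, a holomorphic Jacobi form of weight 14 and index `t` (for `t` prime). -/
def Bform (B : Matrix (Fin 24) (Fin 24) ℤ) (t : ℕ) : UpperHalfPlane → CV → ℂ := fun τ z =>
  ((t : ℂ) ^ 12 / ((t : ℂ) ^ 12 - 1)) *
    (f2w t τ * thetaLeech B (scaleH t τ) ((t : ℂ) • z)
      - (t : ℂ) ^ (-13 : ℤ) *
        ∑ j ∈ Finset.range t, f2w t (sliceH t j τ) * thetaLeech B (sliceH t j τ) z)

/-- Fourier coefficients of `E₂`. -/
def e2coeff : ℕ → ℂ := fun m => if m = 0 then 1 else -24 * (sigmaNat 1 m : ℂ)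

/-- Fourier coefficients of the image `H_k(φ)` of the modified heat operator applied to a
Jacobi form of weight `k` and index `t` with Fourier coefficients `f`:
`H_k(φ) = 𝓗(φ) + ((12-k)/12)E₂φ` where `𝓗` multiplies `f(n,ℓ)` by `n - (ℓ,ℓ)/(2t)`. -/
def heatCoeff (B : Matrix (Fin 24) (Fin 24) ℤ) (k : ℤ) (t : ℕ) (f : ℕ → LV → ℂ) :
    ℕ → LV → ℂ := fun n ℓ =>
  ((n : ℂ) - (pairZ B ℓ ℓ : ℂ) / (2 * (t : ℂ))) * f n ℓ +
    ((12 - k : ℤ) : ℂ) / 12 * ∑ m ∈ Finset.range (n + 1), e2coeff m * f (n - m) ℓ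

/-- The function with Fourier coefficients `f`. -/
def fourierSeries (B : Matrix (Fin 24) (Fin 24) ℤ) (f : ℕ → LV → ℂ) :
    UpperHalfPlane → CV → ℂ := fun τ z =>
  ∑' p : ℕ × LV, f p.1 p.2 * fterm B p.1 p.2 τ z

/-- The family `Φ m = Φ_{12,m}` of Fourier–Jacobi coefficients of the Borcherds form `Φ₁₂`
at the Leech cusp:
`Δ(τ)·exp(−Σ_{m≥1}((Δ⁻¹A₁)|T₋(m))(τ,𝔷)e^{2πimω}) = Σ_{m≥0} Φ_{12,m}(τ,𝔷)e^{2πimω}`. -/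
def IsFJExpansionOfPhi12 (B : Matrix (Fin 24) (Fin 24) ℤ)
    (Φ : ℕ → UpperHalfPlane → CV → ℂ) : Prop :=
  ∀ (τ ω : UpperHalfPlane) (z : CV),
    HasSum (fun m : ℕ => Φ m τ z * eC ((m : ℂ) * (ω : ℂ)))
      (DeltaForm τ * Complex.exp
        (- ∑' m : ℕ, heckeOp 0 (m + 1) (fun σ w => thetaLeech B σ w / DeltaForm σ) τ z *
            eC (((m : ℂ) + 1) * (ω : ℂ))))

/-- `S_t`: the set of lattice vectors of minimal norm in their coset modulo `tΛ`. -/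
def minimalSet (B : Matrix (Fin 24) (Fin 24) ℤ) (t : ℕ) : Set LV :=
  {v | ∀ u : LV, (∃ w : LV, u = v + (t : ℤ) • w) → pairZ B v v ≤ pairZ B u u}

/-- `v` and `u` are conjugate modulo `tΛ` up to the Conway group. -/
def conjModT (B : Matrix (Fin 24) (Fin 24) ℤ) (t : ℕ) (v u : LV) : Prop :=
  ∃ σ ∈ ConwayGroup B, ∃ w : LV, v - σ.mulVec u = (t : ℤ) • w

/-- `s(t) = |(S_t/Co₀)/tΛ|`. -/
def sRank (B : Matrix (Fin 24) (Fin 24) ℤ) (t : ℕ) : ℕ :=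
  Nat.card (Quot (fun v u : minimalSet B t => conjModT B t v.1 u.1))

/-- `R` is a system of representatives for `(S_t/Co₀)/tΛ` (of minimal length). -/
def IsRepSystem (B : Matrix (Fin 24) (Fin 24) ℤ) (t : ℕ) (R : Finset LV) : Prop :=
  (↑R ⊆ minimalSet B t) ∧ ∀ v ∈ minimalSet B t, ∃! r, r ∈ R ∧ conjModT B t v r

/-- The Conway orbit of a lattice vector. -/
def orbitOf (B : Matrix (Fin 24) (Fin 24) ℤ) (v : LV) : Set LV :=
  {u | ∃ σ ∈ ConwayGroup B, u = σ.mulVec v}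

/-- `O` is a Conway orbit of Leech vectors of type `x` (i.e. norm `2x`) with `c` elements. -/
def OrbitData (B : Matrix (Fin 24) (Fin 24) ℤ) (O : Set LV) (x c : ℕ) : Prop :=
  (∃ v : LV, O = orbitOf B v) ∧ (∀ v ∈ O, pairZ B v v = 2 * (x : ℤ)) ∧ Nat.card O = c

/-- `W` is a `d`-dimensional subspace of the space of functions `ℍ × (Λ⊗ℂ) → ℂ`. -/
def SpanDimIs (W : (UpperHalfPlane → CV → ℂ) → Prop) (d : ℕ) : Prop :=
  ∃ φ : Fin d → UpperHalfPlane → CV → ℂ, (∀ i, W (φ i)) ∧ LinearIndependent ℂ φ ∧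
    ∀ ψ, W ψ → ∃ c : Fin d → ℂ, ψ = ∑ i, c i • φ i


/-! Part 1: q-expansions -/

def qq (τ : ℍ) : ℂ := eC (τ : ℂ)

lemma eC_add (x y : ℂ) : eC (x + y) = eC x * eC y := by
  unfold eC; rw [mul_add, Complex.exp_add]

lemma eC_neg (x : ℂ) : eC (-x) = (eC x)⁻¹ := by
  unfold eC; rw [mul_neg, Complex.exp_neg]

lemma eC_sub (x y : ℂ) : eC (x - y) = eC x / eC y := by
  unfold eC; rw [mul_sub, Complex.exp_sub]

lemma eC_ne_zero (x : ℂ) : eC x ≠ 0 := Complex.exp_ne_zero _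

lemma eC_zero : eC 0 = 1 := by simp [eC]

lemma eC_int (n : ℤ) : eC n = 1 := by
  unfold eC; rw [mul_comm]; exact Complex.exp_int_mul_two_pi_mul_I n

lemma eC_nat (n : ℕ) : eC n = 1 := by exact_mod_cast eC_int n

lemma eC_one : eC 1 = 1 := by exact_mod_cast eC_int 1

lemma eC_nat_mul (n : ℕ) (x : ℂ) : eC (n * x) = eC x ^ n := by
  unfold eC; rw [← Complex.exp_nat_mul]; ring_nf

lemma eC_int_mul (n : ℤ) (x : ℂ) : eC (n * x) = eC x ^ n := by
  unfold eC; rw [← Complex.exp_int_mul]; ring_nf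

lemma norm_eC (x : ℂ) : ‖eC x‖ = Real.exp (-(2 * π * x.im)) := by
  unfold eC; rw [Complex.norm_exp]; congr 1; simp

lemma qq_ne_zero (τ : ℍ) : qq τ ≠ 0 := eC_ne_zero _

lemma norm_qq (τ : ℍ) : ‖qq τ‖ = Real.exp (-(2 * π * τ.im)) := norm_eC _

lemma norm_qq_lt_one (τ : ℍ) : ‖qq τ‖ < 1 := by
  rw [norm_qq, Real.exp_lt_one_iff]
  have := τ.im_pos
  have := Real.pi_pos
  nlinarith [mul_pos Real.pi_pos τ.im_pos]

lemma exists_qq_eq {x : ℂ} (hx : x ≠ 0) (hx1 : ‖x‖ < 1) : ∃ τ : ℍ, qq τ = x := by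
  have hpi := Real.pi_pos
  have key : 2 * (π : ℂ) * Complex.I * (Complex.log x / (2 * (π : ℂ) * Complex.I)) =
      Complex.log x := by
    rw [mul_div_cancel₀]; simp [hpi.ne']
  have him : 0 < (Complex.log x / (2 * (π : ℂ) * Complex.I)).im := by
    have h := congrArg Complex.re key
    rw [Complex.log_re] at h
    simp at h
    have hl : Real.log ‖x‖ < 0 := Real.log_neg (norm_pos_iff.2 hx) hx1
    nlinarith
  refine ⟨⟨_, him⟩, ?_⟩
  change Complex.exp (2 * (π : ℂ) * Complex.I * (Complex.log x / (2 * (π : ℂ) * Complex.I))) = x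
  rw [key, Complex.exp_log hx]

lemma qParam_one_eq (τ : ℍ) : Function.Periodic.qParam 1 (τ : ℂ) = qq τ := by
  simp [Function.Periodic.qParam, qq, eC]

lemma qq_tendsto : Filter.Tendsto qq atImInfty (𝓝 0) := by
  have := (qParam_tendsto_atImInfty (h := 1) one_pos)
  refine Filter.Tendsto.congr (fun τ => qParam_one_eq τ) this

lemma HasSum.congr_of {α : Type*} {f g : α → ℂ} {a : ℂ} (h : HasSum f a) (e : ∀ n, g n = f n) :
    HasSum g a := (funext e : g = f) ▸ h

def HasQ (f : ℍ → ℂ) (a : PowerSeries ℂ) : Prop :=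
  ∀ τ, HasSum (fun n : ℕ => a.coeff n * qq τ ^ n) (f τ)

def evq (a : PowerSeries ℂ) (x : ℂ) : ℂ := ∑' n : ℕ, a.coeff n * x ^ n

lemma HasQ.eq_evq {f a} (h : HasQ f a) (τ : ℍ) : f τ = evq a (qq τ) := (h τ).tsum_eq.symm

lemma HasQ.hasSum_evq {f a} (h : HasQ f a) {x : ℂ} (hx : ‖x‖ < 1) :
    HasSum (fun n : ℕ => a.coeff n * x ^ n) (evq a x) := by
  by_cases h0 : x = 0
  · subst h0
    apply Summable.hasSum
    apply summable_of_ne_finset_zero (s := {0})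
    intro n hn; simp at hn; simp [hn]
  · obtain ⟨τ, rfl⟩ := exists_qq_eq h0 hx
    exact (h τ).summable.hasSum

lemma HasQ.fps {f a} (h : HasQ f a) : HasFPowerSeriesOnBall (evq a)
    (.ofScalars ℂ (fun n => a.coeff n)) 0 1 := by
  constructor
  · refine le_of_forall_lt_imp_le_of_dense fun r hr ↦ ?_
    lift r to NNReal using hr.ne_top
    apply FormalMultilinearSeries.le_radius_of_summable
    have hr' : ‖((r : ℝ) : ℂ)‖ < 1 := by simpa using hr
    simpa [smul_eq_mul, norm_mul, mul_comm, mul_left_comm, mul_assoc] using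
        (h.hasSum_evq hr').summable.norm
  · simp
  · intro y hy
    rw [← ENNReal.coe_one, Metric.eball_coe, NNReal.coe_one, mem_ball_zero_iff] at hy
    simpa [mul_comm] using h.hasSum_evq hy

lemma HasQ.contAt {f a} (h : HasQ f a) : ContinuousAt (evq a) 0 :=
  h.fps.hasFPowerSeriesAt.continuousAt

lemma evq_zero (a : PowerSeries ℂ) : evq a 0 = a.coeff 0 := by
  unfold evq
  rw [tsum_eq_single 0 (by intro n hn; simp [hn])]; simp

lemma HasQ.tendsto {f a} (h : HasQ f a) : Filter.Tendsto f atImInfty (𝓝 (a.coeff 0)) := by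
  have h1 := h.contAt.tendsto.comp qq_tendsto
  rw [evq_zero] at h1
  exact h1.congr fun τ => (h.eq_evq τ).symm

lemma HasQ.unique {f a b} (h : HasQ f a) (h' : HasQ f b) : a = b := by
  have e : evq a =ᶠ[𝓝 0] evq b := by
    have L := (h.contAt.eventuallyEq_nhds_iff_eventuallyEq_nhdsNE h'.contAt).mp
    apply L
    have : ∀ᶠ x : ℂ in 𝓝[≠] 0, ‖x‖ < 1 :=
      nhdsWithin_le_nhds (by filter_upwards [Metric.ball_mem_nhds (0 : ℂ) one_pos] with x hx; simpa using hx)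
    filter_upwards [this, self_mem_nhdsWithin] with x hx hx0
    obtain ⟨τ, rfl⟩ := exists_qq_eq hx0 hx
    rw [← h.eq_evq, ← h'.eq_evq]
  have := (h.fps.hasFPowerSeriesAt.congr e).eq_formalMultilinearSeries h'.fps.hasFPowerSeriesAt
  ext m
  simpa using congr_arg (FormalMultilinearSeries.coeff · m) this

lemma HasQ.congr {f g a} (h : HasQ f a) (e : ∀ τ, f τ = g τ) : HasQ g a :=
  fun τ => e τ ▸ h τ

lemma HasQ.add {f g a b} (h : HasQ f a) (h' : HasQ g b) : HasQ (fun τ => f τ + g τ) (a + b) :=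
  fun τ => by simpa [add_mul] using (h τ).add (h' τ)

lemma HasQ.sub {f g a b} (h : HasQ f a) (h' : HasQ g b) : HasQ (fun τ => f τ - g τ) (a - b) :=
  fun τ => by simpa [sub_mul] using (h τ).sub (h' τ)

lemma HasQ.smul {f a} (c : ℂ) (h : HasQ f a) : HasQ (fun τ => c * f τ) (c • a) :=
  fun τ => by simpa [mul_assoc] using (h τ).mul_left c

lemma HasQ.zero : HasQ (fun _ => 0) 0 := fun τ => by simpa using hasSum_zero

lemma HasQ.mul {f g a b} (h : HasQ f a) (h' : HasQ g b) : HasQ (fun τ => f τ * g τ) (a * b) := by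
  intro τ
  have h1 := (h τ).summable.norm
  have h2 := (h' τ).summable.norm
  have e := tsum_mul_tsum_eq_tsum_sum_antidiagonal_of_summable_norm h1 h2
  have s := (summable_norm_sum_mul_antidiagonal_of_summable_norm h1 h2).of_norm.hasSum
  rw [← e, (h τ).tsum_eq, (h' τ).tsum_eq] at s
  refine s.congr_of fun n => ?_
  rw [PowerSeries.coeff_mul, Finset.sum_mul]
  refine Finset.sum_congr rfl fun p hp => ?_
  rw [← Finset.HasAntidiagonal.mem_antidiagonal.1 hp]; ring

lemma HasQ.one : HasQ (fun _ => 1) 1 := fun τ => by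
  convert hasSum_ite_eq 0 (1 : ℂ) using 2 with n
  by_cases hn : n = 0 <;> simp [PowerSeries.coeff_one, hn]

lemma HasQ.pow {f a} (h : HasQ f a) (n : ℕ) : HasQ (fun τ => f τ ^ n) (a ^ n) := by
  induction n with
  | zero => simpa using HasQ.one
  | succ n ih => simpa [pow_succ] using ih.mul h

lemma HasQ.sum {ι : Type*} (s : Finset ι) {f : ι → ℍ → ℂ} {a : ι → PowerSeries ℂ}
    (h : ∀ i ∈ s, HasQ (f i) (a i)) : HasQ (fun τ => ∑ i ∈ s, f i τ) (∑ i ∈ s, a i) := by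
  classical
  induction s using Finset.induction_on with
  | empty => simpa using HasQ.zero
  | insert i s hi ih =>
    simp only [Finset.sum_insert hi]
    exact (h i (by simp)).add (ih fun j hj => h j (by simp [hj]))

lemma HasQ.prod {ι : Type*} (s : Finset ι) {f : ι → ℍ → ℂ} {a : ι → PowerSeries ℂ}
    (h : ∀ i ∈ s, HasQ (f i) (a i)) : HasQ (fun τ => ∏ i ∈ s, f i τ) (∏ i ∈ s, a i) := by
  classical
  induction s using Finset.induction_on with
  | empty => simpa using HasQ.one
  | insert i s hi ih =>
    simp only [Finset.prod_insert hi]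
    exact (h i (by simp)).mul (ih fun j hj => h j (by simp [hj]))

lemma HasQ.qq : HasQ _root_.qq PowerSeries.X := fun τ => by
  convert hasSum_ite_eq 1 (_root_.qq τ) using 2 with n
  by_cases hn : n = 1 <;> simp [PowerSeries.coeff_X, hn]

lemma HasQ.of_X_mul {f a} (h : HasQ (fun τ => _root_.qq τ * f τ) (PowerSeries.X * a)) : HasQ f a := by
  intro τ
  have h1 := h τ
  rw [hasSum_iff_hasSum_of_ne_zero_bij (g := fun n : ℕ => _root_.qq τ * (a.coeff n * _root_.qq τ ^ n))
    (i := fun n => n.1 + 1)] at h1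
  · have := h1.mul_left (_root_.qq τ)⁻¹
    simpa [← mul_assoc, qq_ne_zero] using this
  · intro x y hxy; simpa [Subtype.ext_iff] using hxy
  · intro n hn
    rcases n with _ | n
    · simp at hn
    · refine ⟨⟨n, ?_⟩, rfl⟩
      simp only [Function.mem_support] at hn ⊢
      rw [PowerSeries.coeff_succ_X_mul] at hn
      simp [qq_ne_zero] at hn ⊢; exact hn
  · intro n
    rw [PowerSeries.coeff_succ_X_mul]; ring

lemma HasQ.of_X_pow_mul {f a} (n : ℕ)
    (h : HasQ (fun τ => _root_.qq τ ^ n * f τ) (PowerSeries.X ^ n * a)) : HasQ f a := by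
  induction n with
  | zero => simpa using h
  | succ n ih =>
    apply ih
    apply HasQ.of_X_mul
    have e1 : (PowerSeries.X * (PowerSeries.X ^ n * a) : PowerSeries ℂ) = PowerSeries.X ^ (n + 1) * a := by ring
    rw [e1]; exact h.congr fun τ => by ring

lemma qq_vadd (τ : ℍ) : qq ((1 : ℝ) +ᵥ τ) = qq τ := by
  simp [qq, UpperHalfPlane.coe_vadd, eC_add, eC_one]

lemma periodic_ofComplex {f : ℍ → ℂ} (hf : ∀ τ : ℍ, f ((1 : ℝ) +ᵥ τ) = f τ) :
    Function.Periodic (f ∘ ofComplex) 1 := by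
  intro w
  by_cases hw : 0 < w.im
  · have h2 : 0 < (w + 1).im := by simpa using hw
    simp only [Function.comp, ofComplex_apply_of_im_pos hw, ofComplex_apply_of_im_pos h2]
    rw [← hf ⟨w, hw⟩]; congr 1; ext; simp [UpperHalfPlane.coe_vadd, add_comm]
  · have h2 : ¬ 0 < (w + 1).im := by simpa using hw
    simp only [Function.comp]
    rw [ofComplex_apply_of_im_nonpos (by simpa using hw), ofComplex_apply_of_im_nonpos (by simpa using hw)]

lemma exists_hasQ {f : ℍ → ℂ} (hf : MDifferentiable 𝓘(ℂ) 𝓘(ℂ) f)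
    (hp : ∀ τ : ℍ, f ((1 : ℝ) +ᵥ τ) = f τ) (hb : IsBoundedAtImInfty f) : ∃ a, HasQ f a := by
  refine ⟨qExpansion 1 f, fun τ => ?_⟩
  have := hasSum_qExpansion one_pos (by simpa using periodic_ofComplex hp) hf hb τ
  simpa [qParam_one_eq] using this

lemma HasQ.bdd {f a} (h : HasQ f a) : IsBoundedAtImInfty f := h.tendsto.isBigO_one ℝ

lemma HasQ.periodic {f a} (h : HasQ f a) (τ : ℍ) : f ((1 : ℝ) +ᵥ τ) = f τ := by
  rw [h.eq_evq, h.eq_evq, qq_vadd]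

lemma mdiff_iff {f : ℍ → ℂ} : MDifferentiable 𝓘(ℂ) 𝓘(ℂ) f ↔
    DifferentiableOn ℂ (f ∘ ofComplex) {z | 0 < z.im} := UpperHalfPlane.mdifferentiable_iff

lemma mdiff_of_comp {g : ℂ → ℂ} (hg : ∀ z : ℂ, 0 < z.im → DifferentiableAt ℂ g z) :
    MDifferentiable 𝓘(ℂ) 𝓘(ℂ) (fun τ : ℍ => g τ) := by
  rw [mdiff_iff]
  have : DifferentiableOn ℂ g {z | 0 < z.im} := fun z hz => (hg z hz).differentiableWithinAt
  refine this.congr fun z hz => ?_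
  simp [ofComplex_apply_of_im_pos hz]

lemma differentiable_eC : Differentiable ℂ eC := by unfold eC; fun_prop

lemma HasQ.mdiff {f a} (h : HasQ f a) : MDifferentiable 𝓘(ℂ) 𝓘(ℂ) f := by
  have := mdiff_of_comp (g := fun z => evq a (eC z)) (fun z hz => by
    refine DifferentiableAt.comp (g := evq a) z ?_ differentiable_eC.differentiableAt
    refine AnalyticAt.differentiableAt (f := evq a) (h.fps.analyticAt_of_mem ?_)
    rw [← ENNReal.coe_one, Metric.eball_coe, NNReal.coe_one, mem_ball_zero_iff]
    exact norm_qq_lt_one ⟨z, hz⟩)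
  convert this using 2 with τ
  exact h.eq_evq τ

lemma mdiff_mul {f g : ℍ → ℂ} (hf : MDifferentiable 𝓘(ℂ) 𝓘(ℂ) f) (hg : MDifferentiable 𝓘(ℂ) 𝓘(ℂ) g) :
    MDifferentiable 𝓘(ℂ) 𝓘(ℂ) (fun τ => f τ * g τ) := by
  rw [mdiff_iff] at *; exact hf.mul hg

lemma mdiff_add {f g : ℍ → ℂ} (hf : MDifferentiable 𝓘(ℂ) 𝓘(ℂ) f) (hg : MDifferentiable 𝓘(ℂ) 𝓘(ℂ) g) :
    MDifferentiable 𝓘(ℂ) 𝓘(ℂ) (fun τ => f τ + g τ) := by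
  rw [mdiff_iff] at *; exact hf.add hg

lemma mdiff_const (c : ℂ) : MDifferentiable 𝓘(ℂ) 𝓘(ℂ) (fun _ : ℍ => c) := by
  rw [mdiff_iff]; exact differentiableOn_const c

lemma mdiff_sum {ι : Type*} (s : Finset ι) {f : ι → ℍ → ℂ}
    (hf : ∀ i ∈ s, MDifferentiable 𝓘(ℂ) 𝓘(ℂ) (f i)) :
    MDifferentiable 𝓘(ℂ) 𝓘(ℂ) (fun τ => ∑ i ∈ s, f i τ) := by
  simp only [mdiff_iff] at *
  exact DifferentiableOn.fun_sum hf

lemma mdiff_prod {ι : Type*} (s : Finset ι) {f : ι → ℍ → ℂ}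
    (hf : ∀ i ∈ s, MDifferentiable 𝓘(ℂ) 𝓘(ℂ) (f i)) :
    MDifferentiable 𝓘(ℂ) 𝓘(ℂ) (fun τ => ∏ i ∈ s, f i τ) := by
  classical
  induction s using Finset.induction_on with
  | empty => simpa using mdiff_const 1
  | insert i s hi ih =>
    simp only [Finset.prod_insert hi]
    exact mdiff_mul (hf i (by simp)) (ih fun j hj => hf j (by simp [hj]))

lemma mdiff_inv {f : ℍ → ℂ} (hf : MDifferentiable 𝓘(ℂ) 𝓘(ℂ) f) (h0 : ∀ τ, f τ ≠ 0) :
    MDifferentiable 𝓘(ℂ) 𝓘(ℂ) (fun τ => (f τ)⁻¹) := by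
  rw [mdiff_iff] at *; exact hf.inv (fun z _ => h0 _)

lemma mdiff_pow {f : ℍ → ℂ} (hf : MDifferentiable 𝓘(ℂ) 𝓘(ℂ) f) (n : ℕ) :
    MDifferentiable 𝓘(ℂ) 𝓘(ℂ) (fun τ => f τ ^ n) := by
  rw [mdiff_iff] at *; exact hf.pow n

lemma mdiff_eC (c : ℂ) : MDifferentiable 𝓘(ℂ) 𝓘(ℂ) (fun τ : ℍ => eC (c * τ)) :=
  mdiff_of_comp (g := fun z => eC (c * z)) fun z _ =>
    (differentiable_eC.comp (differentiable_id.const_mul c)).differentiableAt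

/-- removable version: `q f → 0` -/
lemma exists_hasQ' {f : ℍ → ℂ} (hf : MDifferentiable 𝓘(ℂ) 𝓘(ℂ) f)
    (hp : ∀ τ : ℍ, f ((1 : ℝ) +ᵥ τ) = f τ)
    (hb : Filter.Tendsto (fun τ => qq τ * f τ) atImInfty (𝓝 0)) : ∃ a, HasQ f a := by
  have hq : MDifferentiable 𝓘(ℂ) 𝓘(ℂ) qq := HasQ.qq.mdiff
  obtain ⟨b, hb'⟩ := exists_hasQ (f := fun τ => qq τ * f τ) (mdiff_mul hq hf)
    (fun τ => by rw [qq_vadd, hp]) (hb.isBigO_one ℝ)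
  have h0 : b.coeff 0 = 0 := tendsto_nhds_unique hb'.tendsto hb
  obtain ⟨a, rfl⟩ := PowerSeries.X_dvd_iff.2 (by simpa using h0)
  exact ⟨a, hb'.of_X_mul⟩

lemma HasQ.inv {f a} (h : HasQ f a) (h0 : ∀ τ, f τ ≠ 0) (ha : a.coeff 0 ≠ 0) :
    HasQ (fun τ => (f τ)⁻¹) a⁻¹ := by
  have ht := h.tendsto.inv₀ ha
  obtain ⟨b, hb⟩ := exists_hasQ (f := fun τ => (f τ)⁻¹) (mdiff_inv h.mdiff h0)
    (fun τ => by rw [h.periodic]) (ht.isBigO_one ℝ)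
  have := (h.mul hb).unique (HasQ.one.congr fun τ => (mul_inv_cancel₀ (h0 τ)).symm)
  have e : b = a⁻¹ := by
    rw [PowerSeries.eq_inv_iff_mul_eq_one (by simpa using ha), mul_comm]; exact this
  exact e ▸ hb

lemma HasQ.eq_zero_iff {f a} (h : HasQ f a) : (∀ τ, f τ = 0) ↔ a = 0 := by
  constructor
  · intro h0; exact (h.congr h0).unique HasQ.zero
  · rintro rfl τ; exact (h τ).unique (by simpa using hasSum_zero)

/-! Part 2: scalar modular forms -/

lemma jfactor_eq (A : SL(2, ℤ)) (τ : ℍ) : jfactor A τ = UpperHalfPlane.denom A τ := by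
  rw [ModularGroup.denom_apply]; rfl

lemma jfactor_ne_zero (A : SL(2, ℤ)) (τ : ℍ) : jfactor A τ ≠ 0 := by
  rw [jfactor_eq]; exact UpperHalfPlane.denom_ne_zero _ _

lemma jfactor_mul (A C : SL(2, ℤ)) (τ : ℍ) :
    jfactor (A * C) τ = jfactor A (C • τ) * jfactor C τ := by
  rw [jfactor_eq, jfactor_eq, jfactor_eq]
  have := UpperHalfPlane.denom_cocycle (A : GL (Fin 2) ℝ) (C : GL (Fin 2) ℝ) τ.im_ne_zero
  rw [← UpperHalfPlane.coe_smul_of_det_pos (by simp)] at this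
  simpa using this

lemma jfactor_one (τ : ℍ) : jfactor 1 τ = 1 := by simp [jfactor, slc, sld]

lemma jfactor_S (τ : ℍ) : jfactor ModularGroup.S τ = τ := by
  simp [jfactor, slc, sld, ModularGroup.S]

lemma jfactor_T (τ : ℍ) : jfactor ModularGroup.T τ = 1 := by
  simp [jfactor, slc, sld, ModularGroup.T]

lemma jfactor_neg (A : SL(2, ℤ)) (τ : ℍ) : jfactor (-A) τ = - jfactor A τ := by
  simp [jfactor, slc, sld]; ring

lemma T_smul (τ : ℍ) : ModularGroup.T • τ = (1 : ℝ) +ᵥ τ := UpperHalfPlane.modular_T_smul τ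

lemma coe_S_smul (τ : ℍ) : ((ModularGroup.S • τ : ℍ) : ℂ) = -1 / (τ : ℂ) := by
  rw [UpperHalfPlane.modular_S_smul]; simp [div_eq_mul_inv, inv_neg]

structure SM (w : ℤ) (f : ℍ → ℂ) (a : PowerSeries ℂ) : Prop where
  mod : ∀ (A : SL(2, ℤ)) (τ : ℍ), f (A • τ) = jfactor A τ ^ w * f τ
  q : HasQ f a

lemma SM.mul {w v f g a b} (h : SM w f a) (h' : SM v g b) :
    SM (w + v) (fun τ => f τ * g τ) (a * b) :=
  ⟨fun A τ => by rw [h.mod, h'.mod, zpow_add₀ (jfactor_ne_zero A τ)]; ring, h.q.mul h'.q⟩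

lemma SM.add {w f g a b} (h : SM w f a) (h' : SM w g b) :
    SM w (fun τ => f τ + g τ) (a + b) :=
  ⟨fun A τ => by rw [h.mod, h'.mod]; ring, h.q.add h'.q⟩

lemma SM.sub {w f g a b} (h : SM w f a) (h' : SM w g b) :
    SM w (fun τ => f τ - g τ) (a - b) :=
  ⟨fun A τ => by rw [h.mod, h'.mod]; ring, h.q.sub h'.q⟩

lemma SM.smul {w f a} (c : ℂ) (h : SM w f a) :
    SM w (fun τ => c * f τ) (c • a) :=
  ⟨fun A τ => by rw [h.mod]; ring, h.q.smul c⟩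

lemma SM.zero (w : ℤ) : SM w (fun _ => 0) 0 := ⟨fun A τ => by simp, HasQ.zero⟩

lemma SM.one : SM 0 (fun _ => 1) 1 := ⟨fun A τ => by simp, HasQ.one⟩

lemma SM.pow {w f a} (h : SM w f a) (n : ℕ) : SM (n * w) (fun τ => f τ ^ n) (a ^ n) := by
  refine ⟨fun A τ => ?_, h.q.pow n⟩
  rw [h.mod, mul_pow, mul_comm (n : ℤ) w, _root_.zpow_mul, zpow_natCast]

lemma SM.wt {w v f a} (h : SM w f a) (e : w = v) : SM v f a := e ▸ h

open scoped ModularForm in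
lemma slash_imp {f : ℍ → ℂ} {k : ℤ} {A : SL(2, ℤ)} (h : f ∣[k] A = f) (τ : ℍ) :
    f (A • τ) = jfactor A τ ^ k * f τ := by
  have := congrFun h τ
  rw [ModularForm.SL_slash_apply] at this
  rw [← this, jfactor_eq, mul_comm, mul_assoc, ← zpow_add₀ (UpperHalfPlane.denom_ne_zero _ _)]
  simp

open scoped ModularForm in
lemma MF_slash {F : Type*} [FunLike F ℍ ℂ] {k : ℤ} [ModularFormClass F 𝒮ℒ k] (f : F)
    (A : SL(2, ℤ)) : (f : ℍ → ℂ) ∣[k] A = f := by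
  exact SlashInvariantFormClass.slash_action_eq f _ ⟨A, rfl⟩

lemma SM_of_MF {F : Type*} [FunLike F ℍ ℂ] {k : ℤ} [ModularFormClass F 𝒮ℒ k] (f : F) :
    SM k f (qExpansion 1 f) := by
  refine ⟨fun A τ => slash_imp (MF_slash f A) τ, fun τ => ?_⟩
  have := ModularForm.hasSum_qExpansion f one_pos one_mem_strictPeriods_SL τ
  simpa [qParam_one_eq] using this

def e4 : ℍ → ℂ := ModularForm.E₄
def e6 : ℍ → ℂ := ModularForm.E₆
def dl : ℍ → ℂ := CuspForm.discriminant
def a4 : PowerSeries ℂ := qExpansion 1 ModularForm.E₄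
def a6 : PowerSeries ℂ := qExpansion 1 ModularForm.E₆

lemma sm_e4 : SM 4 e4 a4 := SM_of_MF _
lemma sm_e6 : SM 6 e6 a6 := SM_of_MF _
lemma a4_zero : a4.coeff 0 = 1 :=
  EisensteinSeries.E_qExpansion_coeff_zero _ (by decide)
lemma a6_zero : a6.coeff 0 = 1 :=
  EisensteinSeries.E_qExpansion_coeff_zero _ (by decide)

lemma dl_ne_zero (τ : ℍ) : dl τ ≠ 0 := ModularForm.discriminant_ne_zero τ

lemma dl_tendsto : Filter.Tendsto dl atImInfty (𝓝 0) := ModularForm.discriminant_isZeroAtImInfty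

lemma exists_u : ∃ u : PowerSeries ℂ, u.coeff 0 = 1 ∧ SM 12 dl (PowerSeries.X * u) := by
  have h : SM 12 dl (qExpansion 1 CuspForm.discriminant) := SM_of_MF _
  have h0 : (qExpansion 1 CuspForm.discriminant).coeff 0 = 0 :=
    tendsto_nhds_unique h.q.tendsto dl_tendsto
  obtain ⟨u, hu⟩ := PowerSeries.X_dvd_iff.2 (by simpa using h0)
  refine ⟨u, ?_, hu ▸ h⟩
  have h1 : (qExpansion 1 CuspForm.discriminant).coeff 1 = 1 :=
    ModularForm.discriminant_qExpansion_coeff_one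
  rw [show qExpansion 1 CuspForm.discriminant = _ from hu, show (1 : ℕ) = 0 + 1 from rfl, PowerSeries.coeff_succ_X_mul] at h1
  exact h1

def uu : PowerSeries ℂ := exists_u.choose
lemma uu_zero : uu.coeff 0 = 1 := exists_u.choose_spec.1
lemma sm_dl : SM 12 dl (PowerSeries.X * uu) := exists_u.choose_spec.2

lemma uu_q : HasQ (fun τ => (qq τ)⁻¹ * dl τ) uu := by
  apply HasQ.of_X_mul
  exact sm_dl.q.congr fun τ => by rw [mul_inv_cancel_left₀ (qq_ne_zero τ)]

lemma uu_ne : PowerSeries.constantCoeff uu ≠ 0 := by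
  rw [← PowerSeries.coeff_zero_eq_constantCoeff_apply, uu_zero]; exact one_ne_zero

lemma uu_mul_inv : uu * uu⁻¹ = 1 := PowerSeries.mul_inv_cancel _ uu_ne

lemma uuinv_q : HasQ (fun τ => qq τ * (dl τ)⁻¹) uu⁻¹ := by
  refine (uu_q.inv (fun τ => mul_ne_zero (inv_ne_zero (qq_ne_zero τ)) (dl_ne_zero τ)) ?_).congr ?_
  · rw [uu_zero]; exact one_ne_zero
  · intro τ; rw [mul_inv, inv_inv]

/-- vanishing lemma -/
lemma vanish {E : Type*} [NormedAddCommGroup E] [NormedSpace ℂ E] (b : ℍ → E) (n : ℕ)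
    (hhol : DifferentiableOn ℂ (b ∘ ofComplex) {z | 0 < z.im})
    (hmod : ∀ (A : SL(2, ℤ)) (τ : ℍ), ‖b (A • τ)‖ * ‖jfactor A τ‖ ^ n = ‖b τ‖)
    (h0 : Filter.Tendsto b atImInfty (𝓝 0)) (τ : ℍ) : b τ = 0 := by
  by_contra hne
  let g : ℍ → ℝ := fun τ => ‖b τ‖ ^ 12 * ‖dl τ‖ ^ n
  have hopen : IsOpen {z : ℂ | 0 < z.im} := UpperHalfPlane.isOpen_upperHalfPlaneSet
  have hbc : Continuous b := by
    have h1 := hhol.continuousOn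
    have : b = fun τ : ℍ => (b ∘ ofComplex) (τ : ℂ) := by funext τ; simp
    rw [this]
    exact h1.comp_continuous UpperHalfPlane.continuous_coe (fun τ => τ.im_pos)
  have hdc : Continuous dl := sm_dl.q.mdiff.continuous
  have hgc : Continuous g := by fun_prop
  have hginv : ∀ (A : SL(2, ℤ)) (τ : ℍ), g (A • τ) = g τ := by
    intro A τ
    simp only [g]
    rw [sm_dl.mod, ← hmod A τ, norm_mul, norm_zpow]
    have : ‖jfactor A τ‖ ^ (12 : ℤ) = ‖jfactor A τ‖ ^ 12 := by norm_cast
    rw [this]; ring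
  have hg0 : Filter.Tendsto g atImInfty (𝓝 0) := by
    have h1 : Filter.Tendsto (fun τ => ‖b τ‖ ^ 12) atImInfty (𝓝 0) := by
      simpa using (h0.norm.pow 12)
    have h2 : Filter.Tendsto (fun τ => ‖dl τ‖ ^ n) atImInfty (𝓝 (0 ^ n)) := by
      simpa using (dl_tendsto.norm.pow n)
    simpa using h1.mul h2
  have hgpos : 0 < g τ := mul_pos (pow_pos (norm_pos_iff.2 hne) _)
    (pow_pos (norm_pos_iff.2 (dl_ne_zero τ)) _)
  have hev := hg0.eventually (gt_mem_nhds hgpos)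
  obtain ⟨Y, hY⟩ := (atImInfty_mem _).1 hev
  obtain ⟨A1, hA1⟩ := ModularGroup.exists_smul_mem_fd τ
  have hin : ∀ σ : ℍ, σ ∈ ModularGroup.fd → g τ ≤ g σ →
      σ ∈ ModularGroup.truncatedFundamentalDomain Y := by
    intro σ hσ hle
    refine ⟨hσ, ?_⟩
    by_contra hlt
    have : g σ < g τ := hY σ (le_of_lt (not_le.1 hlt))
    linarith
  obtain ⟨τ0, hτ0, hmax⟩ := (ModularGroup.isCompact_truncatedFundamentalDomain Y).exists_isMaxOn
    ⟨A1 • τ, hin _ hA1 (hginv A1 τ).ge⟩ hgc.continuousOn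
  have hmax' : ∀ σ, g σ ≤ g τ0 := by
    intro σ
    obtain ⟨A, hA⟩ := ModularGroup.exists_smul_mem_fd σ
    have hττ : g τ ≤ g τ0 := by
      rw [← hginv A1 τ]; exact hmax (hin _ hA1 (hginv A1 τ).ge)
    rcases le_total (g τ) (g (A • σ)) with h | h
    · rw [← hginv A σ]; exact hmax (hin _ hA h)
    · rw [← hginv A σ]; exact h.trans hττ
  have hgτ0 : 0 < g τ0 := hgpos.trans_le (hmax' τ)
  have hb0 : ‖b τ0‖ ≠ 0 := by
    intro h; simp [g, h] at hgτ0
  obtain ⟨x, hx1, hx2⟩ := exists_dual_vector ℂ (b τ0) hb0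
  let f : ℂ → ℂ := fun z => (x (b (ofComplex z))) ^ 12 * (dl (ofComplex z)) ^ n
  have hf : DifferentiableOn ℂ f {z | 0 < z.im} := by
    refine DifferentiableOn.mul ?_ ?_
    · exact (x.differentiable.comp_differentiableOn hhol).pow 12
    · exact ((mdiff_iff.1 sm_dl.q.mdiff).pow n)
  have hfle : ∀ z, ‖f z‖ ≤ g (ofComplex z) := by
    intro z
    simp only [f, g, norm_mul, norm_pow]
    gcongr
    simpa [hx1] using x.le_opNorm (b (ofComplex z))
  have hf0 : ‖f τ0‖ = g τ0 := by
    simp [f, g, hx2]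
  have hM : IsMaxOn (norm ∘ f) {z : ℂ | 0 < z.im} (τ0 : ℂ) := by
    intro z _
    simp only [Set.mem_ofPred_eq, Function.comp]
    rw [hf0]; exact (hfle z).trans (hmax' _)
  have hpre : IsPreconnected {z : ℂ | 0 < z.im} := (convex_halfSpace_im_gt 0).isPreconnected
  have hconst := Complex.norm_eqOn_of_isPreconnected_of_isMaxOn hpre hopen hf τ0.im_pos hM
  have hge : ∀ σ : ℍ, g τ0 ≤ g σ := by
    intro σ
    have := hconst (σ.im_pos : (σ : ℂ) ∈ {z : ℂ | 0 < z.im})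
    simp only [Function.comp, Function.const] at this
    rw [hf0] at this
    rw [← this]
    simpa using hfle σ
  have h5 := hg0.eventually (gt_mem_nhds hgτ0)
  obtain ⟨σ, hσ⟩ := h5.exists
  linarith [hge σ]

lemma SM.neg_zero {n : ℕ} (hn : 0 < n) {f a} (h : SM (-(n : ℤ)) f a) (τ : ℍ) : f τ = 0 := by
  -- `f^12 Δ` has weight `12 - 12 n ≤ 0`
  have hs := (h.pow 12).mul sm_dl
  have := vanish (fun τ => f τ ^ 12 * dl τ) (12 * (n - 1)) (by
      exact mdiff_iff.1 hs.q.mdiff) (by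
      intro A τ
      rw [hs.mod, norm_mul, norm_zpow, mul_right_comm, ← zpow_natCast, ← zpow_add₀
        (norm_ne_zero_iff.2 (jfactor_ne_zero A τ))]
      have : ((12 : ℕ) : ℤ) * -(n : ℤ) + 12 + ((12 * (n - 1) : ℕ) : ℤ) = 0 := by
        push_cast [Nat.cast_sub hn]; ring
      rw [this]; simp) (by
      have := hs.q.tendsto
      convert this using 2
      rw [← mul_assoc, mul_comm _ PowerSeries.X, mul_assoc]
      simp) τ
  simpa [dl_ne_zero] using this

/-- the derivation `q d/dq` -/
def th (a : PowerSeries ℂ) : PowerSeries ℂ := PowerSeries.mk fun n => (n : ℂ) * a.coeff n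

lemma th_coeff (a : PowerSeries ℂ) (n : ℕ) : (th a).coeff n = n * a.coeff n := by simp [th]

lemma th_mul (a b : PowerSeries ℂ) : th (a * b) = th a * b + a * th b := by
  ext n
  simp only [th_coeff, PowerSeries.coeff_mul, map_add, Finset.mul_sum, ← Finset.sum_add_distrib]
  refine Finset.sum_congr rfl fun p hp => ?_
  rw [← Finset.HasAntidiagonal.mem_antidiagonal.1 hp]; push_cast; ring

lemma th_one : th 1 = 0 := by
  ext n; by_cases h : n = 0 <;> simp [th_coeff, PowerSeries.coeff_one, h]

lemma th_pow (a : PowerSeries ℂ) (n : ℕ) : th (a ^ (n + 1)) = ((n : ℂ) + 1) • (a ^ n * th a) := by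
  induction n with
  | zero => simp
  | succ n ih =>
    rw [pow_succ, th_mul, ih]
    simp only [PowerSeries.smul_eq_C_mul, map_add, map_one, Nat.cast_add, Nat.cast_one]; ring

lemma th_hasQ {f a} (h : HasQ f a) : HasQ (Derivative.normalizedDerivOfComplex f) (th a) := by
  intro τ
  have hx : ‖qq τ‖ < 1 := norm_qq_lt_one τ
  have hmem : (qq τ) ∈ Metric.eball (0 : ℂ) 1 := by
    rw [← ENNReal.coe_one, Metric.eball_coe, NNReal.coe_one, mem_ball_zero_iff]; exact hx
  have hd : HasDerivAt (evq a) (deriv (evq a) (qq τ)) (qq τ) :=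
    (AnalyticAt.differentiableAt (f := evq a) (h.fps.analyticAt_of_mem hmem)).hasDerivAt
  have hq : HasDerivAt eC (2 * (π : ℂ) * Complex.I * qq τ) (τ : ℂ) := by
    unfold eC
    have := ((hasDerivAt_id (τ : ℂ)).const_mul (2 * (π : ℂ) * Complex.I)).cexp
    simpa [qq, eC, mul_comm] using this
  have hcomp : HasDerivAt (f ∘ ofComplex) (deriv (evq a) (qq τ) * (2 * (π : ℂ) * Complex.I * qq τ)) (τ : ℂ) := by
    have h1 := HasDerivAt.comp (τ : ℂ) (h₂ := evq a) hd hq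
    refine h1.congr_of_eventuallyEq ?_
    filter_upwards [UpperHalfPlane.isOpen_upperHalfPlaneSet.mem_nhds τ.im_pos] with z hz
    simp only [Function.comp, ofComplex_apply_of_im_pos hz]
    exact h.eq_evq _
  have hval : Derivative.normalizedDerivOfComplex f τ = qq τ * deriv (evq a) (qq τ) := by
    unfold Derivative.normalizedDerivOfComplex
    rw [hcomp.deriv]; field_simp [Real.pi_ne_zero]
  rw [hval]
  have h2 := h.fps.fderiv.hasSum hmem
  have h3 := (ContinuousLinearMap.apply ℂ ℂ (qq τ)).hasSum h2
  simp only [ContinuousLinearMap.apply_apply, zero_add, fderiv_eq_smul_deriv, smul_eq_mul,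
    FormalMultilinearSeries.derivSeries_apply_diag] at h3
  rw [← hasSum_nat_add_iff' 1]
  simp only [Finset.range_one, Finset.sum_singleton, th_coeff, Nat.cast_zero, zero_mul, sub_zero]
  refine HasSum.congr_of h3 fun n => ?_
  simp [FormalMultilinearSeries.ofScalars]; ring

/-! Part 3: residue identity and scalar duality -/

open scoped ModularForm in
lemma sm_rc : SM 18 (fun τ => 4 * (e4 τ * Derivative.normalizedDerivOfComplex dl τ)
      - 12 * (dl τ * Derivative.normalizedDerivOfComplex e4 τ))
    ((4 : ℂ) • (a4 * th (PowerSeries.X * uu)) - (12 : ℂ) • (PowerSeries.X * uu * th a4)) := by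
  refine ⟨fun A τ => ?_, ((sm_e4.q.mul (th_hasQ sm_dl.q)).smul 4).sub
    ((sm_dl.q.mul (th_hasQ sm_e4.q)).smul 12)⟩
  have h4 : e4 ∣[(4 : ℤ)] A = e4 := MF_slash ModularForm.E₄ A
  have hd : dl ∣[(12 : ℤ)] A = dl := MF_slash CuspForm.discriminant A
  have s4 := slash_imp (Derivative.serreDerivative_slash_invariant sm_e4.q.mdiff h4) τ
  have sd := slash_imp (Derivative.serreDerivative_slash_invariant sm_dl.q.mdiff hd) τ
  have m4 := sm_e4.mod A τ
  have md := sm_dl.mod A τ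
  simp only [Derivative.serreDerivative_apply] at s4 sd
  have e1 : ∀ σ, 4 * (e4 σ * Derivative.normalizedDerivOfComplex dl σ)
      - 12 * (dl σ * Derivative.normalizedDerivOfComplex e4 σ) =
      4 * (e4 σ * (Derivative.normalizedDerivOfComplex dl σ -
        ((12 : ℤ) : ℂ) * 12⁻¹ * EisensteinSeries.E2 σ * dl σ))
      - 12 * (dl σ * (Derivative.normalizedDerivOfComplex e4 σ -
        ((4 : ℤ) : ℂ) * 12⁻¹ * EisensteinSeries.E2 σ * e4 σ)) := by
    intro σ; push_cast; ring
  rw [e1, e1, s4, sd, m4, md]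
  norm_num
  ring

lemma rc_eq : (4 : ℂ) • (a4 * th (PowerSeries.X * uu)) - (12 : ℂ) • (PowerSeries.X * uu * th a4)
    = (4 : ℂ) • (a6 * (PowerSeries.X * uu)) := by
  have thX : th (PowerSeries.X : PowerSeries ℂ) = PowerSeries.X := by
    ext n; by_cases h : n = 1 <;> simp [th_coeff, PowerSeries.coeff_X, h]
  set Y : PowerSeries ℂ := (4 : ℂ) • (a4 * (uu + th uu)) - (12 : ℂ) • (uu * th a4)
  have hY : (4 : ℂ) • (a4 * th (PowerSeries.X * uu)) - (12 : ℂ) • (PowerSeries.X * uu * th a4) =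
      PowerSeries.X * Y := by
    simp only [Y, th_mul, thX, PowerSeries.smul_eq_C_mul]; ring
  have hrc := sm_rc
  rw [hY] at hrc
  -- f = rc/Δ - 4 e6
  let g : ℍ → ℂ := fun τ => (4 * (e4 τ * Derivative.normalizedDerivOfComplex dl τ)
      - 12 * (dl τ * Derivative.normalizedDerivOfComplex e4 τ)) * (dl τ)⁻¹ - 4 * e6 τ
  have hgq : HasQ g (Y * uu⁻¹ - (4 : ℂ) • a6) := by
    refine HasQ.sub ?_ (sm_e6.q.smul 4)
    have h1 : HasQ (fun τ => (qq τ)⁻¹ * (4 * (e4 τ * Derivative.normalizedDerivOfComplex dl τ)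
      - 12 * (dl τ * Derivative.normalizedDerivOfComplex e4 τ))) Y := by
      apply HasQ.of_X_mul
      exact hrc.q.congr fun τ => by rw [mul_inv_cancel_left₀ (qq_ne_zero τ)]
    refine (h1.mul uuinv_q).congr fun τ => ?_
    have := qq_ne_zero τ
    field_simp
  have hg0 : (Y * uu⁻¹ - (4 : ℂ) • a6).coeff 0 = 0 := by
    have := a4_zero; have := a6_zero; have := uu_zero
    simp only [PowerSeries.coeff_zero_eq_constantCoeff_apply] at *
    have hth : ∀ a, PowerSeries.constantCoeff (th a) = 0 := fun a => by
      rw [← PowerSeries.coeff_zero_eq_constantCoeff_apply, th_coeff]; simp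
    have hs : ∀ (c : ℂ) (a : PowerSeries ℂ), PowerSeries.constantCoeff (c • a) =
        c * PowerSeries.constantCoeff a := fun c a => by
      rw [PowerSeries.smul_eq_C_mul]; simp
    simp [Y, hth, hs, *]
  have hgm : SM 6 g (Y * uu⁻¹ - (4 : ℂ) • a6) := by
    refine ⟨fun A τ => ?_, hgq⟩
    simp only [g]
    rw [hrc.mod, sm_dl.mod, sm_e6.mod, mul_inv]
    have hj := jfactor_ne_zero A τ
    rw [show (18 : ℤ) = 6 + 12 from rfl, zpow_add₀ hj]
    have : jfactor A τ ^ (12 : ℤ) ≠ 0 := zpow_ne_zero _ hj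
    field_simp
  obtain ⟨y, hy⟩ := PowerSeries.X_dvd_iff.2
    ((PowerSeries.coeff_zero_eq_constantCoeff_apply _).symm.trans hg0)
  have hfm : SM (-((6 : ℕ) : ℤ)) (fun τ => g τ * (dl τ)⁻¹) (y * uu⁻¹) := by
    constructor
    · intro A τ
      rw [hgm.mod, sm_dl.mod, mul_inv]
      have hj := jfactor_ne_zero A τ
      rw [show (6 : ℤ) = -((6 : ℕ) : ℤ) + 12 from rfl, zpow_add₀ hj]
      have : jfactor A τ ^ (12 : ℤ) ≠ 0 := zpow_ne_zero _ hj
      field_simp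
    · have h1 : HasQ (fun τ => (qq τ)⁻¹ * g τ) y := by
        apply HasQ.of_X_mul
        rw [← hy]
        exact hgm.q.congr fun τ => by rw [mul_inv_cancel_left₀ (qq_ne_zero τ)]
      refine (h1.mul uuinv_q).congr fun τ => ?_
      have := qq_ne_zero τ
      field_simp
  have hz : ∀ τ, g τ = 0 := fun τ => by
    have := hfm.neg_zero (by norm_num) τ
    simpa [dl_ne_zero] using this
  have h0 := hgm.q.eq_zero_iff.1 hz
  have h1 : Y * uu⁻¹ = (4 : ℂ) • a6 := sub_eq_zero.1 h0
  have h2 : Y = (4 : ℂ) • a6 * uu := by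
    rw [← h1, mul_assoc, mul_comm _ uu, uu_mul_inv, mul_one]
  rw [hY, h2]
  simp only [PowerSeries.smul_eq_C_mul]; ring

/-- residue identity -/
lemma residue (p : ℕ) : (a4 ^ (2 + 3 * p) * a6 * uu⁻¹ ^ (p + 1)).coeff (p + 1) = 0 := by
  have thX : th (PowerSeries.X : PowerSeries ℂ) = PowerSeries.X := by
    ext n; by_cases h : n = 1 <;> simp [th_coeff, PowerSeries.coeff_X, h]
  set v := uu⁻¹ with hv
  have huv : uu * v = 1 := uu_mul_inv
  have hthv : th v * uu + v * th uu = 0 := by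
    rw [← th_mul, mul_comm, huv, th_one]
  have hrc := rc_eq
  have hX : (PowerSeries.X : PowerSeries ℂ) ≠ 0 := PowerSeries.X_ne_zero
  have hrc2 : a4 * (uu + th uu) - 3 * (uu * th a4) = a6 * uu := by
    have hC4 : PowerSeries.C (R := ℂ) 4 ≠ 0 := by
      rw [map_ne_zero_iff _ PowerSeries.C_injective]; norm_num
    apply mul_left_cancel₀ (mul_ne_zero hX hC4)
    simp only [th_mul, thX, PowerSeries.smul_eq_C_mul] at hrc
    have c4 : PowerSeries.C (R := ℂ) 4 = 4 := map_ofNat _ 4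
    have c12 : PowerSeries.C (R := ℂ) 12 = 12 := map_ofNat _ 12
    rw [c4, c12] at hrc
    rw [c4]
    linear_combination hrc
  -- J = a4^3 v, th J = J - a4^2 a6 v
  have hJ : th (a4 ^ 3 * v) = a4 ^ 3 * v - a4 ^ 2 * a6 * v := by
    have h3 : th (a4 ^ 3) = 3 * (a4 ^ 2 * th a4) := by
      have := th_pow a4 2
      rw [this, PowerSeries.smul_eq_C_mul]
      have : PowerSeries.C (R := ℂ) (((2 : ℕ) : ℂ) + 1) = 3 := by
        rw [show (((2 : ℕ) : ℂ) + 1) = 3 by norm_num]; exact map_ofNat _ 3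
      rw [this]
    rw [th_mul, h3]
    have hv1 : th v = - (v * v * th uu) := by
      have : (th v * uu + v * th uu) * v = 0 := by rw [hthv, zero_mul]
      linear_combination this - th v * huv
    rw [hv1]
    linear_combination (-a4 ^ 2 * v ^ 2) * hrc2 +
      (a4 ^ 3 * v - a4 ^ 2 * a6 * v - 3 * a4 ^ 2 * v * th a4) * huv
  have hJp := th_pow (a4 ^ 3 * v) p
  rw [hJ] at hJp
  have e : a4 ^ (2 + 3 * p) * a6 * v ^ (p + 1) = (a4 ^ 3 * v) ^ (p + 1)
      - (a4 ^ 3 * v) ^ p * (a4 ^ 3 * v - a4 ^ 2 * a6 * v) := by ring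
  have hc := congrArg (fun s => PowerSeries.coeff (p + 1) s) hJp
  simp only [th_coeff, map_smul, smul_eq_mul] at hc
  rw [e, map_sub]
  push_cast at hc
  have hp : ((p : ℂ) + 1) ≠ 0 := by exact_mod_cast Nat.succ_ne_zero p
  have := mul_left_cancel₀ hp hc
  rw [this, sub_self]

lemma cc_a4 : PowerSeries.constantCoeff a4 = 1 := by
  rw [← PowerSeries.coeff_zero_eq_constantCoeff_apply, a4_zero]
lemma cc_a6 : PowerSeries.constantCoeff a6 = 1 := by
  rw [← PowerSeries.coeff_zero_eq_constantCoeff_apply, a6_zero]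
lemma cc_uu : PowerSeries.constantCoeff uu = 1 := by
  rw [← PowerSeries.coeff_zero_eq_constantCoeff_apply, uu_zero]
lemma cc_uui : PowerSeries.constantCoeff uu⁻¹ = 1 := by
  simp [cc_uu]

lemma coeff_X_pow_mul_self (n : ℕ) (y : PowerSeries ℂ) :
    (PowerSeries.X ^ n * y).coeff n = PowerSeries.constantCoeff y := by
  have := PowerSeries.coeff_X_pow_mul y n 0
  simpa using this

lemma even_weight (w : ℤ) (hw : Even w) : ∃ (a b : ℕ) (l : ℤ), a ≤ 2 ∧ b ≤ 1 ∧
    w = 4 * a + 6 * b + 12 * l := by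
  obtain ⟨v, rfl⟩ := hw
  have h6 : v % 6 = 0 ∨ v % 6 = 1 ∨ v % 6 = 2 ∨ v % 6 = 3 ∨ v % 6 = 4 ∨ v % 6 = 5 := by omega
  rcases h6 with h | h | h | h | h | h
  · exact ⟨0, 0, v / 6, by norm_num, by norm_num, by push_cast; omega⟩
  · exact ⟨2, 1, v / 6 - 1, by norm_num, by norm_num, by push_cast; omega⟩
  · exact ⟨1, 0, v / 6, by norm_num, by norm_num, by push_cast; omega⟩
  · exact ⟨0, 1, v / 6, by norm_num, by norm_num, by push_cast; omega⟩
  · exact ⟨2, 0, v / 6, by norm_num, by norm_num, by push_cast; omega⟩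
  · exact ⟨1, 1, v / 6, by norm_num, by norm_num, by push_cast; omega⟩

lemma duality (w : ℤ) (hw : Even w) (h : PowerSeries ℂ)
    (H : ∀ (N : ℕ) (f : ℍ → ℂ) (a : PowerSeries ℂ), SM (2 + 12 * N - w) f a →
      (h * a * uu⁻¹ ^ N).coeff N = 0) : ∃ g, SM w g h := by
  obtain ⟨a, b, l, ha, hb, rfl⟩ := even_weight w hw
  let tst : ℕ → PowerSeries ℂ := fun m => a4 ^ (2 - a + 3 * (m - 1 - l).toNat) * a6 ^ (1 - b)
  have htst : ∀ m : ℕ, l + 1 ≤ m → ∃ f, SM (2 + 12 * m - (4 * a + 6 * b + 12 * l)) f (tst m) := by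
    intro m hm
    refine ⟨_, ((sm_e4.pow (2 - a + 3 * (m - 1 - l).toNat)).mul (sm_e6.pow (1 - b))).wt ?_⟩
    push_cast [Nat.cast_sub ha, Nat.cast_sub hb, Int.toNat_of_nonneg (show 0 ≤ m - 1 - l by omega)]
    ring
  have key : ∀ n : ℕ, (n : ℤ) ≤ max (l + 1) 0 → ∃ g c, SM (4 * a + 6 * b + 12 * l) g c ∧
      PowerSeries.X ^ n ∣ h - c ∧
      ∀ m : ℕ, l + 1 ≤ m → (c * tst m * uu⁻¹ ^ m).coeff m = 0 := by
    intro n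
    induction n with
    | zero => intro _; exact ⟨_, 0, SM.zero _, by simp, by simp⟩
    | succ n ih =>
      intro hn
      push_cast at hn
      have hl : (n : ℤ) ≤ l := by omega
      obtain ⟨g, c, hg, ⟨y, hy⟩, hm⟩ := ih (by omega)
      set d := PowerSeries.constantCoeff y
      let s : PowerSeries ℂ := a4 ^ (a + 3 * (l - n).toNat) * a6 ^ b * (PowerSeries.X * uu) ^ n
      have hs : ∃ f, SM (4 * a + 6 * b + 12 * l) f s := by
        refine ⟨_, (((sm_e4.pow (a + 3 * (l - n).toNat)).mul (sm_e6.pow b)).mul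
          (sm_dl.pow n)).wt ?_⟩
        push_cast [Int.toNat_of_nonneg (show 0 ≤ l - n by omega)]
        ring
      obtain ⟨f, hf⟩ := hs
      refine ⟨_, _, hg.add (hf.smul d), ?_, ?_⟩
      · have : h - (c + d • s) = PowerSeries.X ^ n *
          (y - PowerSeries.C d * (a4 ^ (a + 3 * (l - n).toNat) * a6 ^ b * uu ^ n)) := by
          rw [← sub_sub, hy, PowerSeries.smul_eq_C_mul]; ring
        rw [this, pow_succ]
        apply mul_dvd_mul_left
        rw [PowerSeries.X_dvd_iff]
        simp [cc_a4, cc_a6, cc_uu, d]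
      · intro m hlm
        obtain ⟨p, rfl⟩ : ∃ p, m = n + (p + 1) := ⟨m - n - 1, by omega⟩
        have e : s * tst (n + (p + 1)) * uu⁻¹ ^ (n + (p + 1)) = PowerSeries.X ^ n *
            (a4 ^ (2 + 3 * p) * a6 * uu⁻¹ ^ (p + 1)) := by
          have hu : uu ^ n * uu⁻¹ ^ n = 1 := by rw [← mul_pow, uu_mul_inv, one_pow]
          have e1 : a4 ^ (a + 3 * (l - n).toNat) *
              a4 ^ (2 - a + 3 * (((n + (p + 1) : ℕ) : ℤ) - 1 - l).toNat) = a4 ^ (2 + 3 * p) := by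
            rw [← pow_add]; congr 1; push_cast; omega
          have e2 : a6 ^ b * a6 ^ (1 - b) = a6 := by
            rw [← pow_add]; rw [show b + (1 - b) = 1 by omega, pow_one]
          calc _ = PowerSeries.X ^ n * ((a4 ^ (a + 3 * (l - n).toNat) *
              a4 ^ (2 - a + 3 * (((n + (p + 1) : ℕ) : ℤ) - 1 - l).toNat)) *
              (a6 ^ b * a6 ^ (1 - b)) * uu⁻¹ ^ (p + 1)) * (uu ^ n * uu⁻¹ ^ n) := by
                simp only [s, tst]; ring
            _ = _ := by rw [e1, e2, hu, mul_one]
        have := hm _ hlm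
        rw [add_mul, add_mul, map_add, this, zero_add, smul_mul_assoc, smul_mul_assoc, e,
          map_smul, add_comm n, PowerSeries.coeff_X_pow_mul, residue, smul_zero]
  obtain ⟨g, c, hg, hdvd, hm⟩ := key (max (l + 1) 0).toNat (by omega)
  refine ⟨g, ?_⟩
  have : h - c = 0 := by
    ext m
    induction m using Nat.strong_induction_on with
    | _ m ih =>
    by_cases hlt : m < (max (l + 1) 0).toNat
    · simpa using PowerSeries.X_pow_dvd_iff.1 hdvd m hlt
    · have hd : PowerSeries.X ^ m ∣ h - c :=
        PowerSeries.X_pow_dvd_iff.2 (fun j hj => by simpa using ih j hj)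
      obtain ⟨y, hy⟩ := hd
      have hlm : l + 1 ≤ m := by omega
      obtain ⟨f, hf⟩ := htst m hlm
      have h1 := H m f _ hf
      have h2 := hm m hlm
      have h3 : ((h - c) * tst m * uu⁻¹ ^ m).coeff m = 0 := by
        rw [sub_mul, sub_mul, map_sub, h1, h2, sub_zero]
      rw [hy, mul_assoc, mul_assoc, coeff_X_pow_mul_self] at h3
      have h4 : PowerSeries.constantCoeff (tst m) = 1 := by simp [tst, cc_a4, cc_a6]
      rw [hy, coeff_X_pow_mul_self]
      simpa [h4, cc_uu] using h3
  rw [sub_eq_zero.1 this]; exact hg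

/-! ### Part 5: vector valued forms, Poincaré series -/

def XA (τ₀ : ℍ) (A : SL(2, ℤ)) (z : ℂ) : ℂ :=
  ((A 0 0 : ℤ) : ℂ) * z + ((A 0 1 : ℤ) : ℂ) - (starRingEnd ℂ) τ₀ * (((A 1 0 : ℤ) : ℂ) * z + ((A 1 1 : ℤ) : ℂ))

lemma coe_smul_eq (A : SL(2, ℤ)) (τ : ℍ) : ((A • τ : ℍ) : ℂ) * jfactor A τ =
    ((A 0 0 : ℤ) : ℂ) * τ + ((A 0 1 : ℤ) : ℂ) := by
  rw [UpperHalfPlane.coe_specialLinearGroup_apply]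
  have := jfactor_ne_zero A τ
  simp only [jfactor, slc, sld, algebraMap_int_eq, eq_intCast, ofReal_intCast] at *
  exact div_mul_cancel₀ _ this

lemma XA_eq (τ₀ : ℍ) (A : SL(2, ℤ)) (τ : ℍ) :
    XA τ₀ A τ = jfactor A τ * (((A • τ : ℍ) : ℂ) - (starRingEnd ℂ) τ₀) := by
  rw [mul_sub, mul_comm (jfactor A τ), coe_smul_eq]
  simp only [XA, jfactor, slc, sld]; ring

lemma norm_jf_le (τ₀ : ℍ) (A : SL(2, ℤ)) (τ : ℍ) : τ₀.im * ‖jfactor A τ‖ ≤ ‖XA τ₀ A τ‖ := by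
  rw [XA_eq, norm_mul, mul_comm]
  gcongr
  have h1 := Complex.abs_im_le_norm (((A • τ : ℍ) : ℂ) - (starRingEnd ℂ) τ₀)
  have h2 : (((A • τ : ℍ) : ℂ) - (starRingEnd ℂ) τ₀).im = (A • τ).im + τ₀.im := by simp
  rw [h2] at h1
  have := (A • τ).im_pos
  linarith [le_abs_self ((A • τ).im + τ₀.im)]

lemma XA_ne (τ₀ : ℍ) (A : SL(2, ℤ)) (τ : ℍ) : XA τ₀ A τ ≠ 0 := by
  have := norm_jf_le τ₀ A τ
  have h2 := norm_pos_iff.2 (jfactor_ne_zero A τ)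
  have h3 := τ₀.im_pos
  rw [← norm_pos_iff]
  exact lt_of_lt_of_le (by positivity) this

def slrow (A : SL(2, ℤ)) (i : Fin 2) : Fin 2 → ℤ := fun j => A i j

lemma row_ne (A : SL(2, ℤ)) (i : Fin 2) : slrow A i ≠ 0 := by
  intro h
  have hd := A.det_coe
  rw [Matrix.det_fin_two] at hd
  fin_cases i
  · have h0 := congrFun h 0
    have h1 := congrFun h 1
    simp [slrow] at h0 h1
    simp [h0, h1] at hd
  · have h0 := congrFun h 0
    have h1 := congrFun h 1
    simp [slrow] at h0 h1
    simp [h0, h1] at hd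

lemma one_le_row (A : SL(2, ℤ)) (i : Fin 2) : 1 ≤ ‖slrow A i‖ := by
  have h := row_ne A i
  obtain ⟨j, hj⟩ := Function.ne_iff.1 h
  refine le_trans ?_ (norm_le_pi_norm (slrow A i) j)
  rw [Int.norm_eq_abs]
  exact_mod_cast Int.one_le_abs hj

lemma XA_bound (τ₀ : ℍ) (P Q : ℝ) (hQ : 0 < Q) : ∃ C : ℝ, 0 < C ∧
    ∀ (A : SL(2, ℤ)) (τ : ℍ), τ ∈ verticalStrip P Q → ∀ i, ‖slrow A i‖ ≤ C * ‖XA τ₀ A τ‖ := by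
  set r := EisensteinSeries.r ⟨⟨P, Q⟩, hQ⟩ with hr
  have hr0 : 0 < r := EisensteinSeries.r_pos _
  have hy := τ₀.im_pos
  refine ⟨r⁻¹ * (1 + ‖(τ₀ : ℂ)‖ / τ₀.im + 1 / τ₀.im), by positivity, fun A τ hτ => ?_⟩
  have key : ∀ i, r * ‖slrow A i‖ ≤ ‖((A i 0 : ℤ) : ℂ) * τ + ((A i 1 : ℤ) : ℂ)‖ := fun i =>
    (mul_le_mul_of_nonneg_right (EisensteinSeries.r_lower_bound_on_verticalStrip τ hQ hτ)
      (norm_nonneg _)).trans (EisensteinSeries.r_mul_max_le τ (row_ne A i))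
  have h1 := norm_jf_le τ₀ A τ
  have hj : ‖jfactor A τ‖ ≤ ‖XA τ₀ A τ‖ / τ₀.im := by rw [le_div_iff₀ hy]; linarith
  have h0 : ‖((A 0 0 : ℤ) : ℂ) * τ + ((A 0 1 : ℤ) : ℂ)‖ ≤ (1 + ‖(τ₀ : ℂ)‖ / τ₀.im) * ‖XA τ₀ A τ‖ := by
    have e : ((A 0 0 : ℤ) : ℂ) * τ + ((A 0 1 : ℤ) : ℂ) = XA τ₀ A τ +
      (starRingEnd ℂ) τ₀ * jfactor A τ := by simp only [XA, jfactor, slc, sld]; ring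
    rw [e]
    refine (norm_add_le _ _).trans ?_
    rw [norm_mul, RCLike.norm_conj]
    have := mul_le_mul_of_nonneg_left hj (norm_nonneg (τ₀ : ℂ))
    calc _ ≤ ‖XA τ₀ A τ‖ + ‖(τ₀ : ℂ)‖ * (‖XA τ₀ A τ‖ / τ₀.im) := by linarith
      _ = _ := by ring
  have hX := norm_nonneg (XA τ₀ A τ)
  intro i
  rw [mul_assoc, ← div_eq_inv_mul, le_div_iff₀ hr0, mul_comm]
  refine (key i).trans ?_
  have hp : 0 ≤ 1 / τ₀.im * ‖XA τ₀ A τ‖ := by positivity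
  have hp2 : 0 ≤ (1 + ‖(τ₀ : ℂ)‖ / τ₀.im) * ‖XA τ₀ A τ‖ := by positivity
  fin_cases i
  · refine h0.trans ?_
    rw [add_mul _ (1 / τ₀.im)]; linarith
  · have : ‖jfactor A τ‖ ≤ _ := hj
    refine this.trans ?_
    rw [add_mul _ (1 / τ₀.im)]
    have : ‖XA τ₀ A τ‖ / τ₀.im = 1 / τ₀.im * ‖XA τ₀ A τ‖ := by ring
    linarith

lemma summable_rows {m : ℕ} (hm : 3 ≤ m) :
    Summable fun A : SL(2, ℤ) => (‖slrow A 0‖ ^ m * ‖slrow A 1‖ ^ m)⁻¹ := by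
  have h := EisensteinSeries.summable_one_div_norm_rpow (k := m) (by
    have : (3 : ℝ) ≤ m := by exact_mod_cast hm
    linarith)
  have h2 := Summable.mul_of_nonneg h h (fun x => by positivity) (fun x => by positivity)
  have h3 := h2.comp_injective (i := fun A : SL(2, ℤ) => (slrow A 0, slrow A 1)) (by
    intro A C h
    simp only [Prod.mk.injEq] at h
    ext i j
    fin_cases i
    · exact congrFun h.1 j
    · exact congrFun h.2 j)
  refine h3.congr fun A => ?_
  simp only [Function.comp]
  rw [Real.rpow_neg (norm_nonneg _), Real.rpow_neg (norm_nonneg _), Real.rpow_natCast,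
    Real.rpow_natCast, mul_inv]

lemma term_bound (τ₀ : ℍ) (P Q : ℝ) (hQ : 0 < Q) (m : ℕ) : ∃ C : ℝ, 0 < C ∧
    ∀ (A : SL(2, ℤ)) (τ : ℍ), τ ∈ verticalStrip P Q →
      ‖(XA τ₀ A τ ^ (2 * m))⁻¹‖ ≤ C * (‖slrow A 0‖ ^ m * ‖slrow A 1‖ ^ m)⁻¹ := by
  obtain ⟨C, hC, h⟩ := XA_bound τ₀ P Q hQ
  refine ⟨C ^ (2 * m), by positivity, fun A τ hτ => ?_⟩
  have h0 := one_le_row A 0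
  have h1 := one_le_row A 1
  have hX := norm_pos_iff.2 (XA_ne τ₀ A τ)
  rw [norm_inv, norm_pow, ← div_eq_mul_inv, le_div_iff₀ (by positivity), ← div_eq_inv_mul,
    div_le_iff₀ (by positivity), ← mul_pow C]
  calc ‖slrow A 0‖ ^ m * ‖slrow A 1‖ ^ m ≤ (C * ‖XA τ₀ A τ‖) ^ m * (C * ‖XA τ₀ A τ‖) ^ m := by
        gcongr <;> exact h A τ hτ _
    _ = (C * ‖XA τ₀ A τ‖) ^ (2 * m) := by rw [← pow_add, two_mul]

lemma sum_bdd {m : ℕ} (hm : 3 ≤ m) (τ₀ : ℍ) (d : SL(2, ℤ) → ℂ) (D : ℝ) (hd : ∀ A, ‖d A‖ ≤ D)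
    (P Q : ℝ) (hQ : 0 < Q) : ∃ u : SL(2, ℤ) → ℝ, Summable u ∧ ∀ A (τ : ℍ), τ ∈ verticalStrip P Q →
      ‖(XA τ₀ A τ ^ (2 * m))⁻¹ * d A‖ ≤ u A := by
  obtain ⟨C, hC, h⟩ := term_bound τ₀ P Q hQ m
  refine ⟨fun A => C * (‖slrow A 0‖ ^ m * ‖slrow A 1‖ ^ m)⁻¹ * D, ((summable_rows hm).mul_left C).mul_right D,
    fun A τ hτ => ?_⟩
  rw [norm_mul]
  exact mul_le_mul (h A τ hτ) (hd A) (norm_nonneg _) (by positivity)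

def poin (m : ℕ) (τ₀ : ℍ) (d : SL(2, ℤ) → ℂ) (τ : ℍ) : ℂ :=
  ∑' A : SL(2, ℤ), (XA τ₀ A τ ^ (2 * m))⁻¹ * d A

lemma poin_summable {m : ℕ} (hm : 3 ≤ m) (τ₀ : ℍ) (d : SL(2, ℤ) → ℂ) (D : ℝ) (hd : ∀ A, ‖d A‖ ≤ D)
    (τ : ℍ) : Summable fun A : SL(2, ℤ) => (XA τ₀ A τ ^ (2 * m))⁻¹ * d A := by
  obtain ⟨u, hu, h⟩ := sum_bdd hm τ₀ d D hd |τ.re| τ.im τ.im_pos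
  exact Summable.of_norm_bounded hu fun A => h A τ ⟨le_rfl, le_rfl⟩

lemma poin_mdiff {m : ℕ} (hm : 3 ≤ m) (τ₀ : ℍ) (d : SL(2, ℤ) → ℂ) (D : ℝ) (hd : ∀ A, ‖d A‖ ≤ D) :
    MDifferentiable 𝓘(ℂ) 𝓘(ℂ) (poin m τ₀ d) := by
  have := mdiff_of_comp (g := fun z => ∑' A : SL(2, ℤ), (XA τ₀ A z ^ (2 * m))⁻¹ * d A) ?_
  · exact this
  intro z hz
  obtain ⟨u, hu, h⟩ := sum_bdd hm τ₀ d D hd (|z.re| + 1) (z.im / 2) (by linarith)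
  have hU : IsOpen {w : ℂ | |w.re| < |z.re| + 1 ∧ z.im / 2 < w.im} :=
    (isOpen_lt (f := fun w : ℂ => |w.re|) (g := fun _ => |z.re| + 1) (by fun_prop) (by fun_prop)).inter
      (isOpen_lt (f := fun _ : ℂ => z.im / 2) (g := fun w => w.im) (by fun_prop) (by fun_prop))
  refine (differentiableOn_tsum_of_summable_norm hu (fun A w hw => ?_) hU (fun A w hw => ?_)).differentiableAt
    (hU.mem_nhds ⟨by linarith, by linarith⟩)
  · have hw0 : 0 < w.im := by have := hw.2; linarith
    have h0 := XA_ne τ₀ A ⟨w, hw0⟩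
    refine DifferentiableAt.differentiableWithinAt ?_
    refine DifferentiableAt.mul (DifferentiableAt.inv ?_ (pow_ne_zero _ h0)) (by fun_prop)
    unfold XA; fun_prop
  · have hw0 : 0 < w.im := by have := hw.2; linarith
    exact h A ⟨w, hw0⟩ ⟨hw.1.le, hw.2.le⟩

lemma poin_bdd {m : ℕ} (hm : 3 ≤ m) (τ₀ : ℍ) (d : SL(2, ℤ) → ℂ) (D : ℝ) (hd : ∀ A, ‖d A‖ ≤ D) :
    ∃ M, ∀ τ ∈ verticalStrip 1 1, ‖poin m τ₀ d τ‖ ≤ M := by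
  obtain ⟨u, hu, h⟩ := sum_bdd hm τ₀ d D hd 1 1 one_pos
  exact ⟨∑' A, u A, fun τ hτ => tsum_of_norm_bounded hu.hasSum fun A => h A τ hτ⟩

lemma XA_smul (τ₀ : ℍ) (A C : SL(2, ℤ)) (τ : ℍ) :
    XA τ₀ A ((C • τ : ℍ) : ℂ) = XA τ₀ (A * C) τ / jfactor C τ := by
  rw [XA_eq, XA_eq, jfactor_mul, mul_smul]
  have := jfactor_ne_zero C τ
  field_simp

lemma poin_smul (m : ℕ) (τ₀ : ℍ) (d : SL(2, ℤ) → ℂ) (C : SL(2, ℤ)) (τ : ℍ) :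
    poin m τ₀ d (C • τ) = jfactor C τ ^ (2 * m) * poin m τ₀ (fun A => d (A * C⁻¹)) τ := by
  unfold poin
  rw [← tsum_mul_left, ← (Equiv.mulRight C).tsum_eq (fun A => jfactor C τ ^ (2 * m) * _)]
  refine tsum_congr fun A => ?_
  simp only [Equiv.coe_mulRight, mul_inv_cancel_right]
  rw [XA_smul, div_pow, inv_div]
  have := jfactor_ne_zero C τ
  ring

lemma XA_id (τ₀ : ℍ) (A : SL(2, ℤ)) : ‖XA τ₀ A τ₀‖ ^ 2 =
    ‖jfactor A τ₀ * (((A • τ₀ : ℍ) : ℂ) - τ₀)‖ ^ 2 + (2 * τ₀.im) ^ 2 := by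
  have hd : (A 0 0 : ℝ) * A 1 1 - A 0 1 * A 1 0 = 1 := by
    have := A.det_coe
    rw [Matrix.det_fin_two] at this
    exact_mod_cast this
  have e : jfactor A τ₀ * (((A • τ₀ : ℍ) : ℂ) - τ₀) =
    ((A 0 0 : ℤ) : ℂ) * τ₀ + ((A 0 1 : ℤ) : ℂ) - τ₀ * (((A 1 0 : ℤ) : ℂ) * τ₀ + ((A 1 1 : ℤ) : ℂ)) := by
    rw [mul_sub, mul_comm (jfactor A τ₀), coe_smul_eq]; simp only [jfactor, slc, sld]; ring
  rw [e, XA, ← Complex.normSq_eq_norm_sq, ← Complex.normSq_eq_norm_sq, Complex.normSq_apply,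
    Complex.normSq_apply]
  simp
  linear_combination (4 * τ₀.im ^ 2) * hd

/-- the normalised coefficient -/
def cA (τ₀ : ℍ) (A : SL(2, ℤ)) : ℂ := 2 * Complex.I * τ₀.im / XA τ₀ A τ₀

lemma norm_cA (τ₀ : ℍ) (A : SL(2, ℤ)) : ‖cA τ₀ A‖ ≤ 1 := by
  have h := XA_id τ₀ A
  have hy := τ₀.im_pos
  have hX := norm_pos_iff.2 (XA_ne τ₀ A τ₀)
  unfold cA
  rw [norm_div, div_le_one hX]
  simp only [norm_mul, Complex.norm_I, Complex.norm_ofNat, Complex.norm_real, Real.norm_eq_abs, abs_of_pos hy]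
  nlinarith [sq_nonneg ‖jfactor A τ₀ * (((A • τ₀ : ℍ) : ℂ) - τ₀)‖]

lemma cA_sq (τ₀ : ℍ) (A : SL(2, ℤ)) (h : cA τ₀ A ^ 2 = 1) : A = 1 ∨ A = -1 := by
  have hid := XA_id τ₀ A
  have hy := τ₀.im_pos
  have hX := XA_ne τ₀ A τ₀
  have hsq : XA τ₀ A τ₀ ^ 2 = (2 * Complex.I * τ₀.im) ^ 2 := by
    unfold cA at h
    rw [div_pow, div_eq_one_iff_eq (pow_ne_zero _ hX)] at h
    exact h.symm
  have hn : ‖XA τ₀ A τ₀‖ ^ 2 = (2 * τ₀.im) ^ 2 := by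
    rw [← norm_pow, hsq, norm_pow]
    simp [abs_of_pos hy]
  have h0 : jfactor A τ₀ * (((A • τ₀ : ℍ) : ℂ) - τ₀) = 0 := by
    have : ‖jfactor A τ₀ * (((A • τ₀ : ℍ) : ℂ) - τ₀)‖ ^ 2 = 0 := by linarith
    simpa using this
  have hfix : ((A • τ₀ : ℍ) : ℂ) = τ₀ := by
    rcases mul_eq_zero.1 h0 with h | h
    · exact absurd h (jfactor_ne_zero _ _)
    · exact sub_eq_zero.1 h
  have hjs : jfactor A τ₀ ^ 2 = 1 := by
    rw [XA_eq, hfix, mul_pow] at hsq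
    have e : (τ₀ : ℂ) - (starRingEnd ℂ) τ₀ = 2 * Complex.I * τ₀.im := by
      apply Complex.ext <;> simp; ring
    rw [e] at hsq
    have : (2 * Complex.I * (τ₀.im : ℂ)) ^ 2 ≠ 0 := by
      simp [hy.ne']
    exact mul_right_cancel₀ this (by rw [hsq, one_mul])
  have hd := A.det_coe
  rw [Matrix.det_fin_two] at hd
  have hcs := coe_smul_eq A τ₀
  rw [hfix] at hcs
  have hjim : (jfactor A τ₀).im = A 1 0 * τ₀.im := by simp [jfactor, slc, sld]
  have hjre : (jfactor A τ₀).re = A 1 0 * τ₀.re + A 1 1 := by simp [jfactor, slc, sld]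
  have him := congrArg Complex.im hcs
  have hre := congrArg Complex.re hcs
  have fin : ∀ e : ℤ, jfactor A τ₀ = e → A 1 0 = 0 ∧ A 1 1 = e ∧ A 0 0 = e ∧ A 0 1 = 0 := by
    intro e h
    rw [h] at hjim hjre him hre
    simp at hjim hjre him hre
    have h10 : A 1 0 = 0 := by
      rcases hjim with h | h
      · exact h
      · exact absurd h hy.ne'
    have h00 : A 0 0 = e := by
      have : (e : ℝ) = A 0 0 := mul_right_cancel₀ hy.ne' (by linarith)
      exact_mod_cast this.symm
    rw [h10] at hjre
    rw [h00] at hre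
    simp at hjre
    refine ⟨h10, by exact_mod_cast hjre.symm, h00, ?_⟩
    have : (A 0 1 : ℝ) = 0 := by linarith
    exact_mod_cast this
  rcases sq_eq_one_iff.1 hjs with h | h
  · obtain ⟨h1, h2, h3, h4⟩ := fin 1 (by simpa using h)
    left; ext i j; fin_cases i <;> fin_cases j <;> simp [h1, h2, h3, h4]
  · obtain ⟨h1, h2, h3, h4⟩ := fin (-1) (by simpa using h)
    right; ext i j; fin_cases i <;> fin_cases j <;> simp [h1, h2, h3, h4]

lemma cA_one (τ₀ : ℍ) : cA τ₀ 1 ^ 2 = 1 := by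
  have hy := τ₀.im_pos
  have e : XA τ₀ 1 τ₀ = 2 * Complex.I * τ₀.im := by
    rw [XA_eq, jfactor_one, one_smul]
    apply Complex.ext <;> simp; ring
  unfold cA
  rw [e, div_self, one_pow]
  simp [hy.ne']

lemma cA_neg_one (τ₀ : ℍ) : cA τ₀ (-1) ^ 2 = 1 := by
  rw [← cA_one τ₀]
  have : XA τ₀ (-1) τ₀ = - XA τ₀ 1 τ₀ := by simp [XA]; ring
  unfold cA; rw [this, div_neg, neg_sq]

lemma cesaro {z : ℂ} (hz : ‖z‖ ≤ 1) : Filter.Tendsto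
    (fun M : ℕ => ((M : ℂ))⁻¹ * ∑ m ∈ Finset.range M, z ^ m) Filter.atTop
    (𝓝 (if z = 1 then 1 else 0)) := by
  split_ifs with h
  · subst h
    refine tendsto_const_nhds.congr' ?_
    filter_upwards [Filter.eventually_ne_atTop 0] with M hM
    have : (M : ℂ) ≠ 0 := by exact_mod_cast hM
    simp [this]
  · rw [tendsto_zero_iff_norm_tendsto_zero]
    have h1 : 0 < ‖z - 1‖ := norm_pos_iff.2 (sub_ne_zero.2 h)
    have hlim : Filter.Tendsto (fun M : ℕ => ((M : ℝ))⁻¹ * (2 / ‖z - 1‖)) Filter.atTop (𝓝 0) := by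
      simpa using (tendsto_inv_atTop_nhds_zero_nat (𝕜 := ℝ)).mul_const (2 / ‖z - 1‖)
    refine squeeze_zero (fun _ => norm_nonneg _) (fun M => ?_) hlim
    rw [norm_mul, norm_inv, Complex.norm_natCast, geom_sum_eq h, norm_div]
    gcongr
    calc _ ≤ ‖z ^ M‖ + ‖(1 : ℂ)‖ := norm_sub_le _ _
      _ ≤ 1 + 1 := by
        rw [norm_pow, norm_one]; gcongr; exact pow_le_one₀ (norm_nonneg _) hz
      _ = 2 := by norm_num

/-- Key averaging statement: if all Poincaré values vanish at `τ₀`, then `d 1 + d (-1) = 0`. -/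
lemma poin_avg (τ₀ : ℍ) (d : SL(2, ℤ) → ℂ) (D : ℝ) (hd : ∀ A, ‖d A‖ ≤ D)
    (h : ∀ m, 3 ≤ m → poin m τ₀ d τ₀ = 0) : d 1 + d (-1) = 0 := by
  have hyy : (2 * Complex.I * (τ₀.im : ℂ)) ≠ 0 := by simp [τ₀.im_pos.ne']
  have hpow : ∀ m A, (cA τ₀ A) ^ (2 * m) * d A =
      (2 * Complex.I * (τ₀.im : ℂ)) ^ (2 * m) * ((XA τ₀ A τ₀ ^ (2 * m))⁻¹ * d A) := fun m A => by
    unfold cA; rw [div_pow, div_eq_mul_inv]; ring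
  have hs : ∀ m, 3 ≤ m → HasSum (fun A => (cA τ₀ A) ^ (2 * m) * d A) 0 := fun m hm => by
    have := ((poin_summable hm τ₀ d D hd τ₀).hasSum).mul_left ((2 * Complex.I * (τ₀.im : ℂ)) ^ (2 * m))
    have h2 := h m hm
    unfold poin at h2
    rw [h2, mul_zero] at this
    exact HasSum.congr_of this (hpow m)
  set b : SL(2, ℤ) → ℝ := fun A => ‖(cA τ₀ A) ^ (2 * 3) * d A‖
  have hb : Summable b := (hs 3 le_rfl).summable.norm
  have hzero : ∀ M : ℕ, ∑' A, ((M : ℂ)⁻¹ * ∑ m ∈ Finset.range M, (cA τ₀ A ^ 2) ^ m) *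
      ((cA τ₀ A) ^ (2 * 3) * d A) = 0 := fun M => by
    have h1 := hasSum_sum (s := Finset.range M) (fun m _ => hs (m + 3) (by omega))
    have h2 := h1.mul_left ((M : ℂ)⁻¹)
    rw [Finset.sum_const_zero, mul_zero] at h2
    rw [← h2.tsum_eq]
    refine tsum_congr fun A => ?_
    rw [mul_assoc, Finset.sum_mul]
    congr 1
    refine Finset.sum_congr rfl fun m _ => ?_
    rw [← mul_assoc, ← pow_mul, ← pow_add]; ring_nf
  have hlim := tendsto_tsum_of_dominated_convergence (𝓕 := Filter.atTop)
    (f := fun (M : ℕ) A => ((M : ℂ)⁻¹ * ∑ m ∈ Finset.range M, (cA τ₀ A ^ 2) ^ m) *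
      ((cA τ₀ A) ^ (2 * 3) * d A)) hb
    (g := fun A => (if cA τ₀ A ^ 2 = 1 then 1 else 0) * ((cA τ₀ A) ^ (2 * 3) * d A))
    (fun A => (cesaro (by rw [norm_pow]; exact pow_le_one₀ (norm_nonneg _) (norm_cA _ _))).mul_const _)
    (Filter.Eventually.of_forall fun M A => by
      rw [norm_mul]
      refine mul_le_of_le_one_left (norm_nonneg _) ?_
      rw [norm_mul, norm_inv, Complex.norm_natCast]
      have h1 : ‖∑ m ∈ Finset.range M, (cA τ₀ A ^ 2) ^ m‖ ≤ M := by
        refine (norm_sum_le_of_le _ (n := fun _ => 1) fun m _ => ?_).trans (by simp)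
        rw [norm_pow, norm_pow]
        exact pow_le_one₀ (by positivity) (pow_le_one₀ (norm_nonneg _) (norm_cA _ _))
      calc _ ≤ (M : ℝ)⁻¹ * M := by gcongr
        _ ≤ 1 := inv_mul_le_one)
  simp only [hzero] at hlim
  have h0 := tendsto_nhds_unique tendsto_const_nhds hlim
  have hne : (1 : SL(2, ℤ)) ≠ -1 := by
    intro h
    have := congrArg (fun A : SL(2, ℤ) => A 0 0) h
    simp at this
  rw [tsum_eq_sum (s := {1, -1})] at h0
  · rw [Finset.sum_pair hne] at h0
    simp only [pow_mul, cA_one, cA_neg_one] at h0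
    simpa using h0.symm
  · intro A hA
    rw [if_neg, zero_mul]
    intro hc
    rcases cA_sq τ₀ A hc with h | h <;> simp [h] at hA

section

/-! ### Part 6: vector valued modular forms -/

structure WD (J : Type) [Fintype J] [DecidableEq J] where
  ρ : SL(2, ℤ) →* Matrix J J ℂ
  p : J → ℝ
  hp : ∀ j, 0 < p j
  iso : ∀ A, (ρ A)ᴴ * Matrix.diagonal (fun j => (p j : ℂ)) * ρ A = Matrix.diagonal (fun j => (p j : ℂ))
  neg : ρ (-1) = 1
  lam : J → ℝ
  lam0 : ∀ j, 0 ≤ lam j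
  lam1 : ∀ j, lam j < 1
  hT : ρ ModularGroup.T = Matrix.diagonal (fun j => eC (lam j))

lemma wnorm_eq {J : Type} [Fintype J] [DecidableEq J] (p : J → ℝ) (x : J → ℂ) :
    ((∑ j, p j * ‖x j‖ ^ 2 : ℝ) : ℂ) = star x ⬝ᵥ (Matrix.diagonal (fun j => (p j : ℂ)) *ᵥ x) := by
  push_cast
  refine Finset.sum_congr rfl fun j _ => ?_
  rw [Matrix.mulVec_diagonal, ← Complex.conj_mul']
  simp; ring

lemma wnorm_iso {J : Type} [Fintype J] [DecidableEq J] (p : J → ℝ) (M : Matrix J J ℂ)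
    (h : Mᴴ * Matrix.diagonal (fun j => (p j : ℂ)) * M = Matrix.diagonal (fun j => (p j : ℂ)))
    (x : J → ℂ) : ∑ j, p j * ‖(M *ᵥ x) j‖ ^ 2 = ∑ j, p j * ‖x j‖ ^ 2 := by
  have : ((∑ j, p j * ‖(M *ᵥ x) j‖ ^ 2 : ℝ) : ℂ) = ((∑ j, p j * ‖x j‖ ^ 2 : ℝ) : ℂ) := by
    rw [wnorm_eq, wnorm_eq, Matrix.star_mulVec, ← Matrix.dotProduct_mulVec, Matrix.mulVec_mulVec,
      Matrix.mulVec_mulVec, h]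
  exact_mod_cast this

lemma vv_vanish {J : Type} [Fintype J] [DecidableEq J] (p : J → ℝ) (hp : ∀ j, 0 < p j) (V : ℍ → J → ℂ) (n : ℕ)
    (hhol : ∀ j, MDifferentiable 𝓘(ℂ) 𝓘(ℂ) fun τ => V τ j)
    (hmod : ∀ (A : SL(2, ℤ)) (τ : ℍ), (∑ j, p j * ‖V (A • τ) j‖ ^ 2) * (‖jfactor A τ‖ ^ n) ^ 2 =
      ∑ j, p j * ‖V τ j‖ ^ 2)
    (h0 : ∀ j, Filter.Tendsto (fun τ => V τ j) atImInfty (𝓝 0)) (τ : ℍ) : V τ = 0 := by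
  let b : ℍ → EuclideanSpace ℂ J := fun τ => WithLp.toLp 2 fun j => (Real.sqrt (p j) : ℂ) * V τ j
  have hn : ∀ τ, ‖b τ‖ ^ 2 = ∑ j, p j * ‖V τ j‖ ^ 2 := fun τ => by
    rw [EuclideanSpace.norm_sq_eq]
    refine Finset.sum_congr rfl fun j _ => ?_
    simp only [b, norm_mul, mul_pow, Complex.norm_real, Real.norm_eq_abs, sq_abs, Real.sq_sqrt (hp j).le]
  have := vanish b n ?_ ?_ ?_ τ
  · ext j
    have h1 : (b τ) j = 0 := by rw [this]; rfl
    have h2 : (Real.sqrt (p j) : ℂ) * V τ j = 0 := h1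
    rcases mul_eq_zero.1 h2 with h | h
    · exact absurd (by exact_mod_cast h) (Real.sqrt_pos.2 (hp j)).ne'
    · exact h
  · rw [differentiableOn_euclidean]
    intro j
    have := mdiff_iff.1 (hhol j)
    exact this.const_mul _
  · intro A τ
    have h1 := hmod A τ
    rw [← hn, ← hn, ← mul_pow] at h1
    exact (pow_left_inj₀ (by positivity) (norm_nonneg _) two_ne_zero).1 h1
  · have : Filter.Tendsto (fun τ => fun j => (Real.sqrt (p j) : ℂ) * V τ j) atImInfty (𝓝 0) := by
      rw [tendsto_pi_nhds]
      intro j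
      simpa using (h0 j).const_mul (Real.sqrt (p j) : ℂ)
    have h2 := ((PiLp.continuous_toLp 2 (fun _ : J => ℂ)).tendsto 0).comp this
    rw [WithLp.toLp_zero] at h2
    exact h2

variable {J : Type} [Fintype J] [DecidableEq J]

structure VM (D : WD J) (w : ℤ) (G : ℍ → J → ℂ) (a : J → PowerSeries ℂ) : Prop where
  mod : ∀ (A : SL(2, ℤ)) (τ : ℍ), G (A • τ) = jfactor A τ ^ w • (D.ρ A *ᵥ G τ)
  q : ∀ j, HasQ (fun τ => eC (-(D.lam j * τ)) * G τ j) (a j)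

lemma WD.iso' (D : WD J) (A : SL(2, ℤ)) (x : J → ℂ) :
    ∑ j, D.p j * ‖(D.ρ A *ᵥ x) j‖ ^ 2 = ∑ j, D.p j * ‖x j‖ ^ 2 := wnorm_iso _ _ (D.iso A) x

lemma WD.bdd (D : WD J) (v : J → ℂ) : ∃ C : ℝ, ∀ A j, ‖(D.ρ A *ᵥ v) j‖ ≤ C := by
  set S := ∑ j, D.p j * ‖v j‖ ^ 2
  have hS : 0 ≤ S := Finset.sum_nonneg fun j _ => mul_nonneg (D.hp j).le (by positivity)
  refine ⟨∑ j, Real.sqrt (S / D.p j), fun A j => ?_⟩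
  refine le_trans ?_ (Finset.single_le_sum (f := fun j => Real.sqrt (S / D.p j))
    (fun i _ => Real.sqrt_nonneg _) (Finset.mem_univ j))
  apply Real.le_sqrt_of_sq_le
  rw [le_div_iff₀ (D.hp j), mul_comm]
  refine le_of_le_of_eq ?_ (D.iso' A v)
  exact Finset.single_le_sum (f := fun j => D.p j * ‖(D.ρ A *ᵥ v) j‖ ^ 2)
    (fun i _ => mul_nonneg (D.hp i).le (by positivity)) (Finset.mem_univ j)

lemma VM.mdiff {D : WD J} {w G a} (h : VM D w G a) (j : J) :
    MDifferentiable 𝓘(ℂ) 𝓘(ℂ) fun τ => G τ j := by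
  have := mdiff_mul (mdiff_eC (D.lam j)) (h.q j).mdiff
  convert this using 2 with τ
  rw [← mul_assoc, ← eC_add]; simp [eC_zero]

lemma eC_lam (x : ℝ) (τ : ℍ) : eC (-(x * (((1 : ℝ) +ᵥ τ : ℍ) : ℂ))) * eC x = eC (-(x * τ)) := by
  rw [← eC_add]; congr 1; rw [UpperHalfPlane.coe_vadd]; push_cast; ring

lemma norm_eC_tendsto {x : ℝ} (hx : 0 < x) : Filter.Tendsto (fun τ : ℍ => eC (x * τ)) atImInfty (𝓝 0) := by
  rw [tendsto_zero_iff_norm_tendsto_zero]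
  have : (fun τ : ℍ => ‖eC (x * τ)‖) = fun τ : ℍ => Real.exp (-(2 * π * x * τ.im)) := by
    ext τ; rw [norm_eC]; simp; ring
  rw [this]
  refine Real.tendsto_exp_atBot.comp (Filter.tendsto_neg_atTop_atBot.comp ?_)
  exact Filter.Tendsto.const_mul_atTop (by positivity) Filter.tendsto_comap

/-- Modularity and boundedness in a strip produce a `VM`. -/
lemma VM.of_bdd (D : WD J) (w : ℤ) (G : ℍ → J → ℂ)
    (hmod : ∀ (A : SL(2, ℤ)) (τ : ℍ), G (A • τ) = jfactor A τ ^ w • (D.ρ A *ᵥ G τ))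
    (hd : ∀ j, MDifferentiable 𝓘(ℂ) 𝓘(ℂ) fun τ => G τ j)
    (hb : ∀ j, ∃ M, ∀ τ ∈ verticalStrip 1 1, ‖G τ j‖ ≤ M) : ∃ a, VM D w G a := by
  have hT : ∀ τ j, G ((1 : ℝ) +ᵥ τ) j = eC (D.lam j) * G τ j := fun τ j => by
    rw [← T_smul, hmod, jfactor_T, _root_.one_zpow, one_smul, D.hT, Matrix.mulVec_diagonal]
  have hTn : ∀ (n : ℤ) τ j, ‖G (ModularGroup.T ^ n • τ) j‖ = ‖G τ j‖ := by
    have h1 : ∀ τ j, ‖G (ModularGroup.T • τ) j‖ = ‖G τ j‖ := fun τ j => by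
      rw [T_smul, hT, norm_mul, norm_eC]; simp
    intro n
    induction n with
    | zero => simp
    | succ n ih => intro τ j; rw [_root_.zpow_add_one, mul_smul, ih, h1]
    | pred n ih => intro τ j; rw [_root_.zpow_sub_one, mul_smul, ih, ← h1 (ModularGroup.T⁻¹ • τ), smul_inv_smul]
  have hq : ∀ j, ∃ a, HasQ (fun τ => eC (-(D.lam j * τ)) * G τ j) a := by
    intro j
    obtain ⟨M, hM⟩ := hb j
    have hbd : ∀ τ : ℍ, 1 ≤ τ.im → ‖G τ j‖ ≤ M := fun τ hτ => by
      rw [← hTn (-⌊τ.re⌋) τ j]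
      refine hM _ ⟨?_, ?_⟩
      · rw [ModularGroup.re_T_zpow_smul]
        push_cast
        rw [← sub_eq_add_neg, abs_of_nonneg (by linarith [Int.floor_le τ.re])]
        linarith [Int.lt_floor_add_one τ.re]
      · rw [ModularGroup.im_T_zpow_smul]; exact hτ
    refine exists_hasQ' (mdiff_mul ?_ (hd j)) ?_ ?_
    · simpa [neg_mul] using mdiff_eC (-(D.lam j : ℂ))
    · intro τ
      simp only [hT]
      rw [← mul_assoc, eC_lam]
    · have e : ∀ τ : ℍ, qq τ * (eC (-(D.lam j * τ)) * G τ j) = eC (((1 - D.lam j : ℝ) : ℂ) * τ) * G τ j := by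
        intro τ
        rw [← mul_assoc, qq, ← eC_add]; congr 2; push_cast; ring
      simp only [e]
      have h1 := norm_eC_tendsto (x := 1 - D.lam j) (by linarith [D.lam1 j])
      refine Filter.Tendsto.zero_mul_isBoundedUnder_le h1 ?_
      refine Filter.isBoundedUnder_of_eventually_le (a := M) ?_
      have : ∀ᶠ τ : ℍ in atImInfty, 1 ≤ τ.im := (atImInfty_basis.mem_of_mem (i := 1) trivial)
      filter_upwards [this] with τ hτ using hbd τ hτ
  choose a ha using hq
  exact ⟨a, hmod, ha⟩

lemma spanning (D : WD J) (τ₀ : ℍ) (u : J → ℂ)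
    (h : ∀ (w : ℤ) G a, Even w → VM D w G a → ∑ j, u j * G τ₀ j = 0) : u = 0 := by
  ext i
  let v : J → ℂ := Pi.single i 1
  let d : J → SL(2, ℤ) → ℂ := fun j A => (D.ρ A⁻¹ *ᵥ v) j
  obtain ⟨C, hC⟩ := D.bdd v
  have hd : ∀ j A, ‖d j A‖ ≤ C := fun j A => hC _ _
  have hvm : ∀ m, 3 ≤ m → ∃ a, VM D (2 * m : ℕ) (fun τ j => poin m τ₀ (d j) τ) a := by
    intro m hm
    refine VM.of_bdd D _ _ ?_ (fun j => poin_mdiff hm τ₀ _ C (hd j)) (fun j => poin_bdd hm τ₀ _ C (hd j))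
    intro A τ
    ext j
    simp only [Pi.smul_apply, smul_eq_mul]
    rw [poin_smul, zpow_natCast]
    congr 1
    simp only [Matrix.mulVec, dotProduct]
    have hs := hasSum_sum (s := Finset.univ) (fun i (_ : i ∈ Finset.univ) =>
      ((poin_summable hm τ₀ (d i) C (hd i) τ).hasSum).mul_left (D.ρ A j i))
    refine Eq.trans ?_ hs.tsum_eq
    refine tsum_congr fun A' => ?_
    have : d j (A' * A⁻¹) = ∑ i, D.ρ A j i * d i A' := by
      simp only [d]
      rw [_root_.mul_inv_rev, inv_inv, map_mul, ← Matrix.mulVec_mulVec]; rfl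
    beta_reduce
    rw [this, Finset.mul_sum]
    exact Finset.sum_congr rfl fun i _ => by ring
  have key := poin_avg τ₀ (fun A => ∑ j, u j * d j A) (∑ j, ‖u j‖ * C) (fun A => by
    refine norm_sum_le_of_le _ fun j _ => ?_
    rw [norm_mul]; exact mul_le_mul_of_nonneg_left (hd j A) (norm_nonneg _)) (fun m hm => by
    obtain ⟨a, ha⟩ := hvm m hm
    have h1 := h _ _ _ (by exact_mod_cast even_two_mul m) ha
    rw [← h1]
    have hs := hasSum_sum (s := Finset.univ) (fun i (_ : i ∈ Finset.univ) =>
      ((poin_summable hm τ₀ (d i) C (hd i) τ₀).hasSum).mul_left (u i))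
    refine Eq.trans ?_ hs.tsum_eq
    refine tsum_congr fun A' => ?_
    rw [Finset.mul_sum]
    exact Finset.sum_congr rfl fun i _ => by ring)
  have e1 : ∀ j, d j 1 = v j := fun j => by simp [d]
  have e2 : ∀ j, d j (-1) = v j := fun j => by
    have : ((-1 : SL(2, ℤ)))⁻¹ = -1 := by ext i j; fin_cases i <;> fin_cases j <;> simp
    simp [d, this, D.neg]
  simp only [e1, e2] at key
  have e3 : ∑ j, u j * v j = u i := by simp [v, Pi.single_apply]
  rw [e3] at key
  have : 2 * u i = 0 := by rw [two_mul]; exact key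
  simpa using this

end

section

/-! ### Part 7: surjectivity onto principal parts -/

variable {J : Type} [Fintype J] [DecidableEq J]

def ppart (N : ℕ) (a : J → PowerSeries ℂ) : J × ℕ →₀ ℂ :=
  Finsupp.onFinset (Finset.univ ×ˢ Finset.range N)
    (fun x => (PowerSeries.X ^ (x.2 + 1) * (a x.1 * uu⁻¹ ^ N)).coeff N) (by
      intro x hx
      simp only [Finset.mem_product, Finset.mem_univ, Finset.mem_range, true_and]
      by_contra h
      apply hx
      rw [PowerSeries.coeff_X_pow_mul', if_neg (by omega)])

lemma ppart_apply (N : ℕ) (a : J → PowerSeries ℂ) (j : J) (n : ℕ) :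
    ppart N a (j, n) = (PowerSeries.X ^ (n + 1) * (a j * uu⁻¹ ^ N)).coeff N := rfl

lemma VM.scal {D : WD J} {w v G a f b} (h : VM D w G a) (hf : SM v f b) :
    VM D (v + w) (fun τ j => f τ * G τ j) (fun j => b * a j) := by
  refine ⟨fun A τ => ?_, fun j => (hf.q.mul (h.q j)).congr fun τ => by ring⟩
  ext j
  rw [zpow_add₀ (jfactor_ne_zero A τ)]
  have : (fun j => f τ * G τ j) = f τ • G τ := rfl
  rw [this, Matrix.mulVec_smul, h.mod, hf.mod]
  simp only [Pi.smul_apply, smul_eq_mul]; ring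

lemma VM.add {D : WD J} {w G H a b} (h : VM D w G a) (h' : VM D w H b) :
    VM D w (fun τ => G τ + H τ) (fun j => a j + b j) := by
  refine ⟨fun A τ => ?_, fun j => ((h.q j).add (h'.q j)).congr fun τ => by
    simp only [Pi.add_apply]; ring⟩
  rw [h.mod, h'.mod, Matrix.mulVec_add, smul_add]

lemma VM.smul {D : WD J} {w G a} (c : ℂ) (h : VM D w G a) :
    VM D w (fun τ => c • G τ) (fun j => c • a j) := by
  refine ⟨fun A τ => ?_, fun j => ((h.q j).smul c).congr fun τ => by
    simp only [Pi.smul_apply, smul_eq_mul]; ring⟩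
  rw [h.mod, Matrix.mulVec_smul, smul_comm]

lemma VM.zero (D : WD J) (w : ℤ) : VM D w (fun _ => 0) (fun _ => 0) := by
  refine ⟨fun A τ => by simp, fun j => HasQ.zero.congr fun τ => by simp⟩

lemma VM.raise {D : WD J} {w G a} (h : VM D w G a) (M : ℕ) :
    VM D (w + 12 * M) (fun τ j => dl τ ^ M * G τ j) (fun j => (PowerSeries.X * uu) ^ M * a j) := by
  have := h.scal (sm_dl.pow M)
  rw [show w + 12 * (M : ℤ) = M * 12 + w by ring]; exact this

lemma ppart_raise (N M : ℕ) (a : J → PowerSeries ℂ) :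
    ppart (N + M) (fun j => (PowerSeries.X * uu) ^ M * a j) = ppart N a := by
  ext ⟨j, n⟩
  rw [ppart_apply, ppart_apply]
  have hu : uu ^ M * uu⁻¹ ^ M = 1 := by rw [← mul_pow, uu_mul_inv, one_pow]
  have : PowerSeries.X ^ (n + 1) * ((PowerSeries.X * uu) ^ M * a j * uu⁻¹ ^ (N + M)) =
      PowerSeries.X ^ M * (PowerSeries.X ^ (n + 1) * (a j * uu⁻¹ ^ N)) * (uu ^ M * uu⁻¹ ^ M) := by ring
  rw [this, hu, mul_one, PowerSeries.coeff_X_pow_mul]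

def imgI (D : WD J) (κ : ℤ) : Submodule ℂ (J × ℕ →₀ ℂ) where
  carrier := {c | ∃ (N : ℕ) (G : ℍ → J → ℂ) (a : J → PowerSeries ℂ), VM D (κ + 12 * N) G a ∧ ppart N a = c}
  zero_mem' := ⟨0, _, _, VM.zero D _, by ext ⟨j, n⟩; rw [ppart_apply]; simp⟩
  add_mem' := by
    rintro _ _ ⟨N, G, a, h, rfl⟩ ⟨M, H, b, h', rfl⟩
    have h1 := h.raise M
    have h2 := h'.raise N
    refine ⟨N + M, _, _, VM.add (w := κ + 12 * ((N + M : ℕ) : ℤ))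
      (by convert h1 using 1; push_cast; ring) (by convert h2 using 1; push_cast; ring), ?_⟩
    rw [← ppart_raise N M a, ← ppart_raise M N b, add_comm M N]
    ext ⟨j, n⟩
    simp only [Finsupp.add_apply, ppart_apply, add_mul, mul_add, map_add]
  smul_mem' := by
    rintro c _ ⟨N, G, a, h, rfl⟩
    refine ⟨N, _, _, h.smul c, ?_⟩
    ext ⟨j, n⟩
    simp only [Finsupp.smul_apply, ppart_apply, smul_mul_assoc, mul_smul_comm, map_smul]

lemma coeff_X_mul_mk (β : ℕ → ℂ) (x : PowerSeries ℂ) (N : ℕ) :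
    (PowerSeries.X * PowerSeries.mk β * x).coeff N =
      ∑ n ∈ Finset.range N, β n * (PowerSeries.X ^ (n + 1) * x).coeff N := by
  cases N with
  | zero => simp
  | succ N =>
    rw [mul_assoc, PowerSeries.coeff_succ_X_mul, PowerSeries.coeff_mul,
      Finset.Nat.sum_antidiagonal_eq_sum_range_succ (fun i j => (PowerSeries.mk β).coeff i * x.coeff j)]
    refine Finset.sum_congr rfl fun n hn => ?_
    have hn' := Finset.mem_range.1 hn
    rw [PowerSeries.coeff_mk, PowerSeries.coeff_X_pow_mul', if_pos (by omega)]
    rw [show N + 1 - (n + 1) = N - n by omega]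

lemma psi_ppart (ψ : (J × ℕ →₀ ℂ) →ₗ[ℂ] ℂ) (N : ℕ) (a : J → PowerSeries ℂ) :
    ψ (ppart N a) = ∑ j, (PowerSeries.X * PowerSeries.mk (fun n => ψ (Finsupp.single (j, n) 1)) *
      (a j * uu⁻¹ ^ N)).coeff N := by
  have h1 : ppart N a = ∑ x ∈ Finset.univ ×ˢ Finset.range N, ppart N a x • Finsupp.single x (1 : ℂ) := by
    conv_lhs => rw [← Finsupp.sum_single (ppart N a)]
    rw [Finsupp.sum_of_support_subset _ (s := Finset.univ ×ˢ Finset.range N)]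
    · refine Finset.sum_congr rfl fun x _ => ?_
      rw [Finsupp.smul_single, smul_eq_mul, mul_one]
    · exact Finsupp.support_onFinset_subset
    · simp
  rw [h1, map_sum, Finset.sum_product]
  refine Finset.sum_congr rfl fun j _ => ?_
  rw [coeff_X_mul_mk]
  refine Finset.sum_congr rfl fun n _ => ?_
  rw [map_smul, smul_eq_mul, ppart_apply, mul_comm]

/-- The pairing data: dual object `b` such that every product is a modular form. -/
structure DualData (D : WD J) (κ : ℤ) (c : J → PowerSeries ℂ) : Prop where
  pair : ∀ (w : ℤ) G a, Even w → VM D w G a → ∃ g, SM (w + 2 - κ) g (∑ j, PowerSeries.X * c j * a j)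

lemma exists_family (D : WD J) (τ : ℍ) : ∃ (w : J → ℤ) (G : J → ℍ → J → ℂ) (a : J → J → PowerSeries ℂ),
    (∀ i, Even (w i)) ∧ (∀ i, VM D (w i) (G i) (a i)) ∧ (Matrix.of fun i j => G i τ j).det ≠ 0 := by
  let S : Set (J → ℂ) := {x | ∃ (w : ℤ) (G : ℍ → J → ℂ) (a : J → PowerSeries ℂ), Even w ∧ VM D w G a ∧ x = G τ}
  have hspan : Submodule.span ℂ S = ⊤ := by
    by_contra hne
    obtain ⟨f, hf, hk⟩ := Submodule.exists_le_ker_of_lt_top _ (lt_top_iff_ne_top.2 hne)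
    have hfe : ∀ x, f x = ∑ j, f (Pi.single j 1) * x j := fun x => by
      conv_lhs => rw [pi_eq_sum_univ' x]
      simp [map_sum, mul_comm]
    have := spanning D τ (fun j => f (Pi.single j 1)) (fun w G a hw hG => by
      rw [← hfe]
      exact hk (Submodule.subset_span ⟨w, G, a, hw, hG, rfl⟩))
    apply hf
    ext j
    simpa using congrFun this j
  obtain ⟨t, htS, bt, hbt⟩ : ∃ t : Set (J → ℂ), t ⊆ S ∧ ∃ b : Module.Basis t ℂ (J → ℂ), ∀ x : t, b x = x := by
    obtain ⟨t, h1, h2, h3⟩ := exists_linearIndependent ℂ S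
    refine ⟨t, h1, Module.Basis.mk h3 (by rw [Subtype.range_coe, h2, hspan]), fun x => by simp⟩
  let e : J ≃ t := (Pi.basisFun ℂ J).indexEquiv bt
  have hx : ∀ i : J, ((e i : t) : J → ℂ) ∈ S := fun i => htS (e i).2
  choose w G a hw hG hx using hx
  refine ⟨w, G, a, hw, hG, ?_⟩
  have hli : LinearIndependent ℂ (fun i => (e i : J → ℂ)) := by
    have := bt.linearIndependent.comp e e.injective
    convert this using 1
    ext1 i; simp [hbt]
  have hM : (Matrix.of fun i j => G i τ j) = Matrix.of (fun i => ((e i : t) : J → ℂ)) := by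
    ext i j; simp [hx i]
  rw [hM]
  have : IsUnit (Matrix.of (fun i => ((e i : t) : J → ℂ))) := by
    rw [← Matrix.linearIndependent_rows_iff_isUnit]; exact hli
  exact ((Matrix.isUnit_iff_isUnit_det _).1 this).ne_zero

lemma HasQ.const (c : ℂ) : HasQ (fun _ => c) (PowerSeries.C c) := by
  have := HasQ.one.smul c
  rw [PowerSeries.smul_eq_C_mul, mul_one] at this
  simpa using this

lemma HasQ.det {M : ℍ → Matrix J J ℂ} {𝒜 : Matrix J J (PowerSeries ℂ)}
    (h : ∀ i j, HasQ (fun τ => M τ i j) (𝒜 i j)) : HasQ (fun τ => (M τ).det) 𝒜.det := by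
  simp only [Matrix.det_apply]
  refine HasQ.sum _ fun σ _ => ?_
  have h1 := HasQ.prod Finset.univ (fun i (_ : i ∈ Finset.univ) => h (σ i) i)
  rcases Int.units_eq_one_or (Equiv.Perm.sign σ) with hs | hs
  · simpa [hs] using h1
  · have h2 := h1.smul (-1)
    simpa [hs] using h2

lemma HasQ.adjugate {M : ℍ → Matrix J J ℂ} {𝒜 : Matrix J J (PowerSeries ℂ)}
    (h : ∀ i j, HasQ (fun τ => M τ i j) (𝒜 i j)) (i j : J) :
    HasQ (fun τ => (M τ).adjugate i j) (𝒜.adjugate i j) := by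
  simp only [Matrix.adjugate_apply]
  refine HasQ.det fun k l => ?_
  by_cases hk : k = j
  · subst hk
    simp only [Matrix.updateRow_self, Pi.single_apply]
    split_ifs
    · exact HasQ.one
    · exact HasQ.zero
  · simp only [Matrix.updateRow_ne hk]
    exact h k l

lemma fam (D : WD J) (κ : ℤ) (c : J → PowerSeries ℂ) (h : DualData D κ c) (τ₀ : ℍ) :
    ∃ (d : PowerSeries ℂ) (de : ℍ → ℂ) (nu : J → ℍ → ℂ), HasQ de d ∧ de τ₀ ≠ 0 ∧
      (∀ j, HasQ (nu j) (d * (PowerSeries.X * c j))) ∧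
      ∀ (w : ℤ) G a g, VM D w G a → SM (w + 2 - κ) g (∑ j, PowerSeries.X * c j * a j) →
        ∀ τ, de τ * g τ = ∑ j, (eC (-(D.lam j * τ)) * G τ j) * nu j τ := by
  obtain ⟨w, G, a, hw, hG, hdet⟩ := exists_family D τ₀
  choose g hg using fun i => h.pair _ _ _ (hw i) (hG i)
  let M : ℍ → Matrix J J ℂ := fun τ => Matrix.of fun i j => eC (-(D.lam j * τ)) * G i τ j
  let 𝒜 : Matrix J J (PowerSeries ℂ) := Matrix.of a
  have hM : ∀ i j, HasQ (fun τ => M τ i j) (𝒜 i j) := fun i j => (hG i).q j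
  have hnu : ∀ j, HasQ (fun τ => ∑ i, (M τ).adjugate j i * g i τ) (𝒜.det * (PowerSeries.X * c j)) := by
    intro j
    have h1 := HasQ.sum Finset.univ fun i (_ : i ∈ Finset.univ) => (HasQ.adjugate hM j i).mul (hg i).q
    have e : ∑ i, 𝒜.adjugate j i * ∑ l, PowerSeries.X * c l * a i l = 𝒜.det * (PowerSeries.X * c j) := by
      have e1 : (𝒜.adjugate *ᵥ (𝒜 *ᵥ fun l => PowerSeries.X * c l)) j = 𝒜.det * (PowerSeries.X * c j) := by
        rw [Matrix.mulVec_mulVec, Matrix.adjugate_mul, Matrix.smul_mulVec, Matrix.one_mulVec]; simp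
      rw [← e1]
      simp only [Matrix.mulVec, dotProduct, 𝒜, Matrix.of_apply]
      exact Finset.sum_congr rfl fun i _ => by
        congr 1; exact Finset.sum_congr rfl fun l _ => by ring
    rw [← e]; exact h1
  refine ⟨𝒜.det, fun τ => (M τ).det, fun j τ => ∑ i, (M τ).adjugate j i * g i τ, HasQ.det hM, ?_, hnu, ?_⟩
  · have : M τ₀ = (Matrix.of fun i j => G i τ₀ j) * Matrix.diagonal fun j => eC (-(D.lam j * τ₀)) := by
      ext i j; rw [Matrix.mul_diagonal]; simp [M, mul_comm]
    beta_reduce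
    rw [this, Matrix.det_mul, Matrix.det_diagonal]
    exact mul_ne_zero hdet (Finset.prod_ne_zero_iff.2 fun j _ => eC_ne_zero _)
  · intro w' G' a' g' hG' hg' τ
    have h1 := (HasQ.det hM).mul hg'.q
    have h2 := HasQ.sum Finset.univ fun j (_ : j ∈ Finset.univ) => (hG'.q j).mul (hnu j)
    have e : ∑ j, a' j * (𝒜.det * (PowerSeries.X * c j)) = 𝒜.det * ∑ j, PowerSeries.X * c j * a' j := by
      rw [Finset.mul_sum]; exact Finset.sum_congr rfl fun j _ => by ring
    rw [e] at h2
    exact (h1 τ).unique (h2 τ)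

lemma dual_zero (D : WD J) (n : ℕ) (c : J → PowerSeries ℂ) (h : DualData D (n + 2) c) (hn : Even n) :
    ∀ j, c j = 0 := by
  have uniq : ∀ (τ : ℍ) (y y' : J → ℂ), (∀ (w : ℤ) G a g, Even w → VM D w G a →
      SM (w + 2 - (n + 2)) g (∑ j, PowerSeries.X * c j * a j) →
      ∑ j, y j * G τ j = g τ ∧ ∑ j, y' j * G τ j = g τ) → y = y' := by
    intro τ y y' hy
    have := spanning D τ (fun j => y j - y' j) (fun w G a hw hG => by
      obtain ⟨g, hg⟩ := h.pair w G a hw hG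
      obtain ⟨h1, h2⟩ := hy w G a g hw hG hg
      simp only [sub_mul, Finset.sum_sub_distrib]
      rw [h1, h2, sub_self])
    ext j
    exact sub_eq_zero.1 (congrFun this j)
  have form : ∀ (d : PowerSeries ℂ) (de : ℍ → ℂ) (nu : J → ℍ → ℂ) (τ : ℍ), de τ ≠ 0 →
      (∀ (w : ℤ) G a g, VM D w G a → SM (w + 2 - (n + 2)) g (∑ j, PowerSeries.X * c j * a j) →
        ∀ τ, de τ * g τ = ∑ j, (eC (-(D.lam j * τ)) * G τ j) * nu j τ) →
      ∀ (w : ℤ) G a g, Even w → VM D w G a → SM (w + 2 - (n + 2)) g (∑ j, PowerSeries.X * c j * a j) →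
        ∑ j, (eC (-(D.lam j * τ)) * nu j τ / de τ) * G τ j = g τ := by
    intro d de nu τ hde hf w G a g hw hG hg
    have := hf w G a g hG hg τ
    apply mul_left_cancel₀ hde
    rw [this, Finset.mul_sum]
    refine Finset.sum_congr rfl fun j _ => ?_
    field_simp
  have ex : ∀ τ : ℍ, ∃ y : J → ℂ, ∀ (w : ℤ) G a g, Even w → VM D w G a →
      SM (w + 2 - (n + 2)) g (∑ j, PowerSeries.X * c j * a j) → ∑ j, y j * G τ j = g τ := by
    intro τ
    obtain ⟨d, de, nu, h1, h2, h3, h4⟩ := fam D _ c h τ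
    exact ⟨_, form d de nu τ h2 h4⟩
  choose V hV using ex
  have Veq : ∀ (d : PowerSeries ℂ) (de : ℍ → ℂ) (nu : J → ℍ → ℂ) (τ : ℍ), de τ ≠ 0 →
      (∀ (w : ℤ) G a g, VM D w G a → SM (w + 2 - (n + 2)) g (∑ j, PowerSeries.X * c j * a j) →
        ∀ τ, de τ * g τ = ∑ j, (eC (-(D.lam j * τ)) * G τ j) * nu j τ) →
      V τ = fun j => eC (-(D.lam j * τ)) * nu j τ / de τ := by
    intro d de nu τ hde hf
    exact uniq τ _ _ fun w G a g hw hG hg => ⟨hV τ w G a g hw hG hg, form d de nu τ hde hf w G a g hw hG hg⟩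
  have hol : ∀ j, MDifferentiable 𝓘(ℂ) 𝓘(ℂ) fun τ => V τ j := by
    intro j
    rw [mdiff_iff]
    intro z hz
    obtain ⟨d, de, nu, h1, h2, h3, h4⟩ := fam D _ c h ⟨z, hz⟩
    have hopen : IsOpen {z : ℂ | 0 < z.im} := isOpen_lt continuous_const Complex.continuous_im
    have hdd : DifferentiableAt ℂ (de ∘ ofComplex) z := (mdiff_iff.1 h1.mdiff).differentiableAt (hopen.mem_nhds hz)
    have hnn : DifferentiableAt ℂ (nu j ∘ ofComplex) z :=
      (mdiff_iff.1 (h3 j).mdiff).differentiableAt (hopen.mem_nhds hz)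
    have hz' : (de ∘ ofComplex) z ≠ 0 := by
      simpa [ofComplex_apply_of_im_pos hz] using h2
    have hee : DifferentiableAt ℂ ((fun τ : ℍ => eC (-(D.lam j) * τ)) ∘ ofComplex) z :=
      (mdiff_iff.1 (mdiff_eC (-(D.lam j : ℂ)))).differentiableAt (hopen.mem_nhds hz)
    refine DifferentiableAt.differentiableWithinAt ?_
    refine ((hee.mul hnn).div hdd hz').congr_of_eventuallyEq ?_
    filter_upwards [hdd.continuousAt.eventually_ne hz'] with z' hz''
    simp only [Function.comp] at hz'' ⊢
    rw [Veq d de nu _ hz'' h4]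
    simp [neg_mul]
  have cusp : ∀ j, Filter.Tendsto (fun τ => V τ j) atImInfty (𝓝 0) := by
    intro j
    obtain ⟨d, de, nu, h1, h2, h3, h4⟩ := fam D _ c h UpperHalfPlane.I
    have hd0 : d ≠ 0 := fun hd => h2 ((h1.eq_zero_iff.2 hd) _)
    obtain ⟨m, δ, hδ, rfl⟩ : ∃ (m : ℕ) (δ : PowerSeries ℂ), δ.coeff 0 ≠ 0 ∧ d = PowerSeries.X ^ m * δ := by
      obtain ⟨δ, hδ⟩ := PowerSeries.X_pow_order_dvd (φ := d)
      have h5 := PowerSeries.coeff_order hd0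
      refine ⟨_, δ, ?_, hδ⟩
      generalize d.order.toNat = m at hδ h5
      rwa [hδ, coeff_X_pow_mul_self, ← PowerSeries.coeff_zero_eq_constantCoeff_apply] at h5
    have hδq : HasQ (fun τ => (qq τ ^ m)⁻¹ * de τ) δ := by
      apply HasQ.of_X_pow_mul m
      exact h1.congr fun τ => by rw [mul_inv_cancel_left₀ (pow_ne_zero _ (qq_ne_zero τ))]
    have hnq : HasQ (fun τ => (qq τ ^ (m + 1))⁻¹ * nu j τ) (δ * c j) := by
      apply HasQ.of_X_pow_mul (m + 1)
      have e : PowerSeries.X ^ m * δ * (PowerSeries.X * c j) = PowerSeries.X ^ (m + 1) * (δ * c j) := by ring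
      have := h3 j
      rw [e] at this
      exact this.congr fun τ => by rw [mul_inv_cancel_left₀ (pow_ne_zero _ (qq_ne_zero τ))]
    have hlim := ((norm_eC_tendsto (x := 1 - D.lam j) (by linarith [D.lam1 j])).mul hnq.tendsto).div
      hδq.tendsto hδ
    rw [zero_mul, zero_div] at hlim
    refine hlim.congr' ?_
    filter_upwards [hδq.tendsto.eventually_ne hδ] with τ hτ
    have hde : de τ ≠ 0 := right_ne_zero_of_mul hτ
    rw [Veq 0 de nu τ hde h4]
    have hq := qq_ne_zero τ
    have e : eC (((1 - D.lam j : ℝ) : ℂ) * τ) = qq τ * eC (-(D.lam j * τ)) := by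
      rw [qq, ← eC_add]; congr 1; push_cast; ring
    simp only [Pi.div_apply]
    rw [e]
    field_simp
    ring
  have trans : ∀ (A : SL(2, ℤ)) (τ : ℍ), V τ = fun i => jfactor A τ ^ n * ((D.ρ A)ᵀ *ᵥ V (A • τ)) i := by
    intro A τ
    refine uniq τ _ _ fun w G a g hw hG hg => ⟨hV τ w G a g hw hG hg, ?_⟩
    have h1 := hV (A • τ) w G a g hw hG hg
    have hj := jfactor_ne_zero A τ
    rw [hg.mod, hG.mod] at h1
    have h2 : ∑ j, V (A • τ) j * (jfactor A τ ^ w • D.ρ A *ᵥ G τ) j =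
        jfactor A τ ^ w * ∑ i, ((D.ρ A)ᵀ *ᵥ V (A • τ)) i * G τ i := by
      have : ∑ i, ((D.ρ A)ᵀ *ᵥ V (A • τ)) i * G τ i = ∑ j, V (A • τ) j * (D.ρ A *ᵥ G τ) j := by
        change ((D.ρ A)ᵀ *ᵥ V (A • τ)) ⬝ᵥ G τ = V (A • τ) ⬝ᵥ (D.ρ A *ᵥ G τ)
        rw [Matrix.dotProduct_mulVec, ← Matrix.mulVec_transpose]
      rw [this, Finset.mul_sum]
      exact Finset.sum_congr rfl fun j _ => by simp only [Pi.smul_apply, smul_eq_mul]; ring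
    rw [h2] at h1
    have h3 : ∑ i, ((D.ρ A)ᵀ *ᵥ V (A • τ)) i * G τ i = jfactor A τ ^ (-(n : ℤ)) * g τ := by
      apply mul_left_cancel₀ (zpow_ne_zero w hj)
      rw [h1, ← mul_assoc, ← zpow_add₀ hj]; congr 2; ring
    simp only [mul_assoc]
    rw [← Finset.mul_sum, h3, _root_.zpow_neg, zpow_natCast, mul_inv_cancel_left₀ (pow_ne_zero _ hj)]
  have hV0 : ∀ τ, V τ = 0 := by
    refine vv_vanish (fun j => (D.p j)⁻¹) (fun j => inv_pos.2 (D.hp j)) V n hol ?_ cusp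
    intro A τ
    conv_rhs => rw [trans A τ]
    have hw := wnorm_iso (fun j => (D.p j)⁻¹) (D.ρ A)ᵀ (by
      have hP : Matrix.diagonal (fun j => (((D.p j)⁻¹ : ℝ) : ℂ)) * Matrix.diagonal (fun j => (D.p j : ℂ)) = 1 := by
        rw [Matrix.diagonal_mul_diagonal, ← Matrix.diagonal_one]
        congr 1; ext j
        have := (D.hp j).ne'
        push_cast
        exact inv_mul_cancel₀ (by exact_mod_cast this)
      have h1 : (Matrix.diagonal (fun j => (((D.p j)⁻¹ : ℝ) : ℂ)) * (D.ρ A)ᴴ *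
          Matrix.diagonal (fun j => (D.p j : ℂ))) * D.ρ A = 1 := by
        rw [mul_assoc, mul_assoc, ← mul_assoc (D.ρ A)ᴴ, D.iso, hP]
      have h2 := mul_eq_one_comm.1 h1
      have hP' := mul_eq_one_comm.1 hP
      have h3 : D.ρ A * Matrix.diagonal (fun j => (((D.p j)⁻¹ : ℝ) : ℂ)) * (D.ρ A)ᴴ =
          Matrix.diagonal (fun j => (((D.p j)⁻¹ : ℝ) : ℂ)) := by
        calc _ = (D.ρ A * (Matrix.diagonal (fun j => (((D.p j)⁻¹ : ℝ) : ℂ)) * (D.ρ A)ᴴ *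
              Matrix.diagonal (fun j => (D.p j : ℂ)))) * Matrix.diagonal (fun j => (((D.p j)⁻¹ : ℝ) : ℂ)) := by
                simp only [mul_assoc, hP', mul_one]
          _ = _ := by rw [h2, one_mul]
      have h4 := congrArg Matrix.transpose h3
      rw [Matrix.transpose_mul, Matrix.transpose_mul, Matrix.diagonal_transpose] at h4
      rw [← mul_assoc] at h4
      have e : (D.ρ A)ᵀᴴ = (D.ρ A)ᴴᵀ := by ext; simp
      rw [e]; exact h4) (V (A • τ))
    rw [← hw, Finset.sum_mul]
    refine Finset.sum_congr rfl fun j _ => ?_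
    rw [norm_mul, norm_pow]; ring
  intro j
  obtain ⟨d, de, nu, h1, h2, h3, h4⟩ := fam D _ c h UpperHalfPlane.I
  have hd0 : d ≠ 0 := fun hd => h2 ((h1.eq_zero_iff.2 hd) _)
  -- `nu j` vanishes where `de` does not; use `de * nu j = 0`
  have hz : ∀ τ, de τ * nu j τ = 0 := fun τ => by
    by_cases hde : de τ = 0
    · rw [hde, zero_mul]
    · have := congrFun (Veq d de nu τ hde h4) j
      rw [hV0] at this
      have h5 := div_eq_zero_iff.1 this.symm
      rcases h5 with h5 | h5
      · rw [(mul_eq_zero.1 h5).resolve_left (eC_ne_zero _), mul_zero]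
      · exact absurd h5 hde
  have := (h1.mul (h3 j)).eq_zero_iff.1 hz
  rcases mul_eq_zero.1 this with h5 | h5
  · exact absurd h5 hd0
  rcases mul_eq_zero.1 h5 with h5 | h5
  · exact absurd h5 hd0
  exact (mul_eq_zero.1 h5).resolve_left PowerSeries.X_ne_zero

theorem surj_pp (D : WD J) (n : ℕ) (hn : Even n) (c : J × ℕ →₀ ℂ) :
    ∃ (N : ℕ) (G : ℍ → J → ℂ) (a : J → PowerSeries ℂ), VM D ((n + 2 : ℤ) + 12 * N) G a ∧ ppart N a = c := by
  have : imgI D (n + 2) = ⊤ := by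
    by_contra hne
    obtain ⟨ψ, hψ, hk⟩ := Submodule.exists_le_ker_of_lt_top _ (lt_top_iff_ne_top.2 hne)
    apply hψ
    have hz := dual_zero D n (fun j => PowerSeries.mk fun m => ψ (Finsupp.single (j, m) 1)) ⟨fun w G a hw hG => by
      refine duality _ ?_ _ fun N f b hf => ?_
      · have : Even (n : ℤ) := by exact_mod_cast hn
        rw [show w + 2 - (n + 2 : ℤ) = w - n by ring]
        exact hw.sub this
      · have h1 : VM D ((n + 2 : ℤ) + 12 * N) (fun τ j => f τ * G τ j) (fun j => b * a j) := by
          have := hG.scal hf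
          convert this using 1; ring
        have h2 : ψ (ppart N (fun j => b * a j)) = 0 := hk ⟨N, _, _, h1, rfl⟩
        rw [psi_ppart] at h2
        rw [← h2, Finset.sum_mul, Finset.sum_mul, map_sum]
        refine Finset.sum_congr rfl fun j _ => ?_
        congr 1; ring⟩ hn
    ext ⟨j, m⟩
    have := congrArg (fun s => PowerSeries.coeff m s) (hz j)
    simpa using this
  have h : c ∈ imgI D (n + 2) := by rw [this]; trivial
  exact h

end

/-! ### Part 8: lattice estimates and Poisson summation -/

open scoped MatrixOrder Matrix.Norms.L2Operator in
lemma exists_factor (M : Matrix (Fin 24) (Fin 24) ℝ) (hM : M.PosSemidef) :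
    ∃ P : Matrix (Fin 24) (Fin 24) ℝ, M = Pᵀ * P := by
  have h := Matrix.nonneg_iff_posSemidef.2 hM
  obtain ⟨P, hP⟩ := CStarAlgebra.nonneg_iff_eq_star_mul_self.1 h
  exact ⟨P, by rw [hP, Matrix.star_eq_conjTranspose, Matrix.conjTranspose_eq_transpose_of_trivial]⟩

def toR (ℓ : LV) : Fin 24 → ℝ := fun i => (ℓ i : ℝ)

def BR (B : Matrix (Fin 24) (Fin 24) ℤ) : Matrix (Fin 24) (Fin 24) ℝ := B.map (Int.cast : ℤ → ℝ)

lemma pairZ_real (B : Matrix (Fin 24) (Fin 24) ℤ) (ℓ m : LV) :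
    ((pairZ B ℓ m : ℤ) : ℝ) = toR ℓ ⬝ᵥ (BR B *ᵥ toR m) := by
  simp [pairZ, toR, BR, dotProduct, Matrix.mulVec]

lemma IsLeech.psd {B : Matrix (Fin 24) (Fin 24) ℤ} (hB : IsLeech B) : (BR B).PosSemidef := by
  rw [Matrix.posSemidef_iff_dotProduct_mulVec]
  constructor
  · rw [Matrix.IsHermitian, Matrix.conjTranspose_eq_transpose_of_trivial, BR, ← Matrix.transpose_map, hB.1]
  · intro x
    rw [star_trivial]
    have hd : DenseRange (Pi.map fun (_ : Fin 24) (q : ℚ) => (q : ℝ)) :=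
      DenseRange.piMap fun _ => Rat.denseRange_cast
    refine hd.induction_on (p := fun x => 0 ≤ x ⬝ᵥ (BR B *ᵥ x)) x ?_ ?_
    · refine isClosed_le continuous_const ?_
      simp only [dotProduct, Matrix.mulVec]
      fun_prop
    · intro q
      obtain ⟨N, hN, hq⟩ : ∃ N : ℕ, 0 < N ∧ ∀ i, ∃ m : ℤ, q i * N = m := by
        refine ⟨∏ i, (q i).den, Finset.prod_pos fun i _ => (q i).pos, fun i => ?_⟩
        obtain ⟨c, hc⟩ := Finset.dvd_prod_of_mem (fun i => (q i).den) (Finset.mem_univ i)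
        refine ⟨(q i).num * c, ?_⟩
        rw [hc]; push_cast
        rw [← mul_assoc, Rat.mul_den_eq_num]
      choose m hm using hq
      have h1 : (0 : ℝ) ≤ (pairZ B m m : ℤ) := by
        by_cases h : m = 0
        · simp [h, pairZ]
        · exact_mod_cast (hB.2.2.1 m h).le
      rw [pairZ_real] at h1
      have h2 : toR m = (N : ℝ) • (Pi.map (fun (_ : Fin 24) (q : ℚ) => (q : ℝ)) q) := by
        ext i
        have := hm i
        simp only [toR, Pi.smul_apply, Pi.map_apply, smul_eq_mul]
        rw [mul_comm]
        exact_mod_cast this.symm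
      rw [h2, Matrix.mulVec_smul, smul_dotProduct, dotProduct_smul, smul_smul, smul_eq_mul] at h1
      exact nonneg_of_mul_nonneg_right h1 (by positivity)

lemma BR_det {B : Matrix (Fin 24) (Fin 24) ℤ} (hB : IsLeech B) : (BR B).det = 1 := by
  have := (Int.castRingHom ℝ).map_det B
  rw [hB.2.1] at this
  simpa [BR] using this.symm

lemma IsLeech.factor {B : Matrix (Fin 24) (Fin 24) ℤ} (hB : IsLeech B) :
    ∃ P : Matrix (Fin 24) (Fin 24) ℝ, BR B = Pᵀ * P ∧ |P.det| = 1 := by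
  obtain ⟨P, hP⟩ := exists_factor _ hB.psd
  refine ⟨P, hP, ?_⟩
  have h := BR_det hB
  rw [hP, Matrix.det_mul, Matrix.det_transpose, ← sq] at h
  rw [← sq_eq_sq₀ (abs_nonneg _) zero_le_one, sq_abs, h, one_pow]

lemma quad_factor {B : Matrix (Fin 24) (Fin 24) ℤ} {P : Matrix (Fin 24) (Fin 24) ℝ} (hP : BR B = Pᵀ * P)
    (x : Fin 24 → ℝ) : x ⬝ᵥ (BR B *ᵥ x) = ∑ i, (P *ᵥ x) i ^ 2 := by
  rw [hP, ← Matrix.mulVec_mulVec, Matrix.dotProduct_mulVec, Matrix.vecMul_transpose]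
  simp [dotProduct, sq]

lemma IsLeech.coercive {B : Matrix (Fin 24) (Fin 24) ℤ} (hB : IsLeech B) :
    ∃ c > 0, ∀ x : Fin 24 → ℝ, c * ∑ i, x i ^ 2 ≤ x ⬝ᵥ (BR B *ᵥ x) := by
  obtain ⟨P, hP, hd⟩ := hB.factor
  have hu : IsUnit P.det := by
    rw [isUnit_iff_ne_zero]; intro h; rw [h] at hd; simp at hd
  set C : ℝ := ∑ i, ∑ j, P⁻¹ i j ^ 2 with hC
  have hC0 : 0 ≤ C := Finset.sum_nonneg fun i _ => Finset.sum_nonneg fun j _ => sq_nonneg _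
  refine ⟨(C + 1)⁻¹, by positivity, fun x => ?_⟩
  rw [quad_factor hP, inv_mul_le_iff₀ (by positivity)]
  have hx : x = P⁻¹ *ᵥ (P *ᵥ x) := by rw [Matrix.mulVec_mulVec, Matrix.nonsing_inv_mul _ hu, Matrix.one_mulVec]
  generalize P *ᵥ x = y at hx
  calc ∑ i, x i ^ 2 ≤ ∑ i, (∑ j, P⁻¹ i j ^ 2) * ∑ j, y j ^ 2 := by
        refine Finset.sum_le_sum fun i _ => ?_
        have e : x i = ∑ j, P⁻¹ i j * y j := by rw [hx]; rfl
        rw [e]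
        exact Finset.sum_mul_sq_le_sq_mul_sq _ _ _
    _ = C * ∑ j, y j ^ 2 := by rw [hC, Finset.sum_mul]
    _ ≤ _ := by
        refine mul_le_mul_of_nonneg_right (by linarith) (Finset.sum_nonneg fun j _ => sq_nonneg _)

lemma summable_pi_prod {g : ℤ → ℝ} (h0 : ∀ n, 0 ≤ g n) (hg : Summable g) (d : ℕ) :
    Summable fun ℓ : Fin d → ℤ => ∏ i, g (ℓ i) := by
  induction d with
  | zero => exact (hasSum_fintype _).summable
  | succ d ih =>
    rw [← (Fin.consEquiv fun _ => ℤ).summable_iff]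
    refine (hg.mul_of_nonneg ih h0 fun ℓ => Finset.prod_nonneg fun i _ => h0 _).congr fun x => ?_
    simp [Fin.prod_univ_succ, Fin.consEquiv]

def n1 (ℓ : LV) : ℝ := ∑ i, |(ℓ i : ℝ)|

lemma n1_nonneg (ℓ : LV) : 0 ≤ n1 ℓ := Finset.sum_nonneg fun i _ => abs_nonneg _

lemma summable_n1 : Summable fun ℓ : LV => Real.exp (-n1 ℓ) := by
  have h1 : Summable fun n : ℤ => Real.exp (-|(n : ℝ)|) := by
    have h2 : Summable fun n : ℕ => Real.exp (-(n : ℝ)) := Real.summable_exp_neg_nat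
    refine Summable.of_nat_of_neg ?_ ?_
    · simpa using h2
    · simpa using h2
  refine (summable_pi_prod (fun n => (Real.exp_pos _).le) h1 24).congr fun ℓ => ?_
  rw [← Real.exp_sum, n1, Finset.sum_neg_distrib]

lemma IsLeech.bound {B : Matrix (Fin 24) (Fin 24) ℤ} (hB : IsLeech B) (a b : ℝ) (ha : 0 < a) :
    ∃ C > 0, ∀ ℓ : LV, Real.exp (-(a * (pairZ B ℓ ℓ : ℤ)) + b * n1 ℓ) ≤ C * Real.exp (-n1 ℓ) := by
  obtain ⟨c, hc, hcx⟩ := hB.coercive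
  refine ⟨Real.exp (24 * ((b + 1) ^ 2 / (4 * (a * c)))), Real.exp_pos _, fun ℓ => ?_⟩
  rw [← Real.exp_add, Real.exp_le_exp]
  have h1 := hcx (toR ℓ)
  rw [← pairZ_real] at h1
  have h2 : ∑ i : Fin 24, ((b + 1) * |(ℓ i : ℝ)|) ≤
      ∑ i : Fin 24, ((b + 1) ^ 2 / (4 * (a * c)) + a * c * (toR ℓ i) ^ 2) := by
    refine Finset.sum_le_sum fun i _ => ?_
    have hac : 0 < a * c := mul_pos ha hc
    rw [toR, ← sq_abs (ℓ i : ℝ)]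
    generalize |(ℓ i : ℝ)| = s
    have : 0 ≤ (2 * (a * c) * s - (b + 1)) ^ 2 / (4 * (a * c)) := by positivity
    have e : (2 * (a * c) * s - (b + 1)) ^ 2 / (4 * (a * c)) =
      (b + 1) ^ 2 / (4 * (a * c)) + a * c * s ^ 2 - (b + 1) * s := by field_simp; ring
    linarith
  rw [← Finset.mul_sum, Finset.sum_add_distrib, ← Finset.mul_sum] at h2
  simp only [Finset.sum_const, Finset.card_univ, Fintype.card_fin, nsmul_eq_mul] at h2
  have h3 := mul_le_mul_of_nonneg_left h1 ha.le
  change (b + 1) * n1 ℓ ≤ _ at h2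
  push_cast at h2
  nlinarith

def bsum (B : Matrix (Fin 24) (Fin 24) ℤ) : ℝ := ∑ i, ∑ j, |(B i j : ℝ)|

lemma norm_pairC_le (B : Matrix (Fin 24) (Fin 24) ℤ) (ℓ : LV) (z : CV) :
    ‖pairC B (liftC ℓ) z‖ ≤ bsum B * ‖z‖ * n1 ℓ := by
  have hb : ∀ i, ‖((B.map (Int.cast : ℤ → ℂ)).mulVec z) i‖ ≤ bsum B * ‖z‖ := by
    intro i
    change ‖∑ j, (B.map (Int.cast : ℤ → ℂ)) i j * z j‖ ≤ _
    refine (norm_sum_le _ _).trans ?_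
    have : ∑ j, |(B i j : ℝ)| ≤ bsum B :=
      Finset.single_le_sum (f := fun i => ∑ j, |(B i j : ℝ)|)
        (fun i _ => Finset.sum_nonneg fun j _ => abs_nonneg _) (Finset.mem_univ i)
    refine le_trans ?_ (mul_le_mul_of_nonneg_right this (norm_nonneg z))
    rw [Finset.sum_mul]
    refine Finset.sum_le_sum fun j _ => ?_
    rw [norm_mul]
    have h1 : ‖(B.map (Int.cast : ℤ → ℂ)) i j‖ = |(B i j : ℝ)| := by simp
    rw [h1]
    exact mul_le_mul_of_nonneg_left (norm_le_pi_norm z j) (abs_nonneg _)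
  rw [pairC, n1, Finset.mul_sum]
  change ‖∑ i, liftC ℓ i * ((B.map (Int.cast : ℤ → ℂ)).mulVec z) i‖ ≤ _
  refine (norm_sum_le _ _).trans (Finset.sum_le_sum fun i _ => ?_)
  rw [norm_mul, mul_comm]
  have h1 : ‖liftC ℓ i‖ = |(ℓ i : ℝ)| := by simp [liftC]
  rw [h1]
  exact mul_le_mul_of_nonneg_right (hb i) (abs_nonneg _)

lemma norm_eC_le (x : ℂ) : ‖eC x‖ ≤ Real.exp (2 * π * ‖x‖) := by
  rw [norm_eC]
  apply Real.exp_le_exp.2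
  have := (abs_le.1 (Complex.abs_im_le_norm x)).1
  nlinarith [Real.pi_pos]

/-! ### Part 9: Fourier series on the torus, Poisson summation -/

def dotC (n : LV) (x : Fin 24 → ℝ) : ℂ := ∑ i, (n i : ℂ) * (x i : ℂ)

def toT (x : Fin 24 → ℝ) : UnitAddTorus (Fin 24) := Pi.map (fun _ (y : ℝ) => (y : UnitAddCircle)) x

lemma eC_sum {α : Type*} (s : Finset α) (f : α → ℂ) : eC (∑ i ∈ s, f i) = ∏ i ∈ s, eC (f i) := by
  simp only [eC, Finset.mul_sum, Complex.exp_sum]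

lemma mFourier_toT (n : LV) (x : Fin 24 → ℝ) : UnitAddTorus.mFourier n (toT x) = eC (dotC n x) := by
  rw [dotC, eC_sum]
  change ∏ i, fourier (n i) ((x i : ℝ) : UnitAddCircle) = _
  refine Finset.prod_congr rfl fun i _ => ?_
  rw [fourier_coe_apply, eC]; congr 1; push_cast; ring

lemma toT_quot : IsOpenQuotientMap toT :=
  IsOpenQuotientMap.piMap fun _ => QuotientAddGroup.isOpenQuotientMap_mk

lemma toT_add (x : Fin 24 → ℝ) (m : LV) : toT (x + toR m) = toT x := by
  funext i
  change (((x i + m i : ℝ)) : UnitAddCircle) = ((x i : ℝ) : UnitAddCircle)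
  rw [AddCircle.coe_add]
  have := AddCircle.coe_period (1 : ℝ)
  rw [show ((m i : ℝ) : UnitAddCircle) = (m i) • ((1 : ℝ) : UnitAddCircle) by
    rw [← AddCircle.coe_zsmul]; simp, this, smul_zero, add_zero]

lemma exists_toR_of_toT {x y : Fin 24 → ℝ} (h : toT x = toT y) : ∃ m : LV, y = x + toR m := by
  have : ∀ i, ∃ m : ℤ, y i = x i + m := by
    intro i
    have h1 : ((x i : ℝ) : UnitAddCircle) = ((y i : ℝ) : UnitAddCircle) := congrFun h i
    have h2 : ((y i - x i : ℝ) : UnitAddCircle) = 0 := by rw [AddCircle.coe_sub, h1, sub_self]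
    obtain ⟨m, hm⟩ := (AddCircle.coe_eq_zero_iff (1 : ℝ)).1 h2
    exact ⟨m, by simp at hm; linarith⟩
  choose m hm using this
  exact ⟨m, funext hm⟩

section

attribute [local instance] instMeasureSpaceUnitAddCircle

local instance : MeasureTheory.IsProbabilityMeasure (MeasureTheory.volume : MeasureTheory.Measure UnitAddCircle) :=
  inferInstanceAs (MeasureTheory.IsProbabilityMeasure AddCircle.haarAddCircle)

open UnitAddTorus MeasureTheory in
lemma fourier_unique {c : LV → ℂ} (hc : Summable fun n => ‖c n‖)
    (h : ∀ x : Fin 24 → ℝ, ∑' n, c n * eC (dotC n x) = 0) (n : LV) : c n = 0 := by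
  have hs : Summable fun n : LV => c n • (mFourier n : C(UnitAddTorus (Fin 24), ℂ)) := by
    apply Summable.of_norm
    simpa [norm_smul, mFourier_norm] using hc
  have h0 : ∑' n : LV, c n • (mFourier n : C(UnitAddTorus (Fin 24), ℂ)) = 0 := by
    ext y
    obtain ⟨x, rfl⟩ := toT_quot.surjective y
    rw [← ContinuousMap.tsum_apply hs]
    simpa [mFourier_toT] using h x
  have h1 := hs.hasSum
  rw [h0] at h1
  have h2 := h1.mapL (ContinuousMap.toLp (E := ℂ) 2 (volume : Measure (UnitAddTorus (Fin 24))) ℂ)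
  have h3 := ContinuousLinearMap.hasSum (innerSL ℂ (mFourierLp (d := Fin 24) 2 n)) h2
  have h4 : HasSum (fun m : LV => if m = n then c n else 0) (0 : ℂ) := by
    refine HasSum.congr_of (by simpa using h3) fun m => ?_
    have := orthonormal_iff_ite.1 (orthonormal_mFourier (d := Fin 24)) n m
    simp only [map_smul, innerSL_apply_apply, mFourierLp] at this ⊢
    rw [this]
    by_cases hm : m = n
    · subst hm; simp
    · simp [hm, Ne.symm hm]
  exact (hasSum_ite_eq n (c n)).unique h4

end

lemma box_pairwise (a b : ℝ) (m n : ℤ) (ha : 0 < a ∧ a ≤ 1) (hb : 0 < b ∧ b ≤ 1) (h : a + m = b + n) : m = n := by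
  have h1 : (m : ℝ) < n + 1 := by linarith
  have h2 : (n : ℝ) < m + 1 := by linarith
  have h1' : m < n + 1 := by exact_mod_cast h1
  have h2' : n < m + 1 := by exact_mod_cast h2
  omega

def ubox : Set (Fin 24 → ℝ) := {x : Fin 24 → ℝ | ∀ i, x i ∈ Set.Ioc ((0 : Fin 24 → ℝ) i) ((0 : Fin 24 → ℝ) i + 1)}

lemma ubox_eq : ubox = Set.pi Set.univ fun _ => Set.Ioc (0 : ℝ) 1 := by
  ext x; simp [ubox]

lemma ubox_meas : MeasurableSet ubox := by
  rw [ubox_eq]; exact MeasurableSet.univ_pi fun _ => measurableSet_Ioc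

lemma ubox_norm {x : Fin 24 → ℝ} (hx : x ∈ ubox) : ‖x‖ ≤ 1 := by
  rw [ubox_eq] at hx
  refine (pi_norm_le_iff_of_nonneg zero_le_one).2 fun i => ?_
  have := hx i (Set.mem_univ i)
  rw [Real.norm_eq_abs, abs_le]
  constructor <;> linarith [this.1, this.2]

open MeasureTheory in
lemma ubox_vol : volume ubox = 1 := by
  rw [ubox_eq, volume_pi_pi]; simp

open MeasureTheory in
/-- Unfolding an integral over `ℝ^24`. -/
lemma integral_unfold (g : (Fin 24 → ℝ) → ℂ) (hg : Integrable g) :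
    HasSum (fun m : LV => ∫ x in ubox, g (x + toR m)) (∫ x, g x) := by
  have key : ∀ m : LV, ∫ x in ubox, g (x + toR m) = ∫ x in (fun x => x + -toR m) ⁻¹' ubox, g x := by
    intro m
    have := (measurePreserving_add_right (volume : Measure (Fin 24 → ℝ)) (-toR m)).setIntegral_preimage_emb
      (MeasurableEquiv.addRight (-toR m)).measurableEmbedding (fun x => g (x + toR m)) ubox
    rw [← this]
    simp
  simp only [key]
  have hu : (⋃ m : LV, (fun x => x + -toR m) ⁻¹' ubox) = Set.univ := by
    rw [Set.eq_univ_iff_forall]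
    intro x
    rw [Set.mem_iUnion]
    refine ⟨fun i => ⌈x i⌉ - 1, ?_⟩
    rw [ubox_eq]
    intro i _
    simp only [Pi.add_apply, Pi.neg_apply, toR]
    push_cast
    have h1 := Int.ceil_lt_add_one (x i)
    have h2 := Int.le_ceil (x i)
    constructor <;> linarith
  have h := hasSum_integral_iUnion (μ := volume) (f := g) (s := fun m : LV => (fun x => x + -toR m) ⁻¹' ubox)
    (fun m => (measurable_add_const _) ubox_meas) (by
      intro m n hmn
      rw [Function.onFun, Set.disjoint_left]
      intro x hm hn
      apply hmn
      rw [ubox_eq] at hm hn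
      ext i
      have hm := hm i (Set.mem_univ i)
      have hn := hn i (Set.mem_univ i)
      refine box_pairwise _ _ _ _ hm hn ?_
      simp [toR]) (by rw [hu]; exact hg.integrableOn)
  rw [hu, setIntegral_univ] at h
  exact h

open MeasureTheory UnitAddTorus in
lemma poisson (g : (Fin 24 → ℝ) → ℂ) (hc : Continuous g) (hg : Integrable g)
    (hb : ∀ r : ℝ, ∃ u : LV → ℝ, Summable u ∧ ∀ x, ‖x‖ ≤ r → ∀ m, ‖g (x + toR m)‖ ≤ u m)
    (hF : Summable fun n : LV => ∫ x, eC (-dotC n x) * g x) :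
    HasSum (fun n : LV => ∫ x, eC (-dotC n x) * g x) (∑' m : LV, g (toR m)) := by
  set F : (Fin 24 → ℝ) → ℂ := fun x => ∑' m : LV, g (x + toR m) with hFdef
  have hFc : Continuous F := by
    rw [continuous_iff_continuousAt]
    intro x
    obtain ⟨u, hu, hxu⟩ := hb (‖x‖ + 1)
    have : ContinuousOn F (Metric.closedBall 0 (‖x‖ + 1)) := by
      refine continuousOn_tsum (fun m => (by fun_prop)) hu fun m y hy => hxu y (by simpa using hy) m
    exact this.continuousAt (Metric.closedBall_mem_nhds_of_mem (by simp))
  have hFp : ∀ x m, F (x + toR m) = F x := by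
    intro x m
    rw [hFdef]
    simp only
    rw [← (Equiv.addLeft m).tsum_eq (fun n => g (x + toR n))]
    refine tsum_congr fun n => ?_
    congr 1
    rw [add_assoc]; congr 1; ext i; simp [toR]
  have hlift : ∀ x, F (Function.surjInv toT_quot.surjective (toT x)) = F x := by
    intro x
    obtain ⟨m, hm⟩ := exists_toR_of_toT (Function.surjInv_eq toT_quot.surjective (toT x)).symm
    rw [hm, hFp]
  let F' : C(UnitAddTorus (Fin 24), ℂ) := ⟨fun y => F (Function.surjInv toT_quot.surjective y), by
    refine toT_quot.isQuotientMap.continuous_iff.2 ?_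
    exact hFc.congr fun x => (hlift x).symm⟩
  have hcoef : ∀ n : LV, mFourierCoeff F' n = ∫ x, eC (-dotC n x) * g x := by
    intro n
    rw [mFourierCoeff_eq_integral F' n 0]
    have hE : Continuous fun x => eC (-dotC n x) := by
      unfold eC dotC; fun_prop
    have hE1 : ∀ x, ‖eC (-dotC n x)‖ = 1 := by
      intro x
      rw [norm_eC]; simp [dotC]
    have hI : Integrable fun x => eC (-dotC n x) * g x := by
      refine hg.bdd_mul hE.aestronglyMeasurable (c := 1) (.of_forall fun x => (hE1 x).le)
    have h1 := integral_unfold _ hI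
    have hper : ∀ x (m : LV), eC (-dotC n (x + toR m)) = eC (-dotC n x) := by
      intro x m
      have := mFourier_toT (-n) (x + toR m)
      rw [toT_add, mFourier_toT] at this
      have e : ∀ y, dotC (-n) y = -dotC n y := fun y => by simp [dotC]
      rw [← e, ← e, this]
    obtain ⟨u, hu, hxu⟩ := hb 1
    have h2 := hasSum_integral_of_summable_integral_norm (μ := volume.restrict ubox)
      (F := fun (m : LV) x => eC (-dotC n x) * g (x + toR m)) (by
        intro m
        have hcm : Continuous fun x => eC (-dotC n x) * g (x + toR m) := by fun_prop
        refine Measure.integrableOn_of_bounded (M := u m) (by rw [ubox_vol]; simp) hcm.aestronglyMeasurable ?_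
        refine (ae_restrict_iff' ubox_meas).2 (.of_forall fun x hx => ?_)
        rw [norm_mul, hE1, one_mul]; exact hxu x (ubox_norm hx) m) (by
        refine Summable.of_nonneg_of_le (fun m => integral_nonneg fun x => norm_nonneg _) (fun m => ?_) hu
        have := norm_setIntegral_le_of_norm_le_const (μ := volume) (s := ubox) (C := u m)
          (f := fun x => ‖eC (-dotC n x) * g (x + toR m)‖) (by rw [ubox_vol]; simp) (fun x hx => by
            rw [norm_norm, norm_mul, hE1, one_mul]; exact hxu x (ubox_norm hx) m)
        simp only [Measure.real, ubox_vol] at this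
        simpa using (le_abs_self _).trans this)
    have h3 : ∫ x in ubox, (∑' m : LV, eC (-dotC n x) * g (x + toR m)) = ∫ x, eC (-dotC n x) * g x := by
      refine h2.unique (HasSum.congr_of h1 fun m => ?_)
      simp only [hper]
    rw [← h3]
    refine setIntegral_congr_fun ubox_meas fun x hx => ?_
    have e : dotC (-n) x = -dotC n x := by simp [dotC]
    rw [tsum_mul_left, ← e, ← mFourier_toT, smul_eq_mul]
    congr 1
    exact hlift x
  have h4 := hasSum_mFourier_series_apply_of_summable (f := F') (by
    rw [show mFourierCoeff F' = _ from funext hcoef]; exact hF) (toT 0)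
  have h5 : F' (toT 0) = ∑' m : LV, g (toR m) := by
    change F (Function.surjInv toT_quot.surjective (toT 0)) = _
    rw [hlift, hFdef]; simp
  rw [h5] at h4
  refine HasSum.congr_of h4 fun n => ?_
  rw [hcoef, mFourier_toT]
  simp [dotC, eC]

/-! ### Part 10: the theta transformation formula -/

section pairing

variable (B : Matrix (Fin 24) (Fin 24) ℤ)

lemma pairC_add_left (u v w : CV) : pairC B (u + v) w = pairC B u w + pairC B v w := add_dotProduct _ _ _
lemma pairC_add_right (u v w : CV) : pairC B u (v + w) = pairC B u v + pairC B u w := by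
  simp [pairC, Matrix.mulVec_add, dotProduct_add]
lemma pairC_smul_left (c : ℂ) (u v : CV) : pairC B (c • u) v = c * pairC B u v := smul_dotProduct _ _ _
lemma pairC_smul_right (c : ℂ) (u v : CV) : pairC B u (c • v) = c * pairC B u v := by
  simp [pairC, Matrix.mulVec_smul, dotProduct_smul]
lemma pairC_neg_left (u v : CV) : pairC B (-u) v = -pairC B u v := neg_dotProduct _ _
lemma pairC_neg_right (u v : CV) : pairC B u (-v) = -pairC B u v := by
  simp [pairC, Matrix.mulVec_neg, dotProduct_neg]
lemma pairC_symm {B : Matrix (Fin 24) (Fin 24) ℤ} (hB : B.IsSymm) (u v : CV) : pairC B u v = pairC B v u := by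
  rw [pairC, Matrix.dotProduct_mulVec, dotProduct_comm, ← Matrix.mulVec_transpose, ← Matrix.transpose_map, hB]
  rfl

lemma pairZ_add_left (u v w : LV) : pairZ B (u + v) w = pairZ B u w + pairZ B v w := add_dotProduct _ _ _
lemma pairZ_add_right (u v w : LV) : pairZ B u (v + w) = pairZ B u v + pairZ B u w := by
  simp [pairZ, Matrix.mulVec_add, dotProduct_add]
lemma pairZ_smul_left (c : ℤ) (u v : LV) : pairZ B (c • u) v = c * pairZ B u v := smul_dotProduct _ _ _
lemma pairZ_smul_right (c : ℤ) (u v : LV) : pairZ B u (c • v) = c * pairZ B u v := by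
  rw [pairZ, Matrix.mulVec_smul, dotProduct_smul, smul_eq_mul]; rfl
lemma pairZ_symm {B : Matrix (Fin 24) (Fin 24) ℤ} (hB : B.IsSymm) (u v : LV) : pairZ B u v = pairZ B v u := by
  rw [pairZ, Matrix.dotProduct_mulVec, dotProduct_comm, ← Matrix.mulVec_transpose, hB]
  rfl

def cR (x : Fin 24 → ℝ) : CV := fun i => (x i : ℂ)

lemma cR_toR (ℓ : LV) : cR (toR ℓ) = liftC ℓ := by ext i; simp [cR, toR, liftC]
lemma cR_add (x y : Fin 24 → ℝ) : cR (x + y) = cR x + cR y := by ext i; simp [cR]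
lemma liftC_add (x y : LV) : liftC (x + y) = liftC x + liftC y := by ext i; simp [liftC]
lemma liftC_neg (x : LV) : liftC (-x) = -liftC x := by ext i; simp [liftC]
lemma liftC_smul (c : ℤ) (x : LV) : liftC (c • x) = (c : ℂ) • liftC x := by ext i; simp [liftC]
lemma liftC_zero : liftC 0 = 0 := by ext i; simp [liftC]

lemma pairC_cR (x y : Fin 24 → ℝ) : pairC B (cR x) (cR y) = ((x ⬝ᵥ (BR B *ᵥ y) : ℝ) : ℂ) := by
  simp [pairC, cR, BR, dotProduct, Matrix.mulVec]

lemma pairC_liftC (x y : LV) : pairC B (liftC x) (liftC y) = (pairZ B x y : ℂ) := by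
  rw [← cR_toR, ← cR_toR, pairC_cR, ← pairZ_real]; simp

lemma dotC_mulVec {B : Matrix (Fin 24) (Fin 24) ℤ} (hB : B.IsSymm) (ℓ : LV) (x : Fin 24 → ℝ) :
    dotC (B *ᵥ ℓ) x = pairC B (liftC ℓ) (cR x) := by
  rw [pairC_symm hB, pairC, dotProduct]
  refine Finset.sum_congr rfl fun i _ => ?_
  rw [mul_comm, cR]; congr 1
  simp [Matrix.mulVec, dotProduct, liftC]

lemma bsum_nonneg : 0 ≤ bsum B := Finset.sum_nonneg fun i _ => Finset.sum_nonneg fun j _ => abs_nonneg _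

lemma norm_pairC_le' (u v : CV) : ‖pairC B u v‖ ≤ bsum B * ‖u‖ * ‖v‖ := by
  have e : pairC B u v = ∑ i, ∑ j, u i * ((B i j : ℂ) * v j) := by
    simp [pairC, dotProduct, Matrix.mulVec, Finset.mul_sum]
  rw [e, bsum, Finset.sum_mul, Finset.sum_mul]
  refine (norm_sum_le _ _).trans (Finset.sum_le_sum fun i _ => ?_)
  rw [Finset.sum_mul, Finset.sum_mul]
  refine (norm_sum_le _ _).trans (Finset.sum_le_sum fun j _ => ?_)
  rw [norm_mul, norm_mul]
  have h1 : ‖((B i j : ℤ) : ℂ)‖ = |(B i j : ℝ)| := by simp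
  rw [h1]
  calc ‖u i‖ * (|(B i j : ℝ)| * ‖v j‖) ≤ ‖u‖ * (|(B i j : ℝ)| * ‖v‖) := by
        gcongr
        · exact norm_le_pi_norm u i
        · exact norm_le_pi_norm v j
    _ = _ := by ring

lemma norm_cR (x : Fin 24 → ℝ) : ‖cR x‖ = ‖x‖ := by
  simp [cR, Pi.norm_def]

@[fun_prop]
lemma continuous_pairC {X : Type*} [TopologicalSpace X] {f g : X → CV} (hf : Continuous f) (hg : Continuous g) :
    Continuous fun x => pairC B (f x) (g x) := by
  simp only [pairC, dotProduct, Matrix.mulVec]; fun_prop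

@[fun_prop]
lemma continuous_cR : Continuous cR := by unfold cR; fun_prop

lemma continuous_eC : Continuous eC := differentiable_eC.continuous

end pairing

section gauss

variable {B : Matrix (Fin 24) (Fin 24) ℤ}

lemma pairC_factor {P : Matrix (Fin 24) (Fin 24) ℝ} (hP : BR B = Pᵀ * P) (u v : CV) :
    pairC B u v = ∑ i, (P.map (fun r : ℝ => (r : ℂ)) *ᵥ u) i * (P.map (fun r : ℝ => (r : ℂ)) *ᵥ v) i := by
  have h : B.map (Int.cast : ℤ → ℂ) = (P.map (fun r : ℝ => (r : ℂ)))ᵀ * P.map (fun r : ℝ => (r : ℂ)) := by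
    have := congrArg (fun M : Matrix (Fin 24) (Fin 24) ℝ => M.map (fun r : ℝ => (r : ℂ))) hP
    ext i j
    have := congrFun (congrFun this i) j
    simpa [BR, Matrix.mul_apply] using this
  rw [pairC, h, ← Matrix.mulVec_mulVec, Matrix.dotProduct_mulVec, Matrix.vecMul_transpose]
  rfl

lemma mulVec_cR (P : Matrix (Fin 24) (Fin 24) ℝ) (x : Fin 24 → ℝ) :
    P.map (fun r : ℝ => (r : ℂ)) *ᵥ cR x = cR (P *ᵥ x) := by
  ext i; simp [cR, Matrix.mulVec, dotProduct]

open MeasureTheory in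
lemma gauss_integral (hB : IsLeech B) (s : ℂ) (hs : 0 < s.im) (u : CV) :
    Integrable (fun x : Fin 24 → ℝ => eC (s * pairC B (cR x) (cR x) / 2 + pairC B (cR x) u)) ∧
    ∫ x : Fin 24 → ℝ, eC (s * pairC B (cR x) (cR x) / 2 + pairC B (cR x) u) =
      (s ^ 12)⁻¹ * eC (-(pairC B u u / (2 * s))) := by
  obtain ⟨P, hP, hd⟩ := hB.factor
  have hd0 : P.det ≠ 0 := by intro h; rw [h] at hd; simp at hd
  have hs0 : s ≠ 0 := by rintro rfl; simp at hs
  have hmp : MeasurePreserving (fun x : Fin 24 → ℝ => P *ᵥ x) volume volume := by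
    refine ⟨by fun_prop, ?_⟩
    have := Real.map_matrix_volume_pi_eq_smul_volume_pi hd0
    rw [abs_inv, hd] at this
    rw [inv_one, ENNReal.ofReal_one, one_smul] at this
    exact this
  have hme : MeasurableEmbedding (fun x : Fin 24 → ℝ => P *ᵥ x) := by
    have hinj : Function.Injective (fun x : Fin 24 → ℝ => P *ᵥ x) :=
      Matrix.mulVec_injective_iff_isUnit.2 ((Matrix.isUnit_iff_isUnit_det P).2 (isUnit_iff_ne_zero.2 hd0))
    exact (by fun_prop : Continuous (fun x : Fin 24 → ℝ => P *ᵥ x)).measurableEmbedding hinj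
  set b : ℂ := -(π * Complex.I * s) with hb
  have hbre : 0 < b.re := by
    have : b.re = π * s.im := by simp [hb]
    rw [this]; positivity
  set c : Fin 24 → ℂ := fun i => 2 * π * Complex.I * (P.map (fun r : ℝ => (r : ℂ)) *ᵥ u) i with hcdef
  have e : (fun x : Fin 24 → ℝ => eC (s * pairC B (cR x) (cR x) / 2 + pairC B (cR x) u)) =
      (fun v : Fin 24 → ℝ => cexp (-b * ∑ i, (v i : ℂ) ^ 2 + ∑ i, c i * v i)) ∘ (fun x => P *ᵥ x) := by
    ext x
    simp only [Function.comp]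
    rw [eC, pairC_factor hP, pairC_factor hP, mulVec_cR]
    congr 1
    change 2 * π * Complex.I * (s * (∑ i, (((P *ᵥ x) i : ℝ) : ℂ) * (((P *ᵥ x) i : ℝ) : ℂ)) / 2 +
      ∑ i, (((P *ᵥ x) i : ℝ) : ℂ) * (P.map (fun r : ℝ => (r : ℂ)) *ᵥ u) i) =
      -(-(π * Complex.I * s)) * ∑ i, (((P *ᵥ x) i : ℝ) : ℂ) ^ 2 +
      ∑ i, 2 * π * Complex.I * (P.map (fun r : ℝ => (r : ℂ)) *ᵥ u) i * (((P *ᵥ x) i : ℝ) : ℂ)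
    have e1 : ∑ i, (((P *ᵥ x) i : ℝ) : ℂ) * (((P *ᵥ x) i : ℝ) : ℂ) = ∑ i, (((P *ᵥ x) i : ℝ) : ℂ) ^ 2 :=
      Finset.sum_congr rfl fun i _ => (sq _).symm
    have e2 : ∑ i, (((P *ᵥ x) i : ℝ) : ℂ) * (P.map (fun r : ℝ => (r : ℂ)) *ᵥ u) i =
      ∑ i, (P.map (fun r : ℝ => (r : ℂ)) *ᵥ u) i * (((P *ᵥ x) i : ℝ) : ℂ) :=
      Finset.sum_congr rfl fun i _ => mul_comm _ _
    have e3 : ∑ i, 2 * π * Complex.I * (P.map (fun r : ℝ => (r : ℂ)) *ᵥ u) i * (((P *ᵥ x) i : ℝ) : ℂ) =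
      2 * π * Complex.I * ∑ i, (P.map (fun r : ℝ => (r : ℂ)) *ᵥ u) i * (((P *ᵥ x) i : ℝ) : ℂ) := by
      rw [Finset.mul_sum]; exact Finset.sum_congr rfl fun i _ => mul_assoc _ _ _
    rw [e1, e2, e3]
    ring
  rw [e]
  constructor
  · exact (hmp.integrable_comp_emb hme).2 (GaussianFourier.integrable_cexp_neg_mul_sum_add hbre c)
  · refine (hmp.integral_comp hme
      (fun v : Fin 24 → ℝ => cexp (-b * ∑ i, (v i : ℂ) ^ 2 + ∑ i, c i * v i))).trans ?_
    rw [GaussianFourier.integral_cexp_neg_mul_sum_add hbre c]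
    have hpi : (π : ℂ) ≠ 0 := by exact_mod_cast Real.pi_ne_zero
    congr 1
    · rw [show ((Fintype.card (Fin 24) : ℂ) / 2) = ((12 : ℕ) : ℂ) by norm_num, Complex.cpow_natCast, hb]
      rw [show (π : ℂ) / -(π * Complex.I * s) = Complex.I * s⁻¹ by
        field_simp; rw [Complex.I_sq], mul_pow, inv_pow,
        show Complex.I ^ 12 = 1 by rw [show 12 = 4 * 3 by norm_num, pow_mul, Complex.I_pow_four, one_pow], one_mul]
    · rw [eC, pairC_factor hP]
      congr 1
      simp only [hcdef, hb, mul_pow, ← Finset.mul_sum, ← sq]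
      rw [Complex.I_sq]
      have hI := Complex.I_ne_zero
      field_simp
      ring_nf
      try simp [Complex.I_sq]

end gauss

section theta

variable {B : Matrix (Fin 24) (Fin 24) ℤ}

def tterm (B : Matrix (Fin 24) (Fin 24) ℤ) (s : ℂ) (w : CV) (m : LV) : ℂ :=
  eC (s * (pairZ B m m : ℂ) / 2 + pairC B (liftC m) w)

def theta (B : Matrix (Fin 24) (Fin 24) ℤ) (s : ℂ) (w : CV) : ℂ := ∑' m : LV, tterm B s w m

lemma pairZ_self_nonneg (hB : IsLeech B) (m : LV) : 0 ≤ pairZ B m m := by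
  by_cases h : m = 0
  · subst h; simp [pairZ]
  · exact (hB.2.2.1 m h).le

lemma tterm_bound (hB : IsLeech B) (a r : ℝ) (ha : 0 < a) : ∃ C > 0, ∀ (s : ℂ) (w : CV), a ≤ s.im → ‖w‖ ≤ r →
    ∀ m, ‖tterm B s w m‖ ≤ C * Real.exp (-n1 m) := by
  obtain ⟨C, hC, h⟩ := hB.bound (π * a) (2 * π * (bsum B * r)) (by positivity)
  refine ⟨C, hC, fun s w hs hw m => le_trans ?_ (h m)⟩
  rw [tterm, eC_add, norm_mul, Real.exp_add]
  have h0 : (0 : ℝ) ≤ (pairZ B m m : ℤ) := by exact_mod_cast pairZ_self_nonneg hB m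
  refine mul_le_mul ?_ ?_ (norm_nonneg _) (Real.exp_pos _).le
  · rw [norm_eC]
    apply Real.exp_le_exp.2
    have : (s * (pairZ B m m : ℂ) / 2).im = s.im * (pairZ B m m : ℤ) / 2 := by
      rw [show (s * (pairZ B m m : ℂ) / 2) = s * (((pairZ B m m : ℤ) : ℝ) / 2 : ℝ) by push_cast; ring, Complex.im_mul_ofReal]
      ring
    rw [this]
    have := mul_le_mul_of_nonneg_right hs h0
    nlinarith [Real.pi_pos, mul_le_mul_of_nonneg_left this Real.pi_pos.le]
  · refine (norm_eC_le _).trans (Real.exp_le_exp.2 ?_)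
    have h1 := norm_pairC_le B m w
    have h2 : bsum B * ‖w‖ * n1 m ≤ bsum B * r * n1 m := by
      have := n1_nonneg m
      have := bsum_nonneg B
      gcongr
    calc 2 * π * ‖pairC B (liftC m) w‖ ≤ 2 * π * (bsum B * r * n1 m) := by
          have := Real.pi_pos
          gcongr; exact h1.trans h2
      _ = _ := by ring

lemma tterm_summable (hB : IsLeech B) (s : ℂ) (hs : 0 < s.im) (w : CV) : Summable fun m => ‖tterm B s w m‖ := by
  obtain ⟨C, hC, h⟩ := tterm_bound hB s.im ‖w‖ hs
  exact Summable.of_nonneg_of_le (fun _ => norm_nonneg _) (fun m => h s w le_rfl le_rfl m) (summable_n1.mul_left C)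

def bEquiv (hB : IsLeech B) : LV ≃ LV where
  toFun m := B *ᵥ m
  invFun m := B⁻¹ *ᵥ m
  left_inv m := by
    simp only [Matrix.mulVec_mulVec]
    rw [Matrix.nonsing_inv_mul _ (by rw [hB.2.1]; exact isUnit_one), Matrix.one_mulVec]
  right_inv m := by
    simp only [Matrix.mulVec_mulVec]
    rw [Matrix.mul_nonsing_inv _ (by rw [hB.2.1]; exact isUnit_one), Matrix.one_mulVec]

lemma theta_S (hB : IsLeech B) (s : ℂ) (hs : 0 < s.im) (w : CV) :
    theta B s w = (s ^ 12)⁻¹ * eC (-(pairC B w w / (2 * s))) * theta B (-1 / s) (s⁻¹ • w) := by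
  have hs0 : s ≠ 0 := by rintro rfl; simp at hs
  have hs' : 0 < (-1 / s).im := by
    rw [neg_div, one_div, Complex.neg_im, Complex.inv_im]
    have : 0 < Complex.normSq s := Complex.normSq_pos.2 hs0
    rw [neg_div, neg_neg]; positivity
  set g : (Fin 24 → ℝ) → ℂ := fun x => eC (s * pairC B (cR x) (cR x) / 2 + pairC B (cR x) w) with hg
  have hgm : ∀ m, g (toR m) = tterm B s w m := by
    intro m; simp only [hg, cR_toR, pairC_liftC]; rfl
  have hint : ∀ ℓ, ∫ x, eC (-dotC (B *ᵥ ℓ) x) * g x =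
      (s ^ 12)⁻¹ * eC (-(pairC B w w / (2 * s))) * tterm B (-1 / s) (s⁻¹ • w) ℓ := by
    intro ℓ
    have : ∀ x, eC (-dotC (B *ᵥ ℓ) x) * g x =
        eC (s * pairC B (cR x) (cR x) / 2 + pairC B (cR x) (w + -liftC ℓ)) := by
      intro x
      rw [hg, ← eC_add, dotC_mulVec hB.1, pairC_add_right, pairC_neg_right, pairC_symm hB.1 (liftC ℓ)]
      ring_nf
    simp only [this]
    rw [(gauss_integral hB s hs _).2, tterm, mul_assoc, ← eC_add]
    simp only [pairC_add_right, pairC_add_left, pairC_neg_right, pairC_neg_left, pairC_smul_right, pairC_liftC,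
      pairC_symm hB.1 w]
    congr 2
    field_simp
    ring
  have hp := poisson g (by rw [hg]; exact continuous_eC.comp (by fun_prop)) (gauss_integral hB s hs w).1 ?_ ?_
  · have h1 := (bEquiv hB).hasSum_iff.2 hp
    have h2 := HasSum.congr_of h1 (g := fun ℓ => (s ^ 12)⁻¹ * eC (-(pairC B w w / (2 * s))) * tterm B (-1 / s) (s⁻¹ • w) ℓ)
      (fun ℓ => (hint ℓ).symm)
    simp only [hgm] at h2
    rw [theta, theta, ← tsum_mul_left]
    exact h2.tsum_eq.symm
  · intro r
    obtain ⟨C, hC, h⟩ := tterm_bound hB s.im (‖w‖ + ‖s‖ * r) hs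
    refine ⟨fun m => Real.exp (2 * π * (‖s‖ * (bsum B * r * r) / 2 + bsum B * r * ‖w‖)) * (C * Real.exp (-n1 m)),
      (summable_n1.mul_left C).mul_left _, fun x hx m => ?_⟩
    have e : g (x + toR m) = eC (s * pairC B (cR x) (cR x) / 2 + pairC B (cR x) w) * tterm B s (w + s • cR x) m := by
      rw [hg, tterm, ← eC_add]
      simp only [cR_add, cR_toR, pairC_add_right, pairC_add_left, pairC_smul_right, pairC_liftC, pairC_symm hB.1 (cR x) (liftC m)]
      congr 1; ring
    have hb := bsum_nonneg B
    have hr : 0 ≤ r := (norm_nonneg x).trans hx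
    rw [e, norm_mul]
    refine mul_le_mul ?_ (h s _ le_rfl ?_ m) (norm_nonneg _) (Real.exp_pos _).le
    · refine (norm_eC_le _).trans (Real.exp_le_exp.2 ?_)
      have hp := Real.pi_pos
      gcongr
      refine (norm_add_le _ _).trans (add_le_add ?_ ?_)
      · rw [norm_div, norm_mul]
        simp only [Complex.norm_ofNat]
        gcongr
        refine (norm_pairC_le' B _ _).trans ?_
        rw [norm_cR]; gcongr
      · refine (norm_pairC_le' B _ _).trans ?_
        rw [norm_cR]; gcongr
    · refine (norm_add_le _ _).trans ?_
      rw [norm_smul, norm_cR]; gcongr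
  · rw [← (bEquiv hB).summable_iff]
    refine ((tterm_summable hB _ hs' (s⁻¹ • w)).of_norm.mul_left ((s ^ 12)⁻¹ * eC (-(pairC B w w / (2 * s))))).congr fun ℓ => ?_
    exact (hint ℓ).symm

end theta

/-! ### Part 11: the discriminant group and classes -/

section discr

variable {B : Matrix (Fin 24) (Fin 24) ℤ} {t : ℕ} [NeZero t]

abbrev ZT (t : ℕ) := Fin 24 → ZMod t

def red (t : ℕ) (ℓ : LV) : ZT t := fun i => (ℓ i : ZMod t)

def lft (h : ZT t) : LV := fun i => ((h i).val : ℤ)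

lemma red_lft (h : ZT t) : red t (lft h) = h := by ext i; simp [red, lft]

lemma red_add_smul (x w : LV) : red t (x + (t : ℤ) • w) = red t x := by ext i; simp [red]

lemma red_eq {x y : LV} (h : red t x = red t y) : ∃ w : LV, x = y + (t : ℤ) • w := by
  have : ∀ i, ∃ w : ℤ, x i - y i = t * w := fun i => by
    have := congrFun h i
    simp only [red] at this
    rw [← sub_eq_zero, ← Int.cast_sub, ZMod.intCast_zmod_eq_zero_iff_dvd] at this
    exact this
  choose w hw using this
  exact ⟨w, by ext i; simp [← hw]⟩

def actT (σ : Matrix (Fin 24) (Fin 24) ℤ) (h : ZT t) : ZT t := σ.map (Int.cast : ℤ → ZMod t) *ᵥ h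

lemma red_mulVec (σ : Matrix (Fin 24) (Fin 24) ℤ) (ℓ : LV) : red t (σ *ᵥ ℓ) = actT σ (red t ℓ) := by
  ext i; simp [red, actT, Matrix.mulVec, dotProduct]

def pT (B : Matrix (Fin 24) (Fin 24) ℤ) (x y : ZT t) : ZMod t := x ⬝ᵥ (B.map (Int.cast : ℤ → ZMod t) *ᵥ y)

lemma pT_red (x y : LV) : pT B (red t x) (red t y) = (pairZ B x y : ZMod t) := by
  simp [red, pT, pairZ, Matrix.mulVec, dotProduct]

def ch (B : Matrix (Fin 24) (Fin 24) ℤ) (x y : ZT t) : ℂ := ZMod.stdAddChar (-(pT B x y))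

lemma ch_red (x y : LV) : ch B (red t x) (red t y) = eC (-((pairZ B x y : ℂ) / t)) := by
  rw [ch, pT_red, ← Int.cast_neg, ZMod.stdAddChar_coe, eC]
  push_cast; ring_nf

lemma ch_orth (hB : IsLeech B) (x y : ZT t) :
    ∑ h : ZT t, ch B x h * (starRingEnd ℂ) (ch B y h) = if x = y then (t : ℂ) ^ 24 else 0 := by
  classical
  let ψ : AddChar (ZT t) ℂ :=
    { toFun := fun h => ZMod.stdAddChar (pT B (y - x) h)
      map_zero_eq_one' := by simp [pT]
      map_add_eq_mul' := fun a b => by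
        rw [← AddChar.map_add_eq_mul]; congr 1
        simp [pT, Matrix.mulVec_add, dotProduct_add] }
  have e : ∀ h, ch B x h * (starRingEnd ℂ) (ch B y h) = ψ h := by
    intro h
    rw [ch, ch, ← AddChar.map_neg_eq_conj, ← AddChar.map_add_eq_mul]
    change _ = ZMod.stdAddChar (pT B (y - x) h)
    congr 1
    simp only [pT, sub_dotProduct]; ring
  simp only [e]
  rw [AddChar.sum_eq_ite]
  have : ψ = 0 ↔ x = y := by
    constructor
    · intro h0
      have hu : IsUnit (B.map (Int.cast : ℤ → ZMod t)).det := by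
        have : (B.map (Int.cast : ℤ → ZMod t)).det = ((B.det : ℤ) : ZMod t) := by
          have := RingHom.map_det (Int.castRingHom (ZMod t)) B
          simpa using this.symm
        rw [this, hB.2.1]; simp
      have h1 : ∀ v : ZT t, (y - x) ⬝ᵥ v = 0 := by
        intro v
        have h2 : ψ ((B.map (Int.cast : ℤ → ZMod t))⁻¹ *ᵥ v) = 1 := by rw [h0]; rfl
        change ZMod.stdAddChar (pT B (y - x) _) = 1 at h2
        rw [pT, Matrix.mulVec_mulVec, Matrix.mul_nonsing_inv _ hu, Matrix.one_mulVec] at h2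
        apply ZMod.injective_stdAddChar
        rw [h2, AddChar.map_zero_eq_one]
      have h3 : y - x = 0 := dotProduct_eq_zero _ (fun v => h1 v)
      exact (sub_eq_zero.1 h3).symm
    · rintro rfl
      ext h
      change ZMod.stdAddChar (pT B (x - x) h) = 1
      simp [pT]
  simp only [this]
  simp [ZMod.card]

/-- classes of `Λ/tΛ` modulo the Conway group, with minimal representatives -/
structure Cl (B : Matrix (Fin 24) (Fin 24) ℤ) (t : ℕ) (J : Type) where
  c : ZT t → J
  rep : J → LV
  c_rep : ∀ j, c (red t (rep j)) = j
  inv : ∀ σ ∈ ConwayGroup B, ∀ h, c (actT σ h) = c h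
  conj : ∀ x y, c (red t x) = c (red t y) → conjModT B t x y
  min : ∀ x, pairZ B (rep (c (red t x))) (rep (c (red t x))) ≤ pairZ B x x

lemma pairZ_act {σ : Matrix (Fin 24) (Fin 24) ℤ} (hσ : σ ∈ ConwayGroup B) (x y : LV) :
    pairZ B (σ *ᵥ x) (σ *ᵥ y) = pairZ B x y := by
  have h := hσ.2
  simp only [pairZ]
  rw [Matrix.mulVec_mulVec, ← Matrix.vecMul_transpose, ← Matrix.dotProduct_mulVec, Matrix.mulVec_mulVec,
    ← Matrix.mul_assoc, h]

lemma pT_act {σ : Matrix (Fin 24) (Fin 24) ℤ} (hσ : σ ∈ ConwayGroup B) (x y : ZT t) :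
    pT B (actT σ x) (actT σ y) = pT B x y := by
  rw [← red_lft x, ← red_lft y, ← red_mulVec, ← red_mulVec, pT_red, pT_red, pairZ_act hσ]

lemma conway_inv_mem {σ : Matrix (Fin 24) (Fin 24) ℤ} (hσ : σ ∈ ConwayGroup B) : σ⁻¹ ∈ ConwayGroup B := by
  have h1 := Matrix.mul_nonsing_inv σ hσ.1
  refine ⟨by rw [Matrix.isUnit_nonsing_inv_det_iff]; exact hσ.1, ?_⟩
  conv_lhs => rw [← hσ.2]
  rw [Matrix.mul_assoc, Matrix.mul_assoc, h1, Matrix.mul_one, ← Matrix.mul_assoc, ← Matrix.transpose_mul, h1]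
  simp

lemma conway_neg_one : (-1 : Matrix (Fin 24) (Fin 24) ℤ) ∈ ConwayGroup B := by
  refine ⟨?_, by simp⟩
  rw [Matrix.det_neg]; simp

lemma actT_actT (σ τ : Matrix (Fin 24) (Fin 24) ℤ) (h : ZT t) : actT σ (actT τ h) = actT (σ * τ) h := by
  rw [actT, actT, actT, Matrix.mulVec_mulVec]
  congr 1
  ext i j; simp [Matrix.mul_apply]

lemma actT_one (h : ZT t) : actT 1 h = h := by simp [actT]

def actTE {σ : Matrix (Fin 24) (Fin 24) ℤ} (hσ : σ ∈ ConwayGroup B) : ZT t ≃ ZT t where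
  toFun := actT σ
  invFun := actT σ⁻¹
  left_inv h := by rw [actT_actT, Matrix.nonsing_inv_mul _ hσ.1, actT_one]
  right_inv h := by rw [actT_actT, Matrix.mul_nonsing_inv _ hσ.1, actT_one]

variable {J : Type} [Fintype J] [DecidableEq J]

namespace Cl

variable (D : Cl B t J)

/-- kernel -/
def K (j : J) (x : ZT t) : ℂ := ((t : ℂ) ^ 12)⁻¹ * ∑ h : ZT t, if D.c h = j then ch B h x else 0

def N : Matrix J J ℂ := fun i j => D.K i (red t (D.rep j))

def cl (ℓ : LV) : J := D.c (red t ℓ)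

lemma K_act {σ : Matrix (Fin 24) (Fin 24) ℤ} (hσ : σ ∈ ConwayGroup B) (j : J) (x : ZT t) :
    D.K j (actT σ x) = D.K j x := by
  rw [K, K]; congr 1
  rw [← Equiv.sum_comp (actTE (t := t) hσ)]
  refine Finset.sum_congr rfl fun h _ => ?_
  change (if D.c (actT σ h) = j then ch B (actT σ h) (actT σ x) else 0) = _
  rw [D.inv σ hσ, ch, ch, pT_act hσ]

lemma K_eq (j : J) (ℓ : LV) : D.K j (red t ℓ) = D.N j (D.cl ℓ) := by
  rw [N]
  obtain ⟨σ, hσ, w, hw⟩ := D.conj ℓ (D.rep (D.cl ℓ)) (by rw [D.c_rep]; rfl)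
  have : ℓ = σ *ᵥ D.rep (D.cl ℓ) + (t : ℤ) • w := by rw [← hw]; abel
  conv_lhs => rw [this]
  rw [red_add_smul, red_mulVec, D.K_act hσ]

/-- fibre sizes -/
def p (j : J) : ℝ := ∑ h : ZT t, if D.c h = j then 1 else 0

lemma p_pos (j : J) : 0 < D.p j := by
  refine Finset.sum_pos' (fun h _ => by split_ifs <;> norm_num) ⟨red t (D.rep j), Finset.mem_univ _, ?_⟩
  rw [if_pos (D.c_rep j)]; exact one_pos

lemma sum_fib (F : J → ℂ) : ∑ h : ZT t, F (D.c h) = ∑ j, (D.p j : ℂ) * F j := by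
  simp only [p]
  push_cast
  simp only [Finset.sum_mul]
  rw [Finset.sum_comm]
  refine Finset.sum_congr rfl fun h _ => ?_
  rw [Finset.sum_eq_single (D.c h)]
  · simp
  · intro j _ hj; rw [if_neg (Ne.symm hj)]; simp
  · intro h; exact absurd (Finset.mem_univ _) h

lemma N_iso (hB : IsLeech B) :
    D.N * diagonal (fun j => (D.p j : ℂ)) * (D.N)ᴴ = diagonal (fun j => (D.p j : ℂ)) := by
  ext i j
  have h1 : (D.N * diagonal (fun j => (D.p j : ℂ)) * (D.N)ᴴ) i j =
      ∑ h : ZT t, D.K i h * (starRingEnd ℂ) (D.K j h) := by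
    have : ∀ h : ZT t, D.K i h * (starRingEnd ℂ) (D.K j h) =
        (fun l => D.N i l * (starRingEnd ℂ) (D.N j l)) (D.c h) := by
      intro h
      have := D.K_eq i (lft h)
      have h2 := D.K_eq j (lft h)
      rw [cl, red_lft] at this h2
      rw [this, h2]
    simp only [this]
    rw [D.sum_fib (fun l => D.N i l * (starRingEnd ℂ) (D.N j l)), Matrix.mul_apply]
    refine Finset.sum_congr rfl fun l _ => ?_
    rw [Matrix.mul_diagonal, Matrix.conjTranspose_apply]
    simp only [RCLike.star_def]; ring
  rw [h1]
  have ht : (t : ℂ) ≠ 0 := by exact_mod_cast NeZero.ne t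
  have h2 : ∀ h : ZT t, D.K i h * (starRingEnd ℂ) (D.K j h) = ((t : ℂ) ^ 24)⁻¹ *
      ∑ x : ZT t, ∑ y : ZT t, if D.c x = i then (if D.c y = j then ch B x h * (starRingEnd ℂ) (ch B y h) else 0) else 0 := by
    intro h
    rw [K, K, map_mul, map_sum, mul_mul_mul_comm, Finset.sum_mul_sum]
    congr 1
    · simp; rw [← _root_.mul_inv_rev, ← pow_add]
    · refine Finset.sum_congr rfl fun x _ => Finset.sum_congr rfl fun y _ => ?_
      split_ifs <;> simp
  simp only [h2]
  rw [← Finset.mul_sum, Finset.sum_comm]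
  have h3 : ∀ x : ZT t, ∑ h : ZT t, ∑ y : ZT t,
      (if D.c x = i then (if D.c y = j then ch B x h * (starRingEnd ℂ) (ch B y h) else 0) else 0) =
      if D.c x = i then (if i = j then (t : ℂ) ^ 24 else 0) else 0 := by
    intro x
    rw [Finset.sum_comm]
    split_ifs with h4 h5
    · rw [Finset.sum_eq_single x]
      · rw [← h5, h4]; simp only [if_true]; rw [ch_orth hB, if_pos rfl]
      · intro y _ hy
        by_cases h6 : D.c y = j
        · simp only [h6, if_true]; rw [ch_orth hB, if_neg (Ne.symm hy)]
        · simp [h6]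
      · intro h; exact absurd (Finset.mem_univ _) h
    · refine Finset.sum_eq_zero fun y _ => ?_
      by_cases h6 : D.c y = j
      · simp only [h6, if_true]; rw [ch_orth hB, if_neg]
        rintro rfl; exact h5 (h4.symm.trans h6)
      · simp [h6]
    · simp
  simp only [h3]
  by_cases hij : i = j
  · subst hij
    simp only [if_true, Matrix.diagonal_apply_eq, p]
    rw [Finset.mul_sum]; push_cast
    refine Finset.sum_congr rfl fun x _ => ?_
    split_ifs
    · rw [inv_mul_cancel₀ (pow_ne_zero _ ht)]; simp
    · simp
  · simp [hij]

end Cl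

end discr

/-! ### Part 12: class theta functions -/

lemma pair_unique {B : Matrix (Fin 24) (Fin 24) ℤ} (hB : IsLeech B) {c : LV → ℂ} (hc : Summable fun n => ‖c n‖)
    (h : ∀ x : Fin 24 → ℝ, ∑' n, c n * eC (pairC B (liftC n) (cR x)) = 0) (n : LV) : c n = 0 := by
  have := fourier_unique (c := c ∘ (bEquiv hB).symm) ((bEquiv hB).symm.summable_iff.2 hc) (fun x => ?_) (bEquiv hB n)
  · simpa using this
  · rw [← h x, ← (bEquiv hB).tsum_eq]
    refine tsum_congr fun m => ?_
    simp only [Function.comp, Equiv.symm_apply_apply]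
    rw [← dotC_mulVec hB.1]; rfl

lemma im_div_nat (τ : ℍ) (t : ℕ) [NeZero t] : 0 < ((τ : ℂ) / t).im := by
  have ht : (0 : ℝ) < t := by exact_mod_cast Nat.pos_of_ne_zero (NeZero.ne t)
  rw [Complex.div_natCast_im]
  exact div_pos τ.im_pos ht

section classtheta

variable {B : Matrix (Fin 24) (Fin 24) ℤ} {t : ℕ} [NeZero t]

def splitE (t : ℕ) [NeZero t] : ZT t × LV ≃ LV :=
  Equiv.ofBijective (fun p => lft p.1 + (t : ℤ) • p.2) <| by
    have ht : (t : ℤ) ≠ 0 := by exact_mod_cast NeZero.ne t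
    constructor
    · rintro ⟨h, m⟩ ⟨h', m'⟩ e
      simp only at e
      have h1 := congrArg (red t) e
      rw [red_add_smul, red_add_smul, red_lft, red_lft] at h1
      subst h1
      have h2 := add_left_cancel e
      congr 1
      ext i
      have := congrFun h2 i
      simpa [NeZero.ne t] using this
    · intro ℓ
      obtain ⟨w, hw⟩ := red_eq (x := ℓ) (y := lft (red t ℓ)) (by rw [red_lft])
      exact ⟨(red t ℓ, w), hw.symm⟩

lemma tsum_split {F : LV → ℂ} (hF : Summable F) : ∑' ℓ, F ℓ = ∑ h : ZT t, ∑' m, F (lft h + (t : ℤ) • m) := by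
  have h1 := (splitE t).summable_iff.2 hF
  rw [← (splitE t).tsum_eq]
  exact (Summable.tsum_prod h1).trans (tsum_fintype _)

lemma Th_S (hB : IsLeech B) (h : LV) (τ : ℍ) (z : CV) :
    ∑' m, tterm B ((-1 / (τ : ℂ)) / t) ((τ : ℂ)⁻¹ • z) (h + (t : ℤ) • m) =
      ((t : ℂ) ^ 12)⁻¹ * ((τ : ℂ) ^ 12 * eC (t * pairC B z z / (2 * τ))) *
        ∑' ℓ, eC (-((pairZ B h ℓ : ℂ) / t)) * tterm B (τ / t) z ℓ := by
  have ht : (t : ℂ) ≠ 0 := by exact_mod_cast NeZero.ne t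
  have hτ : (τ : ℂ) ≠ 0 := τ.ne_zero
  have htp : (0 : ℝ) < t := by exact_mod_cast Nat.pos_of_ne_zero (NeZero.ne t)
  set s : ℂ := t * (-1 / (τ : ℂ)) with hs
  set w : CV := ((t : ℂ) / τ) • z + (-1 / (τ : ℂ)) • liftC h with hw
  have hsim : 0 < s.im := by
    rw [hs, ← coe_S_smul, ← Complex.ofReal_natCast, Complex.im_ofReal_mul]
    exact mul_pos htp (ModularGroup.S • τ).im_pos
  have e1 : ∀ m, tterm B ((-1 / (τ : ℂ)) / t) ((τ : ℂ)⁻¹ • z) (h + (t : ℤ) • m) =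
      eC ((-1 / (τ : ℂ)) / t * (pairZ B h h : ℂ) / 2 + (τ : ℂ)⁻¹ * pairC B (liftC h) z) * tterm B s w m := by
    intro m
    rw [tterm, tterm, ← eC_add]
    congr 1
    simp only [hs, hw, liftC_add, liftC_smul, pairC_add_left, pairC_add_right, pairC_smul_left, pairC_smul_right,
      pairZ_add_left, pairZ_add_right, pairZ_smul_left, pairZ_smul_right, pairC_liftC, pairZ_symm hB.1 m h]
    push_cast
    field_simp
    ring
  simp only [e1]
  rw [tsum_mul_left, ← theta, theta_S hB s hsim]
  have e2 : theta B (-1 / s) (s⁻¹ • w) = ∑' ℓ, eC (-((pairZ B h ℓ : ℂ) / t)) * tterm B (τ / t) z ℓ := by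
    rw [theta, ← (Equiv.neg LV).tsum_eq]
    refine tsum_congr fun ℓ => ?_
    rw [tterm, tterm, ← eC_add]
    congr 1
    simp only [Equiv.neg_apply, hs, hw, liftC_neg, pairC_neg_left, pairC_add_right, pairC_smul_right, pairC_liftC,
      pairZ_symm hB.1 h ℓ]
    have : pairZ B (-ℓ) (-ℓ) = pairZ B ℓ ℓ := by
      rw [← neg_one_smul ℤ ℓ, pairZ_smul_left, pairZ_smul_right]; ring
    rw [this]
    field_simp
    ring
  rw [e2, ← mul_assoc]
  congr 1
  rw [mul_left_comm, ← eC_add, ← mul_assoc ((t : ℂ) ^ 12)⁻¹]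
  refine congrArg₂ (· * ·) ?_ (congrArg eC ?_)
  · rw [hs]; field_simp
  · simp only [hs, hw, pairC_add_left, pairC_add_right, pairC_smul_left, pairC_smul_right, pairC_liftC,
      pairC_symm hB.1 z (liftC h)]
    field_simp
    ring

def coE {σ : Matrix (Fin 24) (Fin 24) ℤ} (hσ : σ ∈ ConwayGroup B) : LV ≃ LV :=
  ⟨fun m => σ *ᵥ m, fun m => σ⁻¹ *ᵥ m,
    fun m => by simp only [Matrix.mulVec_mulVec]; rw [Matrix.nonsing_inv_mul _ hσ.1, Matrix.one_mulVec],
    fun m => by simp only [Matrix.mulVec_mulVec]; rw [Matrix.mul_nonsing_inv _ hσ.1, Matrix.one_mulVec]⟩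

lemma pairC_act {σ : Matrix (Fin 24) (Fin 24) ℤ} (hσ : σ ∈ ConwayGroup B) (ℓ : LV) (z : CV) :
    pairC B (liftC (σ *ᵥ ℓ)) (actC σ z) = pairC B (liftC ℓ) z := by
  have e1 : liftC (σ *ᵥ ℓ) = σ.map (Int.cast : ℤ → ℂ) *ᵥ liftC ℓ := by
    ext i; simp [liftC, Matrix.mulVec, dotProduct]
  have e2 : (σ.map (Int.cast : ℤ → ℂ))ᵀ * (B.map (Int.cast : ℤ → ℂ)) * σ.map (Int.cast : ℤ → ℂ) = B.map (Int.cast : ℤ → ℂ) := by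
    have := congrArg (fun M : Matrix (Fin 24) (Fin 24) ℤ => M.map (Int.cast : ℤ → ℂ)) hσ.2
    ext i j
    have := congrFun (congrFun this i) j
    simpa [Matrix.mul_apply] using this
  rw [pairC, pairC, actC, e1, Matrix.mulVec_mulVec, ← Matrix.vecMul_transpose, ← Matrix.dotProduct_mulVec,
    Matrix.mulVec_mulVec, ← Matrix.mul_assoc, e2]

variable {J : Type} [Fintype J] [DecidableEq J]

namespace Cl

variable (D : Cl B t J)

def th (j : J) (τ : ℍ) (z : CV) : ℂ := ∑' ℓ, if D.cl ℓ = j then tterm B (τ / t) z ℓ else 0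

lemma th_summable (hB : IsLeech B) (j : J) (τ : ℍ) (z : CV) :
    Summable fun ℓ => if D.cl ℓ = j then tterm B (τ / t) z ℓ else 0 := by
  refine Summable.of_norm_bounded (tterm_summable hB _ (im_div_nat τ t) z) fun ℓ => ?_
  split_ifs
  · exact le_rfl
  · simp

lemma hasSum_comb (hB : IsLeech B) (a : J → ℂ) (τ : ℍ) (z : CV) :
    HasSum (fun ℓ => a (D.cl ℓ) * tterm B (τ / t) z ℓ) (∑ j, a j * D.th j τ z) := by
  have := hasSum_sum (s := Finset.univ) (fun j _ => ((D.th_summable hB j τ z).hasSum.mul_left (a j)))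
  refine HasSum.congr_of this fun ℓ => ?_
  rw [Finset.sum_eq_single (D.cl ℓ)]
  · simp
  · intro j _ hj; rw [if_neg (Ne.symm hj)]; simp
  · intro h; exact absurd (Finset.mem_univ _) h

lemma comb_unique (hB : IsLeech B) (a : J → ℂ) (τ : ℍ) (h : ∀ z, ∑ j, a j * D.th j τ z = 0) : a = 0 := by
  have key := pair_unique hB (c := fun ℓ => a (D.cl ℓ) * eC ((τ : ℂ) / t * (pairZ B ℓ ℓ : ℂ) / 2)) ?_ ?_
  · ext j
    have := key (D.rep j)
    simp only [mul_eq_zero, eC_ne_zero, or_false] at this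
    rwa [cl, D.c_rep] at this
  · have := (D.hasSum_comb hB a τ 0).summable.norm
    refine this.congr fun ℓ => ?_
    simp [tterm, pairC]
  · intro x
    rw [← h (cR x), ← (D.hasSum_comb hB a τ (cR x)).tsum_eq]
    refine tsum_congr fun ℓ => ?_
    rw [tterm, eC_add, mul_assoc]

structure Good (A : SL(2, ℤ)) (M : Matrix J J ℂ) : Prop where
  iso : M * diagonal (fun j => (D.p j : ℂ)) * Mᴴ = diagonal (fun j => (D.p j : ℂ))
  tr : ∀ τ z j, D.th j (A • τ) ((jfactor A τ)⁻¹ • z) =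
    jfactor A τ ^ 12 * eC (t * slc A * pairC B z z / (2 * jfactor A τ)) * ∑ j', M j j' * D.th j' τ z

lemma good_S (hB : IsLeech B) : D.Good ModularGroup.S D.N := by
  refine ⟨D.N_iso hB, fun τ z j => ?_⟩
  rw [jfactor_S, th, tsum_split (t := t) (D.th_summable hB j _ _), ← (D.hasSum_comb hB (fun j' => D.N j j') τ z).tsum_eq]
  have h1 : ∀ h : ZT t, ∑' m, (if D.cl (lft h + (t : ℤ) • m) = j then
      tterm B (((ModularGroup.S • τ : ℍ) : ℂ) / t) ((τ : ℂ)⁻¹ • z) (lft h + (t : ℤ) • m) else 0) =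
      ((t : ℂ) ^ 12)⁻¹ * ((τ : ℂ) ^ 12 * eC (t * pairC B z z / (2 * τ))) *
        ∑' ℓ, (if D.c h = j then ch B h (red t ℓ) else 0) * tterm B (τ / t) z ℓ := by
    intro h
    have : ∀ m, D.cl (lft h + (t : ℤ) • m) = D.c h := fun m => by rw [cl, red_add_smul, red_lft]
    simp only [this]
    split_ifs
    · rw [coe_S_smul, Th_S hB]
      congr 1
      refine tsum_congr fun ℓ => ?_
      rw [← ch_red, red_lft]
    · simp
  simp only [h1]
  rw [← Finset.mul_sum]
  have h2 : ∀ h : ZT t, Summable fun ℓ => (if D.c h = j then ch B h (red t ℓ) else 0) * tterm B (τ / t) z ℓ := by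
    intro h
    refine Summable.of_norm_bounded (tterm_summable hB _ (im_div_nat τ t) z) fun ℓ => ?_
    rw [norm_mul]
    refine mul_le_of_le_one_left (norm_nonneg _) ?_
    split_ifs
    · rw [ch, AddChar.norm_apply]
    · simp
  rw [← Summable.tsum_finsetSum (fun h _ => h2 h), ← tsum_mul_left, ← tsum_mul_left]
  refine tsum_congr fun ℓ => ?_
  rw [← D.K_eq, K, ← Finset.sum_mul]
  have : slc ModularGroup.S = 1 := by simp [slc, ModularGroup.S]
  rw [this]; ring_nf

lemma th_act (hB : IsLeech B) {σ : Matrix (Fin 24) (Fin 24) ℤ} (hσ : σ ∈ ConwayGroup B) (j : J) (τ : ℍ) (z : CV) :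
    D.th j τ (actC σ z) = D.th j τ z := by
  rw [th, th, ← (coE hσ).tsum_eq]
  refine tsum_congr fun ℓ => ?_
  change (if D.c (red t (σ *ᵥ ℓ)) = j then tterm B (τ / t) (actC σ z) (σ *ᵥ ℓ) else 0) = _
  rw [red_mulVec, D.inv σ hσ]
  have : tterm B (τ / t) (actC σ z) (σ *ᵥ ℓ) = tterm B (τ / t) z ℓ := by
    rw [tterm, tterm, pairZ_act hσ, pairC_act hσ]
  rw [this]; rfl

lemma norm_diff (hB : IsLeech B) (ℓ : LV) : ∃ d : ℕ, pairZ B ℓ ℓ = pairZ B (D.rep (D.cl ℓ)) (D.rep (D.cl ℓ)) + 2 * t * d := by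
  obtain ⟨σ, hσ, w, hw⟩ := D.conj ℓ (D.rep (D.cl ℓ)) (by rw [D.c_rep]; rfl)
  have e : ℓ = σ *ᵥ D.rep (D.cl ℓ) + (t : ℤ) • w := by rw [← hw]; abel
  obtain ⟨v, hv⟩ := hB.2.2.2.1 w
  have h1 : pairZ B ℓ ℓ = pairZ B (D.rep (D.cl ℓ)) (D.rep (D.cl ℓ)) +
      2 * t * (pairZ B (σ *ᵥ D.rep (D.cl ℓ)) w + t * v) := by
    conv_lhs => rw [e]
    rw [pairZ_add_left, pairZ_add_right, pairZ_add_right, pairZ_smul_left, pairZ_smul_left, pairZ_smul_right, pairZ_smul_right,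
      pairZ_act hσ, pairZ_symm hB.1 w, hv]
    ring
  have h2 := D.min ℓ
  change pairZ B (D.rep (D.cl ℓ)) (D.rep (D.cl ℓ)) ≤ _ at h2
  have ht : (0 : ℤ) < t := by exact_mod_cast Nat.pos_of_ne_zero (NeZero.ne t)
  have h3 : 0 ≤ pairZ B (σ *ᵥ D.rep (D.cl ℓ)) w + t * v := by
    by_contra h
    push Not at h
    nlinarith
  obtain ⟨d, hd⟩ := Int.eq_ofNat_of_zero_le h3
  exact ⟨d, by rw [h1, hd]⟩

/-- `m_j = (r,r)/2t` -/
def m (j : J) : ℝ := (pairZ B (D.rep j) (D.rep j) : ℝ) / (2 * t)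

lemma m_nonneg (hB : IsLeech B) (j : J) : 0 ≤ D.m j := by
  have : (0 : ℝ) ≤ (pairZ B (D.rep j) (D.rep j) : ℝ) := by exact_mod_cast pairZ_self_nonneg hB _
  unfold m; positivity

def dd (hB : IsLeech B) (ℓ : LV) : ℕ := (D.norm_diff hB ℓ).choose

lemma dd_spec (hB : IsLeech B) (ℓ : LV) : (pairZ B ℓ ℓ : ℂ) / (2 * t) = D.m (D.cl ℓ) + D.dd hB ℓ := by
  have := (D.norm_diff hB ℓ).choose_spec
  have ht : (t : ℂ) ≠ 0 := by exact_mod_cast NeZero.ne t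
  rw [m, this, dd]
  push_cast
  field_simp

lemma good_tr (hB : IsLeech B) (A : SL(2, ℤ)) (b : ℤ) (h0 : slc A = 0) (h1 : ∀ τ, jfactor A τ = 1)
    (h2 : ∀ τ : ℍ, ((A • τ : ℍ) : ℂ) = τ + b) : D.Good A (diagonal fun j => eC (b * D.m j)) := by
  constructor
  · rw [Matrix.diagonal_conjTranspose, Matrix.diagonal_mul_diagonal, Matrix.diagonal_mul_diagonal]
    congr 1; ext j
    have : ‖eC (b * D.m j)‖ = 1 := by
      rw [norm_eC]; simp
    rw [mul_right_comm, Pi.star_apply, RCLike.star_def, Complex.mul_conj, Complex.normSq_eq_norm_sq, this]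
    simp
  · intro τ z j
    rw [h1, h0]
    simp only [inv_one, one_smul, one_pow, mul_zero, zero_mul, zero_div, eC_zero, one_mul, Matrix.diagonal_apply, ite_mul]
    rw [Finset.sum_ite_eq, if_pos (Finset.mem_univ _), th, th, ← tsum_mul_left]
    refine tsum_congr fun ℓ => ?_
    split_ifs with hj
    · subst hj
      rw [tterm, tterm, h2, ← eC_add]
      have e := D.dd_spec hB ℓ
      have : (((τ : ℂ) + b) / t * (pairZ B ℓ ℓ : ℂ) / 2 + pairC B (liftC ℓ) z) =
        (b * D.m (D.cl ℓ) + ((τ : ℂ) / t * (pairZ B ℓ ℓ : ℂ) / 2 + pairC B (liftC ℓ) z)) + ((b * D.dd hB ℓ : ℤ) : ℂ) := by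
        push_cast
        linear_combination (b : ℂ) * e
      rw [this, eC_add _ ((b * D.dd hB ℓ : ℤ) : ℂ), eC_int, mul_one]
    · simp

lemma good_neg_one (hB : IsLeech B) : D.Good (-1) 1 := by
  constructor
  · simp
  · intro τ z j
    have h1 : jfactor (-1) τ = -1 := by rw [jfactor_neg, jfactor_one]
    have h2 : slc (-1) = 0 := by simp [slc]
    rw [h1, h2, ModularGroup.SL_neg_smul, one_smul]
    have h3 : ((-1 : ℂ)⁻¹) • z = actC (-1) z := by
      ext i; simp [actC, Matrix.mulVec, dotProduct, Matrix.one_apply]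
    rw [h3, D.th_act hB conway_neg_one]
    simp only [Matrix.one_apply, ite_mul, zero_mul, one_mul]
    rw [Finset.sum_ite_eq, if_pos (Finset.mem_univ _)]
    simp only [mul_zero, zero_mul, zero_div, eC_zero]; norm_num

lemma Good.mul {D : Cl B t J} {A C : SL(2, ℤ)} {M L : Matrix J J ℂ} (hA : D.Good A M) (hC : D.Good C L) :
    D.Good (A * C) (M * L) := by
  constructor
  · rw [Matrix.conjTranspose_mul]
    calc _ = M * (L * diagonal (fun j => (D.p j : ℂ)) * Lᴴ) * Mᴴ := by simp only [Matrix.mul_assoc]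
      _ = _ := by rw [hC.iso, hA.iso]
  · intro τ z j
    have hj1 := jfactor_ne_zero A (C • τ)
    have hj2 := jfactor_ne_zero C τ
    rw [jfactor_mul, mul_smul, _root_.mul_inv_rev, mul_comm (jfactor C τ)⁻¹, mul_smul, hA.tr]
    simp only [hC.tr]
    have e1 : ∑ j', M j j' * (jfactor C τ ^ 12 * eC (t * slc C * pairC B z z / (2 * jfactor C τ)) * ∑ i, L j' i * D.th i τ z) =
        jfactor C τ ^ 12 * eC (t * slc C * pairC B z z / (2 * jfactor C τ)) * ∑ i, (M * L) j i * D.th i τ z := by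
      simp only [Matrix.mul_apply, Finset.sum_mul, Finset.mul_sum]
      rw [Finset.sum_comm]
      refine Finset.sum_congr rfl fun i _ => Finset.sum_congr rfl fun j' _ => ?_
      ring
    rw [e1, ← mul_assoc]
    congr 1
    rw [mul_pow, mul_mul_mul_comm, ← eC_add, pairC_smul_left, pairC_smul_right]
    congr 2
    have h3 : slc A + slc C * jfactor A (C • τ) * jfactor C τ = slc (A * C) * jfactor C τ := by
      have h4 := coe_smul_eq C τ
      have hd : ((C 0 0 : ℤ) : ℂ) * ((C 1 1 : ℤ) : ℂ) - ((C 0 1 : ℤ) : ℂ) * ((C 1 0 : ℤ) : ℂ) = 1 := by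
        have := C.det_coe; rw [Matrix.det_fin_two] at this; exact_mod_cast this
      have h5 : slc (A * C) = ((A 1 0 : ℤ) : ℂ) * ((C 0 0 : ℤ) : ℂ) + ((A 1 1 : ℤ) : ℂ) * ((C 1 0 : ℤ) : ℂ) := by
        simp [slc, Matrix.mul_apply, Fin.sum_univ_two]
      have h6 : jfactor A (C • τ) * jfactor C τ = ((A 1 0 : ℤ) : ℂ) * (((C 0 0 : ℤ) : ℂ) * τ + ((C 0 1 : ℤ) : ℂ)) +
          ((A 1 1 : ℤ) : ℂ) * jfactor C τ := by
        rw [← h4]; simp only [jfactor, slc, sld]; ring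
      rw [mul_assoc, h6, h5]
      simp only [jfactor, slc, sld]
      linear_combination (-((A 1 0 : ℤ) : ℂ)) * hd
    field_simp
    linear_combination (t * pairC B z z) * h3

lemma exists_good (hB : IsLeech B) (A : SL(2, ℤ)) : ∃ M, D.Good A M := by
  have hA : A ∈ (Subgroup.closure {ModularGroup.S, ModularGroup.T} : Subgroup SL(2, ℤ)).toSubmonoid := by
    rw [SpecialLinearGroup.SL2Z_generators]; trivial
  rw [Subgroup.closure_toSubmonoid] at hA
  have hneg : (ModularGroup.S)⁻¹ = (-1) * ModularGroup.S := by
    rw [inv_eq_iff_mul_eq_one]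
    decide
  induction hA using Submonoid.closure_induction with
  | mem x hx =>
    simp only [Set.mem_union, Set.mem_insert_iff, Set.mem_singleton_iff, Set.mem_inv] at hx
    rcases hx with (rfl | rfl) | (hx | hx)
    · exact ⟨_, D.good_S hB⟩
    · refine ⟨_, D.good_tr hB _ 1 ?_ jfactor_T fun τ => ?_⟩
      · simp [slc, ModularGroup.T]
      · rw [T_smul]; simp [add_comm]
    · have : x = (-1) * ModularGroup.S := by rw [← hneg, ← hx, inv_inv]
      rw [this]; exact ⟨_, (D.good_neg_one hB).mul (D.good_S hB)⟩
    · have : x = (ModularGroup.T)⁻¹ := by rw [← hx, inv_inv]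
      rw [this]
      have e : ((ModularGroup.T)⁻¹ : SL(2, ℤ)) = ModularGroup.T ^ (-1 : ℤ) := by simp
      refine ⟨_, D.good_tr hB _ (-1) ?_ (fun τ => ?_) fun τ => ?_⟩
      · rw [e, slc, ModularGroup.coe_T_zpow]; simp
      · rw [e, jfactor, slc, sld, ModularGroup.coe_T_zpow]; simp
      · rw [e, UpperHalfPlane.modular_T_zpow_smul]; simp [add_comm]
  | one =>
    have := (D.good_neg_one hB).mul (D.good_neg_one hB)
    exact ⟨1, by simpa using this⟩
  | mul x y _ _ hx hy =>
    obtain ⟨M, hM⟩ := hx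
    obtain ⟨L, hL⟩ := hy
    exact ⟨_, hM.mul hL⟩

lemma Good.unique {D : Cl B t J} (hB : IsLeech B) {A : SL(2, ℤ)} {M L : Matrix J J ℂ} (hA : D.Good A M) (hC : D.Good A L) :
    M = L := by
  ext i j
  have h0 := D.comb_unique hB (fun j => M i j - L i j) UpperHalfPlane.I (fun z => ?_)
  · exact sub_eq_zero.1 (congrFun h0 j)
  · have h1 := (hA.tr UpperHalfPlane.I z i).symm.trans (hC.tr UpperHalfPlane.I z i)
    have h2 := mul_left_cancel₀ (mul_ne_zero (pow_ne_zero _ (jfactor_ne_zero _ _)) (eC_ne_zero _)) h1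
    simp only [sub_mul, Finset.sum_sub_distrib, h2, sub_self]

def MM (hB : IsLeech B) (A : SL(2, ℤ)) : Matrix J J ℂ := (D.exists_good hB A).choose

lemma MM_good (hB : IsLeech B) (A : SL(2, ℤ)) : D.Good A (D.MM hB A) := (D.exists_good hB A).choose_spec

def P : Matrix J J ℂ := diagonal fun j => (D.p j : ℂ)
def Pi : Matrix J J ℂ := diagonal fun j => (D.p j : ℂ)⁻¹

lemma P_Pi : D.P * D.Pi = 1 := by
  rw [P, Pi, Matrix.diagonal_mul_diagonal, ← Matrix.diagonal_one]
  congr 1; ext j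
  exact mul_inv_cancel₀ (by exact_mod_cast (D.p_pos j).ne')

lemma Pi_P : D.Pi * D.P = 1 := mul_eq_one_comm.1 D.P_Pi

lemma good_dual {D : Cl B t J} {A : SL(2, ℤ)} {M : Matrix J J ℂ} (h : D.Good A M) :
    Mᵀ * (D.Pi * M.map (starRingEnd ℂ) * D.P) = 1 := by
  have h1 : M * (D.P * Mᴴ * D.Pi) = 1 := by
    have := h.iso
    change M * D.P * Mᴴ = D.P at this
    rw [← Matrix.mul_assoc, ← Matrix.mul_assoc, this, P_Pi]
  have h2 : (D.P * Mᴴ * D.Pi) * M = 1 := mul_eq_one_comm.1 h1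
  have h3 := congrArg Matrix.transpose h2
  rw [Matrix.transpose_mul, Matrix.transpose_mul, Matrix.transpose_mul, Matrix.transpose_one] at h3
  have e1 : D.Piᵀ = D.Pi := by rw [Pi, Matrix.diagonal_transpose]
  have e2 : D.Pᵀ = D.P := by rw [P, Matrix.diagonal_transpose]
  have e3 : (Mᴴ)ᵀ = M.map (starRingEnd ℂ) := by ext i j; simp
  rw [e1, e2, e3] at h3
  rw [← h3]; simp only [Matrix.mul_assoc]

def rhoM (hB : IsLeech B) (A : SL(2, ℤ)) : Matrix J J ℂ := D.Pi * (D.MM hB A).map (starRingEnd ℂ) * D.P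

lemma rhoM_eq (hB : IsLeech B) {A : SL(2, ℤ)} {M : Matrix J J ℂ} (h : D.Good A M) :
    D.rhoM hB A = D.Pi * M.map (starRingEnd ℂ) * D.P := by
  rw [rhoM, (D.MM_good hB A).unique hB h]

def WDc (hB : IsLeech B) : WD J where
  ρ :=
    { toFun := D.rhoM hB
      map_one' := by
        have := (D.good_neg_one hB).mul (D.good_neg_one hB)
        rw [D.rhoM_eq hB (M := 1) (by simpa using this)]
        rw [Matrix.map_one _ (map_zero _) (map_one _), Matrix.mul_one, D.Pi_P]
      map_mul' := fun A C => by
        rw [D.rhoM_eq hB ((D.MM_good hB A).mul (D.MM_good hB C)), rhoM, rhoM]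
        have : (D.MM hB A * D.MM hB C).map (starRingEnd ℂ) = (D.MM hB A).map (starRingEnd ℂ) * (D.MM hB C).map (starRingEnd ℂ) := by
          ext i j; simp [Matrix.mul_apply]
        rw [this]
        calc _ = D.Pi * (D.MM hB A).map (starRingEnd ℂ) * 1 * ((D.MM hB C).map (starRingEnd ℂ)) * D.P := by
              simp only [Matrix.mul_assoc, Matrix.one_mul]
          _ = _ := by rw [← D.P_Pi]; simp only [Matrix.mul_assoc] }
  p := D.p
  hp := D.p_pos
  iso := fun A => by
    change (D.rhoM hB A)ᴴ * D.P * D.rhoM hB A = D.P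
    have h := good_dual (D.MM_good hB A)
    rw [← rhoM] at h
    have e1 : D.Piᴴ = D.Pi := by rw [Pi, Matrix.diagonal_conjTranspose]; congr 1; ext j; simp
    have e2 : D.Pᴴ = D.P := by rw [P, Matrix.diagonal_conjTranspose]; congr 1; ext j; simp
    have e3 : ((D.MM hB A).map (starRingEnd ℂ))ᴴ = (D.MM hB A)ᵀ := by ext i j; simp
    have e4 : (D.rhoM hB A)ᴴ = D.P * ((D.MM hB A)ᵀ * D.Pi) := by
      rw [rhoM, Matrix.conjTranspose_mul, Matrix.conjTranspose_mul, e1, e2, e3]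
    rw [e4]
    calc _ = D.P * ((D.MM hB A)ᵀ * (D.Pi * D.P) * D.rhoM hB A) := by simp only [Matrix.mul_assoc]
      _ = _ := by rw [D.Pi_P, Matrix.mul_one, h, Matrix.mul_one]
  neg := by
    change D.rhoM hB (-1) = 1
    rw [D.rhoM_eq hB (D.good_neg_one hB), Matrix.map_one _ (map_zero _) (map_one _), Matrix.mul_one, D.Pi_P]
  lam := fun j => (⌈D.m j⌉₊ : ℝ) - D.m j
  lam0 := fun j => sub_nonneg.2 (Nat.le_ceil _)
  lam1 := fun j => by have := Nat.ceil_lt_add_one (D.m_nonneg hB j); linarith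
  hT := by
    change D.rhoM hB ModularGroup.T = _
    rw [D.rhoM_eq hB (D.good_tr hB _ 1 (by simp [slc, ModularGroup.T]) jfactor_T fun τ => by rw [T_smul]; simp [add_comm])]
    rw [Matrix.diagonal_map (map_zero _), Pi, P, Matrix.diagonal_mul_diagonal, Matrix.diagonal_mul_diagonal]
    congr 1; ext j
    have hp : (D.p j : ℂ) ≠ 0 := by exact_mod_cast (D.p_pos j).ne'
    have e : (starRingEnd ℂ) (eC (((1 : ℤ) : ℂ) * D.m j)) = eC (((⌈D.m j⌉₊ : ℝ) - D.m j : ℝ)) := by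
      push_cast
      rw [one_mul, eC_sub, eC_nat, one_div, ← eC_neg, eC, eC, ← Complex.exp_conj]
      congr 1
      simp only [map_mul, Complex.conj_I, Complex.conj_ofReal, map_ofNat]
      ring
    rw [e]; field_simp

end Cl

end classtheta

/-! ### Part 13: Jacobi forms and vector-valued forms -/

section
variable {B : Matrix (Fin 24) (Fin 24) ℤ} {t : ℕ} [NeZero t]

lemma tterm_bound2 (hB : IsLeech B) (a r : ℝ) (ha : 0 < a) : ∃ C > 0, ∀ (s : ℂ) (w : CV), a ≤ s.im → ‖w‖ ≤ r →
    ∀ m, n1 m * ‖tterm B s w m‖ ≤ C * Real.exp (-n1 m) := by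
  obtain ⟨C, hC, h⟩ := tterm_bound hB (a / 2) r (by positivity)
  obtain ⟨C', hC', h'⟩ := hB.bound (π * (a / 2)) 0 (by positivity)
  refine ⟨C * C', by positivity, fun s w hs hw m => ?_⟩
  have e : tterm B s w m = tterm B (s - (a / 2 : ℝ) * Complex.I) w m * eC (((a / 2 : ℝ) * Complex.I) * (pairZ B m m : ℂ) / 2) := by
    rw [tterm, tterm, ← eC_add]; congr 1; ring
  have e2 : ‖eC (((a / 2 : ℝ) * Complex.I) * (pairZ B m m : ℂ) / 2)‖ ≤ C' * Real.exp (-n1 m) := by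
    refine le_trans (le_of_eq ?_) (h' m)
    rw [norm_eC, zero_mul, add_zero]
    congr 1
    rw [show (((a / 2 : ℝ) * Complex.I) * (pairZ B m m : ℂ) / 2) = ((a / 2 * ((pairZ B m m : ℤ) : ℝ) / 2 : ℝ) : ℂ) * Complex.I by push_cast; ring,
      Complex.im_ofReal_mul, Complex.I_im]
    ring
  have e3 := h (s - (a / 2 : ℝ) * Complex.I) w (by rw [Complex.sub_im, Complex.mul_im]; simp; linarith) hw m
  have e4 : n1 m * Real.exp (-n1 m) ≤ 1 := by
    rw [Real.exp_neg, ← div_eq_mul_inv, div_le_one (Real.exp_pos _)]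
    linarith [Real.add_one_le_exp (n1 m)]
  have hn := n1_nonneg m
  rw [e, norm_mul]
  calc n1 m * (‖tterm B (s - (a / 2 : ℝ) * Complex.I) w m‖ * _) ≤ n1 m * ((C * Real.exp (-n1 m)) * (C' * Real.exp (-n1 m))) := by gcongr
    _ = C * C' * Real.exp (-n1 m) * (n1 m * Real.exp (-n1 m)) := by ring
    _ ≤ C * C' * Real.exp (-n1 m) * 1 := by gcongr
    _ = _ := by ring

variable {J : Type} [Fintype J] [DecidableEq J]

namespace Cl

variable (D : Cl B t J)

lemma th_mdiff (hB : IsLeech B) (j : J) (z : CV) : MDifferentiable 𝓘(ℂ) 𝓘(ℂ) (fun τ => D.th j τ z) := by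
  have ht : (0 : ℝ) < t := by exact_mod_cast Nat.pos_of_ne_zero (NeZero.ne t)
  refine mdiff_of_comp (g := fun s => ∑' ℓ, if D.cl ℓ = j then tterm B (s / t) z ℓ else 0) fun s hs => ?_
  obtain ⟨C, hC, h⟩ := tterm_bound hB (s.im / 2 / t) ‖z‖ (by positivity)
  have ho : IsOpen {w : ℂ | s.im / 2 < w.im} := isOpen_lt (f := fun _ => s.im / 2) (g := fun w : ℂ => w.im) continuous_const Complex.continuous_im
  refine (differentiableOn_tsum_of_summable_norm (U := {w : ℂ | s.im / 2 < w.im}) (summable_n1.mul_left C) (fun ℓ => ?_) ho fun ℓ w hw => ?_).differentiableAt (ho.mem_nhds ?_)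
  · split_ifs
    · unfold tterm
      exact (differentiable_eC.comp (by fun_prop)).differentiableOn
    · exact differentiableOn_const _
  · split_ifs
    · refine h _ _ ?_ le_rfl ℓ
      have hw : s.im / 2 < w.im := hw
      rw [Complex.div_natCast_im]
      gcongr
    · rw [norm_zero]; positivity
  · show s.im / 2 < s.im
    linarith

lemma th_zdiff (hB : IsLeech B) (j : J) (τ : ℍ) : Differentiable ℂ (D.th j τ) := by
  intro z
  obtain ⟨C, hC, h⟩ := tterm_bound2 hB ((τ : ℂ) / t).im (‖z‖ + 1) (im_div_nat τ t)
  let L : LV → (CV →L[ℂ] ℂ) := fun ℓ => LinearMap.toContinuousLinearMap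
    { toFun := fun w => pairC B (liftC ℓ) w, map_add' := fun x y => pairC_add_right .., map_smul' := fun c x => pairC_smul_right .. }
  have hL : ∀ ℓ w, L ℓ w = pairC B (liftC ℓ) w := fun _ _ => rfl
  have hLn : ∀ ℓ, ‖L ℓ‖ ≤ bsum B * n1 ℓ := fun ℓ => by
    refine ContinuousLinearMap.opNorm_le_bound _ (mul_nonneg (bsum_nonneg B) (n1_nonneg ℓ)) fun w => ?_
    rw [hL]; refine (norm_pairC_le B ℓ w).trans (le_of_eq (by ring))
  have hd : ∀ x : ℂ, HasDerivAt eC (2 * π * Complex.I * eC x) x := fun x => by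
    unfold eC
    have := ((hasDerivAt_id x).const_mul (2 * π * Complex.I : ℂ)).cexp
    simpa [mul_comm] using this
  refine HasFDerivAt.differentiableAt (f' := ∑' ℓ, (if D.cl ℓ = j then (2 * π * Complex.I * tterm B (τ / t) z ℓ) • L ℓ else 0)) ?_
  refine hasFDerivAt_tsum_of_isPreconnected (𝕜 := ℂ) (s := Metric.ball 0 (‖z‖ + 1)) (x₀ := 0) (u := fun ℓ => 2 * π * bsum B * (C * Real.exp (-n1 ℓ)))
    (f := fun ℓ z => if D.cl ℓ = j then tterm B (τ / t) z ℓ else 0) (f' := fun ℓ z => if D.cl ℓ = j then (2 * π * Complex.I * tterm B (τ / t) z ℓ) • L ℓ else 0)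
    ((summable_n1.mul_left C).mul_left _) Metric.isOpen_ball (convex_ball _ _).isPreconnected ?_ ?_ (by simp; positivity) (D.th_summable hB j τ 0) (by simp)
  · intro ℓ x hx
    split_ifs
    · have h1 : HasFDerivAt (fun x => (τ : ℂ) / t * (pairZ B ℓ ℓ : ℂ) / 2 + L ℓ x) (L ℓ) x := (L ℓ).hasFDerivAt.const_add _
      exact (hd _).comp_hasFDerivAt x h1
    · exact hasFDerivAt_const _ _
  · intro ℓ x hx
    have hb := bsum_nonneg B
    have hx : ‖x‖ < ‖z‖ + 1 := by simpa using hx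
    split_ifs
    · rw [norm_smul, norm_mul]
      have : ‖(2 * π * Complex.I : ℂ)‖ = 2 * π := by simp [abs_of_pos Real.pi_pos]
      rw [this]
      have h1 := h _ x le_rfl hx.le ℓ
      calc 2 * π * ‖tterm B (τ / t) x ℓ‖ * ‖L ℓ‖ ≤ 2 * π * ‖tterm B (τ / t) x ℓ‖ * (bsum B * n1 ℓ) := by
            have := Real.pi_pos; gcongr; exact hLn ℓ
        _ = 2 * π * bsum B * (n1 ℓ * ‖tterm B (τ / t) x ℓ‖) := by ring
        _ ≤ _ := by have := Real.pi_pos; gcongr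
    · rw [norm_zero]; have := Real.pi_pos; positivity

structure GM (hB : IsLeech B) (κ : ℤ) (G : ℍ → J → ℂ) (a : J → PowerSeries ℂ) : Prop where
  mod : ∀ (A : SL(2, ℤ)) τ, G (A • τ) = jfactor A τ ^ κ • (D.rhoM hB A *ᵥ G τ)
  q : ∀ j, HasQ (fun τ => eC (D.m j * τ) * G τ j) (a j)

def Ph (G : ℍ → J → ℂ) (τ : ℍ) (z : CV) : ℂ := ∑ j, G τ j * D.th j τ z

lemma th_quasi (hB : IsLeech B) (j : J) (x y : LV) (τ : ℍ) (z : CV) : D.th j τ (z + (τ : ℂ) • liftC x + liftC y) =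
    eC (-(t * (pairZ B x x : ℂ) * τ / 2) - t * pairC B (liftC x) z) * D.th j τ z := by
  have ht : (t : ℂ) ≠ 0 := by exact_mod_cast NeZero.ne t
  rw [th, ← (Equiv.addRight ((t : ℤ) • (-x))).tsum_eq, th, ← tsum_mul_left]
  refine tsum_congr fun ℓ => ?_
  have hc : D.cl (ℓ + (t : ℤ) • -x) = D.cl ℓ := by rw [cl, cl, red_add_smul]
  simp only [Equiv.coe_addRight, hc]
  split_ifs
  · have e : tterm B (τ / t) (z + (τ : ℂ) • liftC x + liftC y) (ℓ + (t : ℤ) • -x) =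
        eC (-(t * (pairZ B x x : ℂ) * τ / 2) - t * pairC B (liftC x) z) * tterm B (τ / t) z ℓ * eC ((pairZ B ℓ y - t * pairZ B x y : ℤ)) := by
      rw [tterm, tterm, ← eC_add, ← eC_add]
      congr 1
      simp only [← pairC_liftC, liftC_add, liftC_smul, liftC_neg, pairC_add_left, pairC_add_right, pairC_smul_left, pairC_smul_right, pairC_neg_left, pairC_neg_right,
        pairC_symm hB.1 (liftC x) (liftC ℓ)]
      push_cast
      simp only [← pairC_liftC]
      field_simp
      ring
    rw [e, eC_int, mul_one]
  · rw [mul_zero]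

lemma Ph_smul_mdiff {hB : IsLeech B} {κ : ℤ} {G : ℍ → J → ℂ} {a : J → PowerSeries ℂ} (h : D.GM hB κ G a) (j : J) :
    MDifferentiable 𝓘(ℂ) 𝓘(ℂ) (fun τ => G τ j) := by
  have := mdiff_mul (mdiff_eC (-(D.m j))) (h.q j).mdiff
  refine (funext fun τ => ?_ : (fun τ => G τ j) = _) ▸ this
  rw [← mul_assoc, ← eC_add, neg_mul, neg_add_cancel, eC_zero, one_mul]

lemma lemB_modular {hB : IsLeech B} {k : ℤ} {G : ℍ → J → ℂ} {a : J → PowerSeries ℂ} (h : D.GM hB (k - 12) G a)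
    (A : SL(2, ℤ)) (τ : ℍ) (z : CV) : D.Ph G (A • τ) ((jfactor A τ)⁻¹ • z) =
      jfactor A τ ^ k * eC (t * slc A * pairC B z z / (2 * jfactor A τ)) * D.Ph G τ z := by
  have hj := jfactor_ne_zero A τ
  have hM := D.MM_good hB A
  have hd : (D.MM hB A)ᵀ * D.rhoM hB A = 1 := good_dual hM
  simp only [Ph, hM.tr, h.mod]
  have e : ∀ j', ∑ j, (D.rhoM hB A *ᵥ G τ) j * D.MM hB A j j' = G τ j' := fun j' => by
    have := congrFun (congrArg (fun M => M *ᵥ G τ) hd) j'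
    simp only [← Matrix.mulVec_mulVec, Matrix.one_mulVec] at this
    rw [← this]; simp only [Matrix.mulVec, dotProduct, Matrix.transpose_apply]
    exact Finset.sum_congr rfl fun j _ => mul_comm _ _
  have e2 : ∑ j, (D.rhoM hB A *ᵥ G τ) j * ∑ j', D.MM hB A j j' * D.th j' τ z = ∑ j, G τ j * D.th j τ z := by
    simp only [Finset.mul_sum, ← e, Finset.sum_mul]
    rw [Finset.sum_comm]
    exact Finset.sum_congr rfl fun j _ => Finset.sum_congr rfl fun j' _ => by ring
  rw [← e2, Finset.mul_sum]
  refine Finset.sum_congr rfl fun j _ => ?_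
  have : jfactor A τ ^ k = jfactor A τ ^ (k - 12) * jfactor A τ ^ 12 := by
    rw [← zpow_natCast, ← zpow_add₀ hj]; congr 1; push_cast; ring
  simp only [Pi.smul_apply, smul_eq_mul]
  rw [this]; ring

def coe_f (hB : IsLeech B) (a : J → PowerSeries ℂ) (n : ℕ) (ℓ : LV) : ℂ :=
  if D.dd hB ℓ ≤ n then (a (D.cl ℓ)).coeff (n - D.dd hB ℓ) else 0

lemma lemB_exp {hB : IsLeech B} {κ : ℤ} {G : ℍ → J → ℂ} {a : J → PowerSeries ℂ} (h : D.GM hB κ G a) (τ : ℍ) (z : CV) :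
    HasSum (fun p : ℕ × LV => D.coe_f hB a p.1 p.2 * fterm B p.1 p.2 τ z) (D.Ph G τ z) := by
  set F : LV × ℕ → ℂ := fun p => ((a (D.cl p.1)).coeff p.2 * qq τ ^ p.2) * (eC (-(D.m (D.cl p.1) * τ)) * tterm B (τ / t) z p.1) with hF
  have hs : Summable F := by
    have h1 : Summable fun ℓ : LV => (∑ j, ‖eC (-(D.m j * τ))‖) * ‖tterm B (τ / t) z ℓ‖ := (tterm_summable hB _ (im_div_nat τ t) z).mul_left _
    have h2 : Summable fun n : ℕ => ∑ j, ‖(a j).coeff n * qq τ ^ n‖ := summable_sum fun j _ => ((h.q j) τ).summable.norm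
    refine Summable.of_norm_bounded (h1.mul_of_nonneg h2 (fun ℓ => by positivity) (fun n => by positivity)) fun p => ?_
    rw [hF, norm_mul, norm_mul (eC _), mul_comm]
    have a1 : ‖eC (-(D.m (D.cl p.1) * τ))‖ ≤ ∑ j, ‖eC (-(D.m j * τ))‖ :=
      Finset.single_le_sum (f := fun j => ‖eC (-(D.m j * τ))‖) (fun j _ => norm_nonneg _) (Finset.mem_univ _)
    have a2 : ‖(a (D.cl p.1)).coeff p.2 * qq τ ^ p.2‖ ≤ ∑ j, ‖(a j).coeff p.2 * qq τ ^ p.2‖ :=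
      Finset.single_le_sum (f := fun j => ‖(a j).coeff p.2 * qq τ ^ p.2‖) (fun j _ => norm_nonneg _) (Finset.mem_univ _)
    gcongr
  have h3 : HasSum F (D.Ph G τ z) := by
    have := hs.hasSum.prod_fiberwise (g := fun ℓ => G τ (D.cl ℓ) * tterm B (τ / t) z ℓ) fun ℓ => by
      have := ((h.q (D.cl ℓ)) τ).mul_right (eC (-(D.m (D.cl ℓ) * τ)) * tterm B (τ / t) z ℓ)
      have e : eC (D.m (D.cl ℓ) * τ) * G τ (D.cl ℓ) * (eC (-(D.m (D.cl ℓ) * τ)) * tterm B (τ / t) z ℓ) = G τ (D.cl ℓ) * tterm B (τ / t) z ℓ := by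
        rw [show eC (D.m (D.cl ℓ) * τ) * G τ (D.cl ℓ) * (eC (-(D.m (D.cl ℓ) * τ)) * tterm B (τ / t) z ℓ) =
          (eC (D.m (D.cl ℓ) * τ) * eC (-(D.m (D.cl ℓ) * τ))) * (G τ (D.cl ℓ) * tterm B (τ / t) z ℓ) by ring, ← eC_add, add_neg_cancel, eC_zero, one_mul]
      rw [e] at this
      exact this
    rw [Ph, (D.hasSum_comb hB (G τ) τ z).unique this]
    exact hs.hasSum
  have hi : Function.Injective (fun p : LV × ℕ => (p.2 + D.dd hB p.1, p.1)) := by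
    rintro ⟨ℓ, n⟩ ⟨ℓ', n'⟩ h
    simp only [Prod.mk.injEq] at h
    obtain ⟨h1, rfl⟩ := h
    simpa using h1
  refine (hi.hasSum_iff (f := fun p : ℕ × LV => D.coe_f hB a p.1 p.2 * fterm B p.1 p.2 τ z) fun p hp => ?_).1 (HasSum.congr_of h3 fun p => ?_)
  · have : ¬ D.dd hB p.2 ≤ p.1 := fun hle => hp ⟨(p.2, p.1 - D.dd hB p.2), by simp [Nat.sub_add_cancel hle]⟩
    simp only [coe_f, if_neg this, zero_mul]
  · have ht : (t : ℂ) ≠ 0 := by exact_mod_cast NeZero.ne t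
    simp only [Function.comp, coe_f, hF, if_pos (Nat.le_add_left _ _), Nat.add_sub_cancel]
    rw [mul_assoc, fterm, tterm, qq, ← eC_nat_mul, ← eC_add, ← eC_add, ← eC_add]
    congr 2
    rw [show (τ : ℂ) / t * (pairZ B p.1 p.1 : ℂ) / 2 = (pairZ B p.1 p.1 : ℂ) / (2 * t) * τ by field_simp, D.dd_spec hB]
    push_cast; ring

lemma lemB {hB : IsLeech B} {k : ℤ} {G : ℍ → J → ℂ} {a : J → PowerSeries ℂ} (h : D.GM hB (k - 12) G a) :
    IsJacobiFormWith B k t (D.Ph G) (D.coe_f hB a) where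
  holo_tau := fun z => mdiff_sum _ fun j _ => mdiff_mul (D.Ph_smul_mdiff h j) (D.th_mdiff hB j z)
  holo_z := fun τ => Differentiable.fun_sum fun j _ => (D.th_zdiff hB j τ).const_mul _
  conway_invar := fun σ hσ τ z => by simp only [Ph, D.th_act hB hσ]
  quasi_periodic := fun x y τ z => by
    simp only [Ph, D.th_quasi hB, Finset.mul_sum]
    refine Finset.sum_congr rfl fun j _ => ?_
    rw [eC, show 2 * (π : ℂ) * Complex.I * (-(t * (pairZ B x x : ℂ) * τ / 2) - t * pairC B (liftC x) z) =
      -(t : ℂ) * (π : ℂ) * Complex.I * (pairZ B x x : ℂ) * (τ : ℂ) - 2 * (t : ℂ) * (π : ℂ) * Complex.I * pairC B (liftC x) z by ring]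
    ring
  modular := fun A τ z => by
    have hj := jfactor_ne_zero A τ
    rw [D.lemB_modular h, eC]
    congr 3
    field_simp
  expansion := D.lemB_exp h

lemma uniq2 (hB : IsLeech B) {c c' : LV → ℂ} {S : CV → ℂ} (h : ∀ z, HasSum (fun ℓ => c ℓ * eC (pairC B (liftC ℓ) z)) (S z))
    (h' : ∀ z, HasSum (fun ℓ => c' ℓ * eC (pairC B (liftC ℓ) z)) (S z)) (ℓ : LV) : c ℓ = c' ℓ := by
  have h2 : ∀ z, HasSum (fun ℓ => (c ℓ - c' ℓ) * eC (pairC B (liftC ℓ) z)) 0 := fun z => by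
    have := (h z).sub (h' z)
    rw [sub_self] at this
    exact HasSum.congr_of this fun ℓ => by ring
  refine sub_eq_zero.1 (pair_unique hB (c := fun ℓ => c ℓ - c' ℓ) ?_ (fun x => (h2 (cR x)).tsum_eq) ℓ)
  refine (h2 0).summable.norm.congr fun ℓ => ?_
  simp [pairC, eC_zero]

def cc (f : ℕ → LV → ℂ) (τ : ℍ) (ℓ : LV) : ℂ := ∑' n : ℕ, f n ℓ * eC (n * τ)

section
variable {k : ℤ} {φ : ℍ → CV → ℂ} {f : ℕ → LV → ℂ}

lemma cc_hasSum (h : IsJacobiFormWith B k t φ f) (τ : ℍ) (ℓ : LV) : HasSum (fun n : ℕ => f n ℓ * eC (n * τ)) (cc f τ ℓ) := by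
  have h1 := ((Equiv.prodComm LV ℕ).summable_iff.2 (h.expansion τ 0).summable).prod_factor ℓ
  refine (h1.congr fun n => ?_).hasSum
  simp [fterm, pairC, eC_zero]

lemma cc_exp (h : IsJacobiFormWith B k t φ f) (τ : ℍ) (z : CV) :
    HasSum (fun ℓ => cc f τ ℓ * eC (pairC B (liftC ℓ) z)) (φ τ z) := by
  refine HasSum.prod_fiberwise ((Equiv.prodComm LV ℕ).hasSum_iff.2 (h.expansion τ z)) fun ℓ => ?_
  refine HasSum.congr_of ((cc_hasSum h τ ℓ).mul_right (eC (pairC B (liftC ℓ) z))) fun n => ?_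
  simp [fterm, mul_assoc]

lemma cc_act (hB : IsLeech B) (h : IsJacobiFormWith B k t φ f) {σ : Matrix (Fin 24) (Fin 24) ℤ} (hσ : σ ∈ ConwayGroup B) (τ : ℍ) (ℓ : LV) :
    cc f τ (σ *ᵥ ℓ) = cc f τ ℓ := by
  refine uniq2 hB (c := fun ℓ => cc f τ (σ *ᵥ ℓ)) (S := φ τ) (fun z => ?_) (cc_exp h τ) ℓ
  rw [← h.conway_invar σ hσ]
  refine HasSum.congr_of ((coE hσ).hasSum_iff.2 (cc_exp h τ (actC σ z))) fun m => ?_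
  change _ = cc f τ (σ *ᵥ m) * eC (pairC B (liftC (σ *ᵥ m)) (actC σ z))
  rw [pairC_act hσ]

lemma cc_quasi (hB : IsLeech B) (h : IsJacobiFormWith B k t φ f) (x : LV) (τ : ℍ) (ℓ : LV) :
    cc f τ ℓ * eC (τ * pairZ B ℓ x) = eC (-(t * (pairZ B x x : ℂ) * τ / 2)) * cc f τ (ℓ + (t : ℤ) • x) := by
  refine uniq2 hB (c := fun ℓ => cc f τ ℓ * eC (τ * pairZ B ℓ x))
    (c' := fun ℓ => eC (-(t * (pairZ B x x : ℂ) * τ / 2)) * cc f τ (ℓ + (t : ℤ) • x))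
    (S := fun z => φ τ (z + (τ : ℂ) • liftC x + liftC 0)) (fun z => ?_) (fun z => ?_) ℓ
  · refine HasSum.congr_of (cc_exp h τ _) fun m => ?_
    rw [liftC_zero, add_zero, pairC_add_right, pairC_smul_right, pairC_liftC, eC_add]
    ring
  · rw [h.quasi_periodic x 0 τ z, show -(t : ℂ) * (π : ℂ) * Complex.I * (pairZ B x x : ℂ) * (τ : ℂ) - 2 * (t : ℂ) * (π : ℂ) * Complex.I * pairC B (liftC x) z
      = 2 * (π : ℂ) * Complex.I * (-(t * (pairZ B x x : ℂ) * τ / 2) + -(t * pairC B (liftC x) z)) by ring, ← eC]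
    have h1 := (Equiv.addRight ((t : ℤ) • x)).hasSum_iff.2 (cc_exp h τ z)
    refine HasSum.congr_of (h1.mul_left _) fun m => ?_
    change _ = _ * (cc f τ (m + (t : ℤ) • x) * eC (pairC B (liftC (m + (t : ℤ) • x)) z))
    rw [liftC_add, liftC_smul, pairC_add_left, pairC_smul_left, eC_add, eC_add]
    push_cast
    have : eC (-(t * pairC B (liftC x) z)) * eC (t * pairC B (liftC x) z) = 1 := by rw [← eC_add, neg_add_cancel, eC_zero]
    linear_combination (-(eC (-(t * (pairZ B x x : ℂ) * τ / 2)) * cc f τ (m + (t : ℤ) • x) * eC (pairC B (liftC m) z))) * this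

def gg (B : Matrix (Fin 24) (Fin 24) ℤ) (t : ℕ) (f : ℕ → LV → ℂ) (τ : ℍ) (ℓ : LV) : ℂ := eC (-(τ * (pairZ B ℓ ℓ : ℂ) / (2 * t))) * cc f τ ℓ

lemma gg_conj (hB : IsLeech B) (h : IsJacobiFormWith B k t φ f) (τ : ℍ) {v u : LV} (hc : conjModT B t v u) :
    gg B t f τ v = gg B t f τ u := by
  have ht : (t : ℂ) ≠ 0 := by exact_mod_cast NeZero.ne t
  obtain ⟨σ, hσ, x, hx⟩ := hc
  obtain rfl : v = σ *ᵥ u + (t : ℤ) • x := by rw [← hx]; abel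
  rw [gg, gg, ← pairZ_act hσ u u, ← cc_act hB h hσ τ u]
  set ℓ := σ *ᵥ u
  have h1 := cc_quasi hB h x τ ℓ
  have h2 : cc f τ (ℓ + (t : ℤ) • x) = eC (t * (pairZ B x x : ℂ) * τ / 2) * (cc f τ ℓ * eC (τ * pairZ B ℓ x)) := by
    rw [h1, ← mul_assoc, ← eC_add, add_neg_cancel, eC_zero, one_mul]
  rw [h2, show ∀ a b c d : ℂ, a * (b * (c * d)) = (a * b * d) * c by intros; ring, ← eC_add, ← eC_add]
  congr 2
  simp only [pairZ_add_left, pairZ_add_right, pairZ_smul_left, pairZ_smul_right, pairZ_symm hB.1 x ℓ]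
  push_cast
  field_simp
  ring

lemma lemA (hB : IsLeech B) (h : IsJacobiFormWith B k t φ f) :
    ∃ G, D.GM hB (k - 12) G (fun j => PowerSeries.mk fun n => f n (D.rep j)) ∧ φ = D.Ph G := by
  have ht : (t : ℂ) ≠ 0 := by exact_mod_cast NeZero.ne t
  set G : ℍ → J → ℂ := fun τ j => gg B t f τ (D.rep j) with hG
  have hφ : ∀ τ z, φ τ z = ∑ j, G τ j * D.th j τ z := by
    intro τ z
    refine (cc_exp h τ z).unique (HasSum.congr_of (D.hasSum_comb hB (G τ) τ z) fun ℓ => ?_)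
    have : gg B t f τ ℓ = G τ (D.cl ℓ) := gg_conj hB h τ (D.conj ℓ _ (D.c_rep _).symm)
    rw [← this, gg, tterm, eC_add, show ∀ a b c d : ℂ, a * b * (c * d) = (a * c) * (b * d) by intros; ring, ← eC_add,
      show -(τ * (pairZ B ℓ ℓ : ℂ) / (2 * t)) + τ / t * (pairZ B ℓ ℓ : ℂ) / 2 = 0 by field_simp; ring, eC_zero, one_mul]
  refine ⟨G, ⟨fun A τ => ?_, fun j τ => ?_⟩, funext fun τ => funext fun z => hφ τ z⟩
  · have hj := jfactor_ne_zero A τ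
    have hM := D.MM_good hB A
    have hd : D.rhoM hB A * (D.MM hB A)ᵀ = 1 := mul_eq_one_comm.1 (good_dual hM)
    have hk : jfactor A τ ^ k = jfactor A τ ^ (k - 12) * jfactor A τ ^ 12 := by
      rw [← zpow_natCast, ← zpow_add₀ hj]; congr 1; push_cast; ring
    have key : (fun j' => ((D.MM hB A)ᵀ *ᵥ G (A • τ)) j' - jfactor A τ ^ (k - 12) * G τ j') = 0 := by
      refine D.comb_unique hB _ τ fun z => ?_
      have h1 := h.modular A τ z
      rw [hφ, hφ, show (t : ℂ) * π * Complex.I * slc A * pairC B z z / jfactor A τ = 2 * π * Complex.I * (t * slc A * pairC B z z / (2 * jfactor A τ)) by field_simp, ← eC, hk] at h1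
      simp only [hM.tr] at h1
      have e2 : ∑ j, G (A • τ) j * ∑ j', D.MM hB A j j' * D.th j' τ z = ∑ j', ((D.MM hB A)ᵀ *ᵥ G (A • τ)) j' * D.th j' τ z := by
        simp only [Finset.mul_sum, Matrix.mulVec, dotProduct, Matrix.transpose_apply, Finset.sum_mul]
        rw [Finset.sum_comm]
        exact Finset.sum_congr rfl fun j _ => Finset.sum_congr rfl fun j' _ => by ring
      have e3 : jfactor A τ ^ 12 * eC (t * slc A * pairC B z z / (2 * jfactor A τ)) * ∑ j', ((D.MM hB A)ᵀ *ᵥ G (A • τ)) j' * D.th j' τ z =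
          jfactor A τ ^ 12 * eC (t * slc A * pairC B z z / (2 * jfactor A τ)) * (jfactor A τ ^ (k - 12) * ∑ j, G τ j * D.th j τ z) := by
        rw [← e2, Finset.mul_sum]
        refine Eq.trans (Finset.sum_congr rfl fun j _ => ?_) (h1.trans ?_) <;> ring
      have e4 := mul_left_cancel₀ (mul_ne_zero (pow_ne_zero 12 hj) (eC_ne_zero _)) e3
      simp only [sub_mul, Finset.sum_sub_distrib]
      rw [e4, Finset.mul_sum, sub_eq_zero]
      exact Finset.sum_congr rfl fun j _ => by ring
    have key2 : (D.MM hB A)ᵀ *ᵥ G (A • τ) = jfactor A τ ^ (k - 12) • G τ := by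
      ext j; exact sub_eq_zero.1 (congrFun key j)
    rw [← Matrix.mulVec_smul, ← key2, Matrix.mulVec_mulVec, hd, Matrix.one_mulVec]
  · have e : eC (D.m j * τ) * G τ j = cc f τ (D.rep j) := by
      rw [hG]; dsimp only; rw [gg, ← mul_assoc, ← eC_add, m]
      push_cast
      rw [show (pairZ B (D.rep j) (D.rep j) : ℂ) / (2 * t) * τ + -(τ * (pairZ B (D.rep j) (D.rep j) : ℂ) / (2 * t)) = 0 by ring, eC_zero, one_mul]
    dsimp only
    rw [e]
    refine HasSum.congr_of (cc_hasSum h τ _) fun n => ?_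
    rw [PowerSeries.coeff_mk, qq, ← eC_nat_mul]

end

end Cl
end

/-! ### Part 14: dimension count -/

section
variable {B : Matrix (Fin 24) (Fin 24) ℤ} {t : ℕ} [NeZero t] {J : Type} [Fintype J] [DecidableEq J]

namespace Cl

variable (D : Cl B t J)

def nu (j : J) : ℕ := ⌈D.m j⌉₊

lemma GM_vanish {hB : IsLeech B} {κ : ℤ} {G : ℍ → J → ℂ} {a : J → PowerSeries ℂ} (h : D.GM hB κ G a) (M K : ℕ)
    (hM : κ ≤ 12 * M) (hK : ∀ j, D.nu j + M + 1 ≤ K) (h0 : ∀ j, ∀ n < K, (a j).coeff n = 0) : G = 0 := by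
  obtain ⟨n, hn⟩ := Int.eq_ofNat_of_zero_le (sub_nonneg.2 hM)
  have hdl : ∀ τ, dl τ ^ M ≠ 0 := fun τ => pow_ne_zero _ (dl_ne_zero τ)
  have key := vv_vanish D.p D.p_pos (fun τ j => G τ j * (dl τ ^ M)⁻¹) n
    (fun j => mdiff_mul (D.Ph_smul_mdiff h j) (mdiff_inv (mdiff_pow sm_dl.q.mdiff M) hdl)) ?_ ?_
  · funext τ
    have := key τ
    ext j
    have := congrFun this j
    simpa [dl_ne_zero] using this
  · intro A τ
    have hj := jfactor_ne_zero A τ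
    have e := (D.WDc hB).iso' A (G τ)
    change ∑ j, D.p j * ‖(D.rhoM hB A *ᵥ G τ) j‖ ^ 2 = ∑ j, D.p j * ‖G τ j‖ ^ 2 at e
    have e2 : ∀ j, ‖G (A • τ) j * (dl (A • τ) ^ M)⁻¹‖ * ‖jfactor A τ‖ ^ n = ‖(D.rhoM hB A *ᵥ G τ) j‖ * ‖(dl τ ^ M)⁻¹‖ := fun j => by
      rw [← norm_pow, ← norm_mul, ← norm_mul]
      congr 1
      rw [h.mod, sm_dl.mod, Pi.smul_apply, smul_eq_mul, mul_pow, ← zpow_natCast (jfactor A τ ^ (12 : ℤ)) M, ← _root_.zpow_mul, mul_inv, ← _root_.zpow_neg]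
      have : jfactor A τ ^ κ * jfactor A τ ^ (-(12 * (M : ℤ))) * jfactor A τ ^ n = 1 := by
        rw [← zpow_natCast (jfactor A τ) n, ← zpow_add₀ hj, ← zpow_add₀ hj]
        rw [show κ + -(12 * (M : ℤ)) + (n : ℤ) = 0 by linarith, zpow_zero]
      linear_combination ((D.rhoM hB A *ᵥ G τ) j * (dl τ ^ M)⁻¹) * this
    have e3 : (∑ j, D.p j * ‖G (A • τ) j * (dl (A • τ) ^ M)⁻¹‖ ^ 2) * (‖jfactor A τ‖ ^ n) ^ 2 =
        (∑ j, D.p j * ‖(D.rhoM hB A *ᵥ G τ) j‖ ^ 2) * ‖(dl τ ^ M)⁻¹‖ ^ 2 := by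
      rw [Finset.sum_mul, Finset.sum_mul]
      refine Finset.sum_congr rfl fun j _ => ?_
      rw [mul_assoc, ← mul_pow, e2]; ring
    rw [e3, e, Finset.sum_mul]
    refine Finset.sum_congr rfl fun j _ => ?_
    rw [norm_mul]; ring
  · intro j
    obtain ⟨b, hb⟩ := (PowerSeries.X_pow_dvd_iff (n := K)).2 (h0 j)
    have h1 : HasQ (fun τ => (qq τ ^ K)⁻¹ * (eC (D.m j * τ) * G τ j)) b := by
      refine HasQ.of_X_pow_mul K ?_
      rw [← hb]
      exact (h.q j).congr fun τ => by rw [mul_inv_cancel_left₀ (pow_ne_zero _ (qq_ne_zero τ))]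
    have h2 := (h1.mul (uuinv_q.pow M)).tendsto
    have hx : 0 < ((K : ℝ) - M) - D.m j := by
      have h3 : (D.nu j + M + 1 : ℝ) ≤ K := by exact_mod_cast hK j
      have h4 : D.m j ≤ D.nu j := Nat.le_ceil _
      linarith
    have h3 := h2.mul (norm_eC_tendsto hx)
    rw [mul_zero] at h3
    refine h3.congr fun τ => ?_
    have hq := qq_ne_zero τ
    have e : eC ((((K : ℝ) - M) - D.m j : ℝ) * τ) = qq τ ^ K * (qq τ ^ M)⁻¹ * (eC (D.m j * τ))⁻¹ := by
      rw [eq_mul_inv_iff_mul_eq₀ (eC_ne_zero _), eq_mul_inv_iff_mul_eq₀ (pow_ne_zero _ hq), qq, ← eC_nat_mul, ← eC_nat_mul, ← eC_add, ← eC_add]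
      congr 1; push_cast; ring
    rw [e, mul_pow, inv_pow]
    have := eC_ne_zero (D.m j * τ)
    have := hdl τ
    field_simp

def XX (hB : IsLeech B) (κ : ℤ) : Submodule ℂ (ℍ → J → ℂ) where
  carrier := {G | ∃ a, D.GM hB κ G a}
  zero_mem' := ⟨0, fun A τ => by simp, fun j => HasQ.zero.congr fun τ => by simp⟩
  add_mem' := by
    rintro G G' ⟨a, h⟩ ⟨a', h'⟩
    refine ⟨a + a', fun A τ => ?_, fun j => ((h.q j).add (h'.q j)).congr fun τ => ?_⟩
    · simp only [Pi.add_apply, h.mod, h'.mod, Matrix.mulVec_add, smul_add]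
    · simp only [Pi.add_apply]; ring
  smul_mem' := by
    rintro c G ⟨a, h⟩
    refine ⟨fun j => c • a j, fun A τ => ?_, fun j => ((h.q j).smul c).congr fun τ => ?_⟩
    · simp only [Pi.smul_apply, h.mod, Matrix.mulVec_smul]; rw [smul_comm]
    · simp only [Pi.smul_apply, smul_eq_mul]; ring

def co (hB : IsLeech B) (κ : ℤ) : D.XX hB κ →ₗ[ℂ] (J → PowerSeries ℂ) where
  toFun G := G.2.choose
  map_add' G G' := by
    ext1 j
    exact ((G + G').2.choose_spec.q j).unique (((G.2.choose_spec.q j).add (G'.2.choose_spec.q j)).congr fun τ => by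
      simp only [Submodule.coe_add, Pi.add_apply]; ring)
  map_smul' c G := by
    ext1 j
    exact ((c • G).2.choose_spec.q j).unique (((G.2.choose_spec.q j).smul c).congr fun τ => by
      simp only [Submodule.coe_smul, Pi.smul_apply, smul_eq_mul]; ring)

lemma co_spec (hB : IsLeech B) (κ : ℤ) (G : D.XX hB κ) : D.GM hB κ G (D.co hB κ G) := G.2.choose_spec

lemma co_eq (hB : IsLeech B) (κ : ℤ) (G : D.XX hB κ) {a} (h : D.GM hB κ G a) : D.co hB κ G = a := by
  ext1 j; exact ((D.co_spec hB κ G).q j).unique (h.q j)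

lemma XX_fin (hB : IsLeech B) (κ : ℤ) : FiniteDimensional ℂ (D.XX hB κ) := by
  let M := κ.toNat
  let K := (∑ j, D.nu j) + M + 1
  let L : D.XX hB κ →ₗ[ℂ] (J × Fin K → ℂ) :=
    { toFun := fun G p => (D.co hB κ G p.1).coeff p.2
      map_add' := fun G G' => by ext p; simp
      map_smul' := fun c G => by ext p; simp }
  refine FiniteDimensional.of_injective L ((injective_iff_map_eq_zero _).2 fun G hG => Subtype.ext ?_)
  refine D.GM_vanish (D.co_spec hB κ G) M K (by omega) (fun j => ?_) fun j n hn => congrFun hG (j, ⟨n, hn⟩)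
  have := Finset.single_le_sum (f := D.nu) (fun _ _ => Nat.zero_le _) (Finset.mem_univ j)
  omega

def LL (hB : IsLeech B) (κ : ℤ) : D.XX hB κ →ₗ[ℂ] ((Σ j, Fin (D.nu j)) → ℂ) where
  toFun := fun G p => (D.co hB κ G p.1).coeff p.2
  map_add' := fun G G' => by ext p; simp
  map_smul' := fun c G => by ext p; simp

lemma LL_surj (hB : IsLeech B) (κ : ℤ) (hκ : 2 ≤ κ) (he : Even κ) : Function.Surjective (D.LL hB κ) := by
  intro y
  obtain ⟨n, hn⟩ := Int.eq_ofNat_of_zero_le (sub_nonneg.2 hκ)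
  have hne : Even n := by
    have : Even (n : ℤ) := by
      rw [← Int.ofNat_eq_natCast] at *; rw [← hn]; exact he.sub even_two
    exact_mod_cast this
  let c0 : J × ℕ → ℂ := fun x => if h : x.2 < D.nu x.1 then y ⟨x.1, ⟨D.nu x.1 - 1 - x.2, by omega⟩⟩ else 0
  let c : J × ℕ →₀ ℂ := Finsupp.onFinset (Finset.univ ×ˢ Finset.range (∑ j, D.nu j)) c0 (by
    intro x hx
    simp only [Finset.mem_product, Finset.mem_univ, Finset.mem_range, true_and]
    by_contra h
    have := Finset.single_le_sum (f := D.nu) (fun _ _ => Nat.zero_le _) (Finset.mem_univ x.1)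
    exact hx (dif_neg (by omega)))
  have hc : ∀ x, c x = c0 x := fun x => rfl
  obtain ⟨N, G, a, hG, hp⟩ := surj_pp (D.WDc hB) n hne c
  have hA : ∀ j i, (PowerSeries.X ^ (i + 1) * (a j * uu⁻¹ ^ N)).coeff N = c0 (j, i) := fun j i => by
    rw [← ppart_apply, hp, hc]
  have hsh : ∀ (P : PowerSeries ℂ) (r s d : ℕ), (PowerSeries.X ^ (r + d) * P).coeff (s + d) = (PowerSeries.X ^ r * P).coeff s := fun P r s d => by
    rw [add_comm r d, pow_add, mul_assoc, PowerSeries.coeff_X_pow_mul]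
  have hdv : ∀ j, (PowerSeries.X ^ N : PowerSeries ℂ) ∣ PowerSeries.X ^ D.nu j * (a j * uu⁻¹ ^ N) := fun j => by
    refine PowerSeries.X_pow_dvd_iff.2 fun m hm => ?_
    rw [← hsh _ (D.nu j) m (N - m), show m + (N - m) = N by omega,
      show D.nu j + (N - m) = (D.nu j + (N - m) - 1) + 1 by omega, hA]
    exact dif_neg (by dsimp only; omega)
  choose b hb using hdv
  have hdl : ∀ τ, dl τ ^ N ≠ 0 := fun τ => pow_ne_zero _ (dl_ne_zero τ)
  have hGM : D.GM hB κ (fun τ => (dl τ ^ N)⁻¹ • G τ) b := by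
    refine ⟨fun A τ => ?_, fun j => ?_⟩
    · have hj := jfactor_ne_zero A τ
      rw [hG.mod, sm_dl.mod]
      change _ • (_ • D.rhoM hB A *ᵥ G τ) = _
      rw [Matrix.mulVec_smul, smul_smul, smul_smul]
      congr 1
      rw [mul_pow, ← zpow_natCast (jfactor A τ ^ (12 : ℤ)) N, ← _root_.zpow_mul, mul_inv, ← _root_.zpow_neg,
        show κ = -(12 * (N : ℤ)) + ((n + 2 : ℤ) + 12 * N) by push_cast at hn; linarith, zpow_add₀ hj (-(12 * (N : ℤ)))]
      ring
    · refine HasQ.of_X_pow_mul N ?_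
      rw [← hb]
      refine ((HasQ.qq.pow (D.nu j)).mul ((hG.q j).mul (uuinv_q.pow N))).congr fun τ => ?_
      have e : eC (D.m j * τ) = qq τ ^ D.nu j * eC (-((D.WDc hB).lam j * τ)) := by
        change _ = _ * eC (-(((⌈D.m j⌉₊ : ℝ) - D.m j : ℝ) * τ))
        rw [qq, ← eC_nat_mul, ← eC_add]; congr 1; rw [nu]; push_cast; ring
      rw [e, mul_pow, inv_pow]
      simp only [Pi.smul_apply, smul_eq_mul]
      ring
  refine ⟨⟨_, b, hGM⟩, ?_⟩
  ext ⟨j, i⟩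
  change (D.co hB κ ⟨_, b, hGM⟩ j).coeff i = _
  rw [D.co_eq hB κ _ hGM, ← PowerSeries.coeff_X_pow_mul (b j) N i, ← hb]
  have hi := i.2
  have e := hsh (a j * uu⁻¹ ^ N) (D.nu j - i - 1 + 1) N i
  rw [show (D.nu j - i - 1 + 1) + (i : ℕ) = D.nu j by omega] at e
  rw [add_comm (i : ℕ) N, e, hA]
  change dite _ _ _ = _
  rw [dif_pos (by dsimp only; omega)]
  congr 2
  apply Fin.ext
  dsimp only; omega


end Cl
end

/-! ### Part 15: conclusion -/

lemma spanDim_of {W : (ℍ → CV → ℂ) → Prop} {Y : Type*} [AddCommGroup Y] [Module ℂ Y] [FiniteDimensional ℂ Y]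
    (Ψ : Y →ₗ[ℂ] (ℍ → CV → ℂ)) (hi : Function.Injective Ψ) (h : ∀ ψ, W ψ ↔ ∃ y, Ψ y = ψ) :
    SpanDimIs W (Module.finrank ℂ Y) := by
  refine ⟨fun i => Ψ (Module.finBasis ℂ Y i), fun i => (h _).2 ⟨_, rfl⟩,
    (Module.finBasis ℂ Y).linearIndependent.map' Ψ (LinearMap.ker_eq_bot.2 hi), fun ψ hψ => ?_⟩
  obtain ⟨y, rfl⟩ := (h ψ).1 hψ
  refine ⟨fun i => (Module.finBasis ℂ Y).repr y i, ?_⟩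
  conv_lhs => rw [← (Module.finBasis ℂ Y).sum_repr y]
  rw [map_sum]
  exact Finset.sum_congr rfl fun i _ => map_smul _ _ _

lemma spanDim_ker {W : (ℍ → CV → ℂ) → Prop} {Y Z : Type*} [AddCommGroup Y] [Module ℂ Y] [FiniteDimensional ℂ Y]
    [AddCommGroup Z] [Module ℂ Z] (L : Y →ₗ[ℂ] Z)
    (Ψ : Y →ₗ[ℂ] (ℍ → CV → ℂ)) (hi : Function.Injective Ψ) (h : ∀ ψ, W ψ ↔ ∃ y, L y = 0 ∧ Ψ y = ψ) :
    SpanDimIs W (Module.finrank ℂ (LinearMap.ker L)) := by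
  refine spanDim_of (Ψ ∘ₗ (LinearMap.ker L).subtype) (hi.comp (Submodule.subtype_injective _)) fun ψ => ?_
  rw [h]
  constructor
  · rintro ⟨y, h1, h2⟩
    exact ⟨⟨y, h1⟩, h2⟩
  · rintro ⟨y, h2⟩
    exact ⟨y.1, y.2, h2⟩

section
variable {B : Matrix (Fin 24) (Fin 24) ℤ} {t : ℕ} [NeZero t] {J : Type} [Fintype J] [DecidableEq J]

namespace Cl

variable (D : Cl B t J)

def PhL : (ℍ → J → ℂ) →ₗ[ℂ] (ℍ → CV → ℂ) where
  toFun := D.Ph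
  map_add' G G' := by
    funext τ z
    simp only [Ph, Pi.add_apply, add_mul, Finset.sum_add_distrib]
  map_smul' c G := by
    funext τ z
    simp only [Ph, Pi.smul_apply, smul_eq_mul, Finset.mul_sum, mul_assoc, RingHom.id_apply]

lemma PhL_inj (hB : IsLeech B) : Function.Injective D.PhL := by
  refine (injective_iff_map_eq_zero _).2 fun G hG => ?_
  funext τ
  exact D.comb_unique hB (G τ) τ fun z => congrFun (congrFun hG τ) z

lemma lt_nu (j : J) (n : ℕ) : n < D.nu j ↔ 2 * (n : ℤ) * t - pairZ B (D.rep j) (D.rep j) < 0 := by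
  have ht : (0 : ℝ) < t := by exact_mod_cast NeZero.pos t
  rw [nu, Nat.lt_ceil, m, lt_div_iff₀ (by positivity), sub_neg,
    ← Int.cast_lt (R := ℝ)]
  push_cast
  rw [show (n : ℝ) * (2 * t) = 2 * n * t by ring]

lemma weak_iff (hB : IsLeech B) (k : ℤ) (ψ : ℍ → CV → ℂ) : IsWeakJacobiForm B k t ψ ↔
    ∃ y : D.XX hB (k - 12), (D.PhL ∘ₗ (D.XX hB (k - 12)).subtype) y = ψ := by
  constructor
  · rintro ⟨f, hf⟩
    obtain ⟨G, hG, h⟩ := D.lemA hB hf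
    exact ⟨⟨G, _, hG⟩, h.symm⟩
  · rintro ⟨G, rfl⟩
    exact ⟨_, D.lemB (D.co_spec hB _ G)⟩

lemma hol_iff (hB : IsLeech B) (k : ℤ) (ψ : ℍ → CV → ℂ) : IsHolJacobiForm B k t ψ ↔
    ∃ y, D.LL hB (k - 12) y = 0 ∧ (D.PhL ∘ₗ (D.XX hB (k - 12)).subtype) y = ψ := by
  constructor
  · rintro ⟨f, hf, h0⟩
    obtain ⟨G, hG, h⟩ := D.lemA hB hf
    refine ⟨⟨G, _, hG⟩, ?_, h.symm⟩
    ext ⟨j, i⟩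
    change (D.co hB _ ⟨G, _, hG⟩ j).coeff i = 0
    rw [D.co_eq hB _ ⟨G, _, hG⟩ hG, PowerSeries.coeff_mk]
    exact h0 _ _ ((D.lt_nu j i).1 i.2)
  · rintro ⟨G, h0, rfl⟩
    refine ⟨_, D.lemB (D.co_spec hB _ G), fun n ℓ hn => ?_⟩
    rw [coe_f]
    split_ifs with hd
    · have hG : ∀ j, ∀ i (hi : i < D.nu j), (D.co hB _ G j).coeff i = 0 := fun j i hi =>
        congrFun h0 ⟨j, ⟨i, hi⟩⟩
      refine hG _ _ ?_
      have ht : (0 : ℝ) < t := by exact_mod_cast NeZero.pos t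
      have e : (pairZ B ℓ ℓ : ℝ) / (2 * t) = D.m (D.cl ℓ) + D.dd hB ℓ := by
        exact_mod_cast D.dd_spec hB ℓ
      rw [nu, Nat.lt_ceil, Nat.cast_sub hd, sub_lt_iff_lt_add, ← e, lt_div_iff₀ (by positivity)]
      rw [sub_neg, ← Int.cast_lt (R := ℝ)] at hn
      push_cast at hn
      linarith
    · rfl

lemma dim_w (hB : IsLeech B) (k : ℤ) :
    SpanDimIs (IsWeakJacobiForm B k t) (Module.finrank ℂ (D.XX hB (k - 12))) := by
  haveI := D.XX_fin hB (k - 12)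
  refine spanDim_of (D.PhL ∘ₗ (D.XX hB (k - 12)).subtype) ?_ (D.weak_iff hB k)
  rw [LinearMap.coe_comp]
  exact (D.PhL_inj hB).comp (Submodule.subtype_injective _)

lemma dim_h (hB : IsLeech B) (k : ℤ) :
    SpanDimIs (IsHolJacobiForm B k t) (Module.finrank ℂ (LinearMap.ker (D.LL hB (k - 12)))) := by
  haveI := D.XX_fin hB (k - 12)
  refine spanDim_ker (D.LL hB (k - 12)) (D.PhL ∘ₗ (D.XX hB (k - 12)).subtype) ?_ (D.hol_iff hB k)
  rw [LinearMap.coe_comp]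
  exact (D.PhL_inj hB).comp (Submodule.subtype_injective _)

lemma dim_c (hB : IsLeech B) (κ : ℤ) (hke : Even κ) (hk : 2 ≤ κ) :
    Module.finrank ℂ (D.XX hB κ) = Module.finrank ℂ (LinearMap.ker (D.LL hB κ)) + ∑ j, D.nu j := by
  haveI := D.XX_fin hB κ
  have h1 := LinearMap.finrank_range_add_finrank_ker (D.LL hB κ)
  have h3 : Module.finrank ℂ (LinearMap.range (D.LL hB κ)) = ∑ j, D.nu j := by
    rw [LinearMap.range_eq_top.2 (D.LL_surj hB κ hk hke), finrank_top,
      Module.finrank_fintype_fun_eq_card, Fintype.card_sigma]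
    simp only [Fintype.card_fin]
  rw [← h1, add_comm, h3]

lemma dims (hB : IsLeech B) (k : ℤ) (hke : Even k) (hk : 14 ≤ k) : ∃ dw dh : ℕ, SpanDimIs (IsWeakJacobiForm B k t) dw ∧
      SpanDimIs (IsHolJacobiForm B k t) dh ∧ dw = dh + ∑ j, D.nu j := 
  ⟨_, _, D.dim_w hB k, D.dim_h hB k, D.dim_c hB (k - 12) (hke.sub ⟨6, by norm_num⟩) (by linarith)⟩

end Cl

lemma conway_one : (1 : Matrix (Fin 24) (Fin 24) ℤ) ∈ ConwayGroup B := ⟨by simp, by simp⟩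

lemma conway_mul {σ ρ : Matrix (Fin 24) (Fin 24) ℤ} (hσ : σ ∈ ConwayGroup B) (hρ : ρ ∈ ConwayGroup B) :
    σ * ρ ∈ ConwayGroup B := by
  refine ⟨by rw [Matrix.det_mul]; exact hσ.1.mul hρ.1, ?_⟩
  rw [Matrix.transpose_mul, show ρᵀ * σᵀ * B * (σ * ρ) = ρᵀ * (σᵀ * B * σ) * ρ by simp only [Matrix.mul_assoc], hσ.2, hρ.2]

lemma conj_iff {x y : LV} : conjModT B t x y ↔ ∃ σ ∈ ConwayGroup B, red t x = actT σ (red t y) := by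
  constructor
  · rintro ⟨σ, hσ, w, h⟩
    refine ⟨σ, hσ, ?_⟩
    rw [← red_mulVec, sub_eq_iff_eq_add'.1 h, red_add_smul]
  · rintro ⟨σ, hσ, h⟩
    rw [← red_mulVec] at h
    obtain ⟨w, h⟩ := red_eq h
    exact ⟨σ, hσ, w, by rw [h]; simp⟩

lemma conj_refl (x : LV) : conjModT B t x x := ⟨1, conway_one, 0, by simp⟩

lemma conj_symm {x y : LV} (h : conjModT B t x y) : conjModT B t y x := by
  obtain ⟨σ, hσ, w, h⟩ := h
  refine ⟨σ⁻¹, conway_inv_mem hσ, σ⁻¹ *ᵥ (-w), ?_⟩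
  rw [sub_eq_iff_eq_add'.1 h, Matrix.mulVec_add, Matrix.mulVec_mulVec, Matrix.nonsing_inv_mul _ hσ.1, Matrix.one_mulVec,
    Matrix.mulVec_smul, Matrix.mulVec_neg]
  simp

lemma conj_trans {x y z : LV} (h : conjModT B t x y) (h' : conjModT B t y z) : conjModT B t x z := by
  obtain ⟨σ, hσ, w, h⟩ := h
  obtain ⟨ρ, hρ, w', h'⟩ := h'
  refine ⟨σ * ρ, conway_mul hσ hρ, w + σ *ᵥ w', ?_⟩
  rw [sub_eq_iff_eq_add'.1 h, sub_eq_iff_eq_add'.1 h', Matrix.mulVec_add, Matrix.mulVec_mulVec, Matrix.mulVec_smul, smul_add]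
  abel

lemma exists_min (hB : IsLeech B) (x : LV) : ∃ v ∈ minimalSet B t, ∃ w, v = x + (t : ℤ) • w := by
  let f : LV → ℕ := fun w => (pairZ B (x + (t : ℤ) • w) (x + (t : ℤ) • w)).toNat
  obtain ⟨w, hw⟩ : ∃ w, ∀ w', f w ≤ f w' := by
    let w := Function.argmin f
    exact ⟨w, fun w' => Function.argmin_le f w'⟩
  refine ⟨x + (t : ℤ) • w, ?_, w, rfl⟩
  rintro u ⟨w', rfl⟩
  have h := hw (w + w')
  simp only [f] at h
  rw [smul_add, ← add_assoc] at h
  have h1 := pairZ_self_nonneg hB (x + (t : ℤ) • w)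
  have h2 := pairZ_self_nonneg hB (x + (t : ℤ) • w + (t : ℤ) • w')
  omega

lemma conj_of_red {x y : LV} (h : red t x = red t y) : conjModT B t x y :=
  conj_iff.2 ⟨1, conway_one, by rw [← red_mulVec, Matrix.one_mulVec, h]⟩

lemma rep_ex (hB : IsLeech B) {R : Finset LV} (hR : IsRepSystem B t R) (x : LV) : ∃ r : {r // r ∈ R}, conjModT B t x r := by
  obtain ⟨v, hv, w, h⟩ := exists_min (t := t) hB x
  obtain ⟨r, ⟨hr, hc⟩, -⟩ := hR.2 v hv
  exact ⟨⟨r, hr⟩, conj_trans (conj_of_red (by rw [h, red_add_smul])) hc⟩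

lemma rep_un {R : Finset LV} (hR : IsRepSystem B t R) {r s : {r // r ∈ R}} (h : conjModT B t r.1 s.1) : r = s := by
  obtain ⟨q, -, hq⟩ := hR.2 r.1 (hR.1 r.2)
  exact Subtype.ext ((hq r.1 ⟨r.2, conj_refl _⟩).trans (hq s.1 ⟨s.2, h⟩).symm)

def mkCl (hB : IsLeech B) {R : Finset LV} (hR : IsRepSystem B t R) : Cl B t {r // r ∈ R} :=
  have key : ∀ x, conjModT B t x ((rep_ex hB hR (lft (red t x))).choose : {r // r ∈ R}).1 := fun x =>
    conj_trans (conj_of_red (red_lft _).symm) (rep_ex hB hR (lft (red t x))).choose_spec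
  { c := fun h => (rep_ex hB hR (lft h)).choose
    rep := Subtype.val
    c_rep := fun j => (rep_un hR (key j.1)).symm
    inv := fun σ hσ h => by
      have h1 := key (σ *ᵥ lft h)
      have h2 := key (lft h)
      rw [red_mulVec, red_lft] at h1
      rw [red_lft] at h2
      exact rep_un hR (conj_trans (conj_symm h1) (conj_trans ⟨σ, hσ, 0, by simp⟩ h2))
    conj := fun x y h => by
      have h1 := key x
      rw [h] at h1
      exact conj_trans h1 (conj_symm (key y))
    min := fun x => by
      obtain ⟨σ, hσ, w, h⟩ := conj_symm (key x)
      rw [← pairZ_act hσ x x]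
      refine hR.1 (Subtype.property _) _ ⟨-w, ?_⟩
      rw [sub_eq_iff_eq_add'.1 h]; simp }

end

/-- Theorem (Sun–Wang): For every even integer `k ≥ 14` and every index `t ≥ 1`,
`dim J^{w,Co₀}_{k,Λ,t} − dim J^{Co₀}_{k,Λ,t} = δ_t`, where
`δ_t = Σ_{v ∈ (S_t/Co₀)/tΛ} ⌈(v,v)/(2t)⌉` (the sum is over any minimal-norm representative
system `R` of `(S_t/Co₀)/tΛ`). -/
theorem dim_weak_sub_dim_hol_eq_delta
    (B : Matrix (Fin 24) (Fin 24) ℤ) (hB : IsLeech B) (t : ℕ) (ht : 1 ≤ t)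
    (k : ℤ) (hke : Even k) (hk : 14 ≤ k)
    (R : Finset LV) (hR : IsRepSystem B t R) :
    ∃ dw dh : ℕ, SpanDimIs (IsWeakJacobiForm B k t) dw ∧
      SpanDimIs (IsHolJacobiForm B k t) dh ∧
      (dw : ℤ) = (dh : ℤ) + ∑ v ∈ R, Int.ceil ((pairZ B v v : ℚ) / (2 * (t : ℚ))) := by
  haveI : NeZero t := ⟨by omega⟩
  obtain ⟨dw, dh, h1, h2, h3⟩ := (mkCl hB hR).dims hB k hke hk
  refine ⟨dw, dh, h1, h2, ?_⟩
  rw [h3, ← Finset.sum_coe_sort R]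
  push_cast
  congr 1
  refine Finset.sum_congr rfl fun v _ => ?_
  rw [Cl.nu, Int.natCast_ceil_eq_ceil (Cl.m_nonneg _ hB v), ← Rat.ceil_cast (α := ℝ)]
  push_cast
  rfl

end
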